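/- Let (Ω,T) be a minimal aperiodic subshift over a finite alphabet 𝒜 ⊂ ℝ that satisfies Boshernitzan's condition (B). Then there exists a Cantor set Σ ⊆ ℝ of Lebesgue measure zero such that the spectrum of the Schrödinger operator H_ω equals Σ for every ω ∈ Ω. -/

import Mathlib

open Filter MeasureTheory Set

noncomputable section

/-- `SL(2,ℝ)`. -/
abbrev SL2 : Type := Matrix.SpecialLinearGroup (Fin 2) ℝ

/-- The left shift on two-sided sequences. -/
def shift (𝒜 : Type*) : (ℤ → 𝒜) → ℤ → 𝒜 := fun ω n => ω (n + 1)

/-- A subshift: a closed, shift-invariant set of two-sided sequences. -/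
def IsSubshift {𝒜 : Type*} [TopologicalSpace 𝒜] (Ω : Set (ℤ → 𝒜)) : Prop :=
  IsClosed Ω ∧ shift 𝒜 '' Ω = Ω

/-- A minimal subshift: every two-sided orbit is dense. -/
def IsMinimalSubshift {𝒜 : Type*} [TopologicalSpace 𝒜] (Ω : Set (ℤ → 𝒜)) : Prop :=
  IsSubshift Ω ∧ ∀ ω ∈ Ω, Ω ⊆ closure (Set.range fun k : ℤ => fun n : ℤ => ω (n + k))

/-- An aperiodic subshift: no nontrivial shift fixes a point of `Ω`. -/
def IsAperiodicSubshift {𝒜 : Type*} (Ω : Set (ℤ → 𝒜)) : Prop :=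
  ∀ ω ∈ Ω, ∀ n : ℤ, n ≠ 0 → (fun m => ω (m + n)) ≠ ω

/-- The word `w` occurs in `ω` starting at position `k`. -/
def OccursAt {𝒜 : Type*} (ω : ℤ → 𝒜) (w : List 𝒜) (k : ℤ) : Prop :=
  ∀ i : Fin w.length, ω (k + i) = w.get i

/-- `w` belongs to `𝒲(Ω)`, the set of finite words of the subshift `Ω`. -/
def IsWordOf {𝒜 : Type*} (Ω : Set (ℤ → 𝒜)) (w : List 𝒜) : Prop :=
  ∃ ω ∈ Ω, ∃ k : ℤ, OccursAt ω w k

/-- `V_w = {ω ∈ Ω : ω(1)⋯ω(|w|) = w}`. -/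
def Vset {𝒜 : Type*} (Ω : Set (ℤ → 𝒜)) (w : List 𝒜) : Set (ℤ → 𝒜) :=
  {ω ∈ Ω | OccursAt ω w 1}

/-- `U_w = {ω ∈ Ω : w occurs in ω around position one}`. -/
def Uset {𝒜 : Type*} (Ω : Set (ℤ → 𝒜)) (w : List 𝒜) : Set (ℤ → 𝒜) :=
  {ω ∈ Ω | ∃ n : ℕ, n < w.length ∧ OccursAt ω w (1 - n)}

/-- Boshernitzan's condition (B): there are an ergodic probability measure `ν` (concentrated
on `Ω`), a constant `C > 0` and lengths `l n → ∞` with `|w| ν(V_w) ≥ C` whenever `|w| = l n`;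
equivalently `limsup n η_ν(n) > 0`. -/
def CondB {𝒜 : Type*} [MeasurableSpace 𝒜] (Ω : Set (ℤ → 𝒜)) : Prop :=
  ∃ ν : Measure (ℤ → 𝒜), IsProbabilityMeasure ν ∧ ν Ωᶜ = 0 ∧ Ergodic (shift 𝒜) ν ∧
    ∃ C > (0 : ℝ), ∃ l : ℕ → ℕ, Tendsto l atTop atTop ∧
      ∀ n : ℕ, ∀ w : List 𝒜, IsWordOf Ω w → w.length = l n →
        C ≤ (w.length : ℝ) * (ν (Vset Ω w)).toReal

/-- Condition (B'): there are an ergodic probability measure `ν` (concentrated on `Ω`),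
a constant `C' > 0` and lengths `l n → ∞` with `ν(U_w) ≥ C'` whenever `|w| = l n`. -/
def CondB' {𝒜 : Type*} [MeasurableSpace 𝒜] (Ω : Set (ℤ → 𝒜)) : Prop :=
  ∃ ν : Measure (ℤ → 𝒜), IsProbabilityMeasure ν ∧ ν Ωᶜ = 0 ∧ Ergodic (shift 𝒜) ν ∧
    ∃ C > (0 : ℝ), ∃ l : ℕ → ℕ, Tendsto l atTop atTop ∧
      ∀ n : ℕ, ∀ w : List 𝒜, IsWordOf Ω w → w.length = l n →
        C ≤ (ν (Uset Ω w)).toReal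

/-- Unique ergodicity: there is exactly one shift-invariant Borel probability measure
concentrated on `Ω`. -/
def UniquelyErgodicSubshift {𝒜 : Type*} [MeasurableSpace 𝒜] (Ω : Set (ℤ → 𝒜)) : Prop :=
  ∃! ν : Measure (ℤ → 𝒜),
    IsProbabilityMeasure ν ∧ ν Ωᶜ = 0 ∧ MeasurePreserving (shift 𝒜) ν ν

/-- A function on sequences is locally constant (on `Ω`) if its value only depends on
the coordinates `ω(−N)⋯ω(N)` for some `N`. -/
def LocConstOn {𝒜 β : Type*} (Ω : Set (ℤ → 𝒜)) (A : (ℤ → 𝒜) → β) : Prop :=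
  ∃ N : ℕ, ∀ ω ∈ Ω, ∀ ρ ∈ Ω, (∀ i : ℤ, |i| ≤ (N : ℤ) → ω i = ρ i) → A ω = A ρ

/-- The cocycle `A(n,ω) = A(T^{n−1}ω)⋯A(ω)`. -/
def cocycle {𝒜 G : Type*} [Monoid G] (A : (ℤ → 𝒜) → G) : ℕ → (ℤ → 𝒜) → G
  | 0, _ => 1
  | n + 1, ω => A ((shift 𝒜)^[n] ω) * cocycle A n ω

/-- A concrete norm on 2×2 real matrices (the Frobenius norm). -/
def matNorm (M : Matrix (Fin 2) (Fin 2) ℝ) : ℝ :=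
  Real.sqrt (∑ i : Fin 2, ∑ j : Fin 2, (M i j) ^ 2)

/-- `A : Ω → SL(2,ℝ)` is uniform: `(1/n) log‖A(n,ω)‖` converges, uniformly on `Ω`,
to a constant `Λ(A)`. -/
def IsUniformOn {𝒜 : Type*} (Ω : Set (ℤ → 𝒜)) (A : (ℤ → 𝒜) → SL2) : Prop :=
  ∃ Λ : ℝ, TendstoUniformlyOn
    (fun (n : ℕ) (ω : ℤ → 𝒜) =>
      (n : ℝ)⁻¹ * Real.log (matNorm ((cocycle A n ω : SL2) : Matrix (Fin 2) (Fin 2) ℝ)))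
    (fun _ => Λ) atTop Ω

/-- Property (P): every locally constant `SL(2,ℝ)`-valued function on `Ω` is uniform. -/
def PropP {𝒜 : Type*} (Ω : Set (ℤ → 𝒜)) : Prop :=
  ∀ A : (ℤ → 𝒜) → SL2, LocConstOn Ω A → IsUniformOn Ω A

/-- The word `ω(1)⋯ω(n)`. -/
def wordOf {𝒜 : Type*} (ω : ℤ → 𝒜) (n : ℕ) : List 𝒜 :=
  (List.range n).map fun i => ω (1 + i)

/-- A subadditive function on the words of `Ω`. -/
def SubadditiveOn {𝒜 : Type*} (Ω : Set (ℤ → 𝒜)) (F : List 𝒜 → ℝ) : Prop :=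
  ∀ x y : List 𝒜, IsWordOf Ω x → IsWordOf Ω y → IsWordOf Ω (x ++ y) →
    F (x ++ y) ≤ F x + F y

/-- The complexity function `p(n) = #{w ∈ 𝒲(Ω) : |w| = n}`. -/
def complexity {𝒜 : Type*} (Ω : Set (ℤ → 𝒜)) (n : ℕ) : ℕ :=
  Set.ncard {w : List 𝒜 | IsWordOf Ω w ∧ w.length = n}

/-- A right-special word. -/
def RightSpecial {𝒜 : Type*} (Ω : Set (ℤ → 𝒜)) (w : List 𝒜) : Prop :=
  ∃ a b : 𝒜, a ≠ b ∧ IsWordOf Ω (w ++ [a]) ∧ IsWordOf Ω (w ++ [b])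

/-- A left-special word. -/
def LeftSpecial {𝒜 : Type*} (Ω : Set (ℤ → 𝒜)) (w : List 𝒜) : Prop :=
  ∃ a b : 𝒜, a ≠ b ∧ IsWordOf Ω (a :: w) ∧ IsWordOf Ω (b :: w)

/-- `σ ∈ ℬ^ℤ` is the image of `ω ∈ 𝒜^ℤ` under the substitution `S`, with `S(ω(0))`
starting at position `0`. -/
def IsSubstImage {𝒜 ℬ : Type*} (S : 𝒜 → List ℬ) (ω : ℤ → 𝒜) (σ : ℤ → ℬ) : Prop :=
  ∃ c : ℤ → ℤ, c 0 = 0 ∧ (∀ k : ℤ, c (k + 1) = c k + (S (ω k)).length) ∧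
    ∀ k : ℤ, ∀ j : Fin (S (ω k)).length, σ (c k + j) = (S (ω k)).get j

/-- `Ω(S) = {T^k S(ω) : ω ∈ Ω, k ∈ ℤ}`. -/
def SubstSubshift {𝒜 ℬ : Type*} (S : 𝒜 → List ℬ) (Ω : Set (ℤ → 𝒜)) : Set (ℤ → ℬ) :=
  {τ | ∃ ω ∈ Ω, ∃ σ : ℤ → ℬ, IsSubstImage S ω σ ∧ ∃ k : ℤ, τ = fun n => σ (n + k)}

/-- `S` is recognizable with respect to `(Ω,T)`: there is a locally constant
`S̃ : Ω(S) → Ω × ℤ` with `S̃(T^k S(ω)) = (ω,k)` for `0 ≤ k ≤ |S(ω(0))|`. -/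
def Recognizable {𝒜 ℬ : Type*} (S : 𝒜 → List ℬ) (Ω : Set (ℤ → 𝒜)) : Prop :=
  ∃ St : (ℤ → ℬ) → (ℤ → 𝒜) × ℤ, LocConstOn (SubstSubshift S Ω) St ∧
    ∀ ω ∈ Ω, ∀ σ : ℤ → ℬ, IsSubstImage S ω σ →
      ∀ k : ℕ, k ≤ (S (ω 0)).length → St (fun n => σ (n + k)) = (ω, (k : ℤ))

/-- A Cantor set: compact, empty interior, no isolated points. -/
def IsCantorSet (S : Set ℝ) : Prop :=
  IsCompact S ∧ interior S = ∅ ∧ ∀ x ∈ S, AccPt x (Filter.principal S)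

/-- `H` is the Schrödinger operator on `ℓ²(ℤ)` with potential `V`:
`(Hu)(n) = u(n+1) + u(n−1) + V(n)u(n)`. -/
def IsSchrodingerOp (V : ℤ → ℝ)
    (H : lp (fun _ : ℤ => ℝ) 2 →L[ℝ] lp (fun _ : ℤ => ℝ) 2) : Prop :=
  ∀ u : lp (fun _ : ℤ => ℝ) 2, ∀ n : ℤ,
    (H u : ∀ _ : ℤ, ℝ) n = (u : ∀ _ : ℤ, ℝ) (n + 1) + (u : ∀ _ : ℤ, ℝ) (n - 1)
      + V n * (u : ∀ _ : ℤ, ℝ) n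

/-- The circle map potential `V_{α,β,θ}(n) = χ_{[1−β,1)}(nα + θ mod 1)`. -/
def circleV (α β θ : ℝ) : ℤ → ℝ := fun n =>
  (Set.Ico (1 - β) 1).indicator (fun _ => (1 : ℝ)) (Int.fract (n * α + θ))

/-- The coding `v_n(α,β,θ) = χ_{[0,β)}(nα + θ mod 1)` of the rotation by `α`. -/
def circleSeq (α β θ : ℝ) : ℤ → Bool := fun n =>
  if Int.fract (n * α + θ) < β then true else false

/-- The circle map subshift `Ω_{α,β}`. -/
def circleSubshift (α β : ℝ) : Set (ℤ → Bool) :=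
  closure {ω | ∃ θ : ℝ, 0 ≤ θ ∧ θ < 1 ∧ ω = circleSeq α β θ}

/-- The one-step transfer matrix `M^E(ω)`. -/
def transferMat (E : ℝ) (ω : ℤ → ℝ) : Matrix (Fin 2) (Fin 2) ℝ :=
  !![E - ω 1, -1; 1, 0]

/-- The Lyapunov exponent `γ(E) = inf_{n ≥ 1} (1/n) ∫ log‖M^E(n,ω)‖ dμ(ω)`. -/
def lyapunov (μ : Measure (ℤ → ℝ)) (E : ℝ) : ℝ :=
  ⨅ n : ℕ+, ((n : ℕ) : ℝ)⁻¹ *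
    ∫ ω, Real.log (matNorm (cocycle (transferMat E) (n : ℕ) ω)) ∂μ

end

namespace ZeroMeasure

open scoped Topology Pointwise

/-- The Poisson kernel of the upper half-plane. -/
noncomputable def poissonKer (z : ℂ) (t : ℝ) : ℝ :=
  Real.pi⁻¹ * (z.im / ((t - z.re) ^ 2 + z.im ^ 2))

lemma poissonKer_nonneg {z : ℂ} (hz : 0 < z.im) (t : ℝ) : 0 ≤ poissonKer z t := by
  unfold poissonKer; positivity

lemma poissonKer_pos {z : ℂ} (hz : 0 < z.im) (t : ℝ) : 0 < poissonKer z t := by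
  unfold poissonKer
  have : 0 < (t - z.re) ^ 2 + z.im ^ 2 := by positivity
  positivity

lemma poissonKer_le {z : ℂ} (hz : 0 < z.im) (t : ℝ) :
    poissonKer z t ≤ Real.pi⁻¹ * z.im⁻¹ := by
  unfold poissonKer
  gcongr
  rw [div_le_iff₀ (by positivity)]
  field_simp
  nlinarith [sq_nonneg (t - z.re)]

lemma poissonKer_eq {z : ℂ} (hz : 0 < z.im) (t : ℝ) :
    poissonKer z t = Real.pi⁻¹ * (z.im⁻¹ * (1 + ((t - z.re) * z.im⁻¹) ^ 2)⁻¹) := by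
  unfold poissonKer
  have : 0 < (t - z.re) ^ 2 + z.im ^ 2 := by positivity
  have h2 : 0 < 1 + ((t - z.re) * z.im⁻¹) ^ 2 := by positivity
  field_simp
  ring

lemma continuous_poissonKer {z : ℂ} (hz : 0 < z.im) : Continuous (poissonKer z) := by
  unfold poissonKer
  refine continuous_const.mul (continuous_const.div (by fun_prop) fun t => ?_)
  positivity

lemma integrable_poissonKer {z : ℂ} (hz : 0 < z.im) : Integrable (poissonKer z) := by
  have h1 : Integrable fun t : ℝ => (1 + ((t - z.re) * z.im⁻¹) ^ 2)⁻¹ :=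
    (integrable_inv_one_add_sq.comp_mul_right' (inv_ne_zero hz.ne')).comp_sub_right z.re
  exact ((h1.const_mul z.im⁻¹).const_mul Real.pi⁻¹).congr
    (Eventually.of_forall fun t => (poissonKer_eq hz t).symm)

lemma integral_poissonKer {z : ℂ} (hz : 0 < z.im) : ∫ t, poissonKer z t = 1 := by
  simp_rw [poissonKer_eq hz, integral_const_mul]
  rw [integral_sub_right_eq_self (fun t : ℝ => (1 + (t * z.im⁻¹) ^ 2)⁻¹) z.re,
    Measure.integral_comp_mul_right (fun t : ℝ => (1 + t ^ 2)⁻¹) z.im⁻¹,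
    integral_univ_inv_one_add_sq]
  have := Real.pi_pos
  simp [abs_of_pos hz]
  field_simp

/-- The **Poisson formula** for bounded holomorphic functions on the upper half-plane. -/
theorem integral_poissonKer_smul {f : ℂ → ℂ} (hf : DifferentiableOn ℂ f {z | 0 < z.im})
    {C : ℝ} (hC : ∀ z : ℂ, 0 < z.im → ‖f z‖ ≤ C) {ε : ℝ} (hε : 0 < ε) {z : ℂ} (hz : 0 < z.im) :
    ∫ t : ℝ, (poissonKer z t : ℂ) * f (t + ε * Complex.I) = f (z + ε * Complex.I) := by
  set U : Set ℂ := {w | -ε < w.im} with hU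
  have hUo : IsOpen U := isOpen_lt continuous_const Complex.continuous_im
  have him : ∀ w : ℂ, (w + ε * Complex.I).im = w.im + ε := fun w => by simp
  set g : ℂ → ℂ := fun w => f (w + ε * Complex.I) with hg
  have hgd : DifferentiableOn ℂ g U := by
    refine hf.comp (by fun_prop) fun w hw => ?_
    simp only [hU, mem_ofPred_eq] at hw ⊢
    rw [him]; linarith
  have hgC : ∀ w ∈ U, ‖g w‖ ≤ C := fun w hw => hC _ (by
    simp only [hU, mem_ofPred_eq] at hw; rw [him]; linarith)
  have hzU : z ∈ U := by simp only [hU, mem_ofPred_eq]; linarith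
  have hC0 : 0 ≤ C := (norm_nonneg _).trans (hgC z hzU)
  set zb : ℂ := (starRingEnd ℂ) z with hzb
  have hzbim : zb.im = -z.im := by simp [hzb]
  set h : ℂ → ℂ := fun w => dslope g z w / (w - zb) with hh
  have hne : ∀ w : ℂ, 0 ≤ w.im → w - zb ≠ 0 := fun w hw h0 => by
    have := congrArg Complex.im h0
    simp [hzb] at this; linarith
  have hd : DifferentiableOn ℂ h {w | 0 ≤ w.im} := by
    have h1 : DifferentiableOn ℂ (dslope g z) U :=
      (Complex.differentiableOn_dslope (hUo.mem_nhds hzU)).2 hgd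
    refine (h1.mono fun w hw => ?_).div (by fun_prop) fun w hw => hne w hw
    simp only [hU, mem_ofPred_eq] at hw ⊢; linarith
  have hval : ∀ w : ℂ, w ≠ z → h w = (g w - g z) / ((w - z) * (w - zb)) := fun w hw => by
    have : w - z ≠ 0 := sub_ne_zero.2 hw
    simp only [hh]
    rw [dslope_of_ne _ hw, slope_def_field, div_div]
  have hbd : ∀ w : ℂ, 0 ≤ w.im → ∀ R : ℝ, 0 < R → R ≤ ‖w - z‖ → R ≤ ‖w - zb‖ →
      ‖h w‖ ≤ 2 * C / R ^ 2 := fun w hw R hR h1 h2 => by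
    have hwz : w ≠ z := fun h0 => by simp [h0] at h1; linarith
    rw [hval w hwz, norm_div, norm_mul]
    have hwU : w ∈ U := by simp only [hU, mem_ofPred_eq]; linarith
    have : ‖g w - g z‖ ≤ 2 * C := (norm_sub_le _ _).trans (by linarith [hgC w hwU, hgC z hzU])
    rw [sq]; gcongr
  -- the integrand on the real line
  have hreal : ∀ t : ℝ, (poissonKer z t : ℂ) * (g t - g z) = (z.im / Real.pi : ℝ) * h t := by
    intro t
    have htz : (t : ℂ) ≠ z := fun h0 => by
      have := congrArg Complex.im h0; simp at this; linarith
    rw [hval _ htz]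
    have e : ((t : ℂ) - z) * (t - zb) = (((t - z.re) ^ 2 + z.im ^ 2 : ℝ) : ℂ) := by
      apply Complex.ext <;> simp [hzb, sq] <;> ring
    rw [e]; unfold poissonKer
    push_cast
    have : (((t:ℂ) - z.re) ^ 2 + z.im ^ 2) ≠ 0 := by
      have : 0 < (t - z.re) ^ 2 + z.im ^ 2 := by positivity
      exact_mod_cast this.ne'
    have hpi : (Real.pi : ℂ) ≠ 0 := by exact_mod_cast Real.pi_ne_zero
    field_simp
  have hgcont : Continuous fun t : ℝ => g t := by
    have : ContinuousOn g U := hgd.continuousOn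
    refine this.comp_continuous Complex.continuous_ofReal fun t => ?_
    simp [hU, hε]
  have hgint : Integrable fun t : ℝ => (poissonKer z t : ℂ) * g t := by
    refine (integrable_poissonKer hz).ofReal.mul_bdd (c := C) hgcont.aestronglyMeasurable ?_
    exact Eventually.of_forall fun t => hgC _ (by simp [hU, hε])
  have hcint : Integrable fun t : ℝ => (poissonKer z t : ℂ) * g z :=
    (integrable_poissonKer hz).ofReal.mul_const _
  have hdint : Integrable fun t : ℝ => h t := by
    have h1 : Integrable fun t : ℝ => (poissonKer z t : ℂ) * (g t - g z) := by
      simp only [mul_sub]; exact hgint.sub hcint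
    simp_rw [hreal] at h1
    have hne' : ((z.im / Real.pi : ℝ) : ℂ) ≠ 0 := by
      have := Real.pi_pos
      exact_mod_cast (by positivity : z.im / Real.pi ≠ 0)
    have := h1.const_mul (((z.im / Real.pi : ℝ) : ℂ)⁻¹)
    refine this.congr (Eventually.of_forall fun t => ?_)
    simp only
    field_simp
  have hzero : ∫ t : ℝ, h t = 0 := by
    have ht : Tendsto (fun R : ℝ => ∫ t in (z.re - R)..(z.re + R), h t) atTop (𝓝 (∫ t : ℝ, h t)) :=
      intervalIntegral_tendsto_integral hdint
        (tendsto_atBot_add_const_left _ _ tendsto_neg_atTop_atBot)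
        (tendsto_atTop_add_const_left _ _ tendsto_id)
    refine tendsto_nhds_unique ht ?_
    have hlim : Tendsto (fun R : ℝ => (32 * C) * R⁻¹) atTop (𝓝 0) := by
      simpa using tendsto_inv_atTop_zero.const_mul (32 * C)
    refine squeeze_zero_norm' ?_ hlim
    filter_upwards [eventually_gt_atTop (2 * z.im), eventually_gt_atTop 0] with R hR hR0
    have hrect := Complex.integral_boundary_rect_eq_zero_of_differentiableOn h
      (⟨z.re - R, 0⟩ : ℂ) (⟨z.re + R, R⟩ : ℂ) (hd.mono fun w hw => by
        have := hw.2
        simp only [mem_preimage, uIcc_of_le hR0.le] at this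
        exact this.1)
    simp only [Complex.ofReal_zero, zero_mul, add_zero] at hrect
    have key : ∀ w : ℂ, 0 ≤ w.im → (w.im = R ∨ |w.re - z.re| = R) → ‖h w‖ ≤ 8 * C / R ^ 2 := by
      intro w hw hc
      have hb : R / 2 ≤ ‖w - z‖ ∧ R / 2 ≤ ‖w - zb‖ := by
        rcases hc with hc | hc
        · constructor
          · refine le_trans ?_ (Complex.abs_im_le_norm _)
            simp only [Complex.sub_im, hc]
            exact le_trans (by linarith) (le_abs_self _)
          · refine le_trans ?_ (Complex.abs_im_le_norm _)
            simp only [Complex.sub_im, hc, hzbim]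
            exact le_trans (by linarith) (le_abs_self _)
        · constructor
          · refine le_trans ?_ (Complex.abs_re_le_norm _)
            simp only [Complex.sub_re, hc]; linarith
          · refine le_trans ?_ (Complex.abs_re_le_norm _)
            simp only [Complex.sub_re, hzb, Complex.conj_re, hc]; linarith
      refine (hbd w hw (R / 2) (by positivity) hb.1 hb.2).trans (le_of_eq ?_)
      field_simp; ring
    have b1 : ‖∫ x : ℝ in (z.re - R)..(z.re + R), h (x + R * Complex.I)‖
        ≤ 8 * C / R ^ 2 * |z.re + R - (z.re - R)| := by
      refine intervalIntegral.norm_integral_le_of_norm_le_const fun x _ => key _ ?_ (Or.inl ?_)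
      · simp [hR0.le]
      · simp
    have b2 : ‖∫ y : ℝ in (0:ℝ)..R, h ((z.re + R : ℝ) + y * Complex.I)‖
        ≤ 8 * C / R ^ 2 * |R - 0| := by
      refine intervalIntegral.norm_integral_le_of_norm_le_const fun x hx => key _ ?_ (Or.inr ?_)
      · rw [uIoc_of_le hR0.le] at hx; simp [hx.1.le]
      · simp [abs_of_pos hR0]
    have b3 : ‖∫ y : ℝ in (0:ℝ)..R, h ((z.re - R : ℝ) + y * Complex.I)‖
        ≤ 8 * C / R ^ 2 * |R - 0| := by
      refine intervalIntegral.norm_integral_le_of_norm_le_const fun x hx => key _ ?_ (Or.inr ?_)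
      · rw [uIoc_of_le hR0.le] at hx; simp [hx.1.le]
      · simp [abs_of_pos hR0]
    have e1 : |z.re + R - (z.re - R)| = 2 * R := by
      rw [abs_of_pos] <;> linarith
    have e2 : |R - 0| = R := by simp [hR0.le]
    rw [e1] at b1; rw [e2] at b2 b3
    have eq : (∫ t in (z.re - R)..(z.re + R), h t)
        = (∫ x : ℝ in (z.re - R)..(z.re + R), h (x + R * Complex.I))
          - Complex.I • (∫ y : ℝ in (0:ℝ)..R, h ((z.re + R : ℝ) + y * Complex.I))
          + Complex.I • (∫ y : ℝ in (0:ℝ)..R, h ((z.re - R : ℝ) + y * Complex.I)) := by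
      linear_combination hrect
    rw [eq]
    calc _ ≤ 8 * C / R ^ 2 * (2 * R) + 8 * C / R ^ 2 * R + 8 * C / R ^ 2 * R := by
          refine (norm_add_le _ _).trans (add_le_add ((norm_sub_le _ _).trans
            (add_le_add b1 ?_)) ?_)
          · simpa [norm_smul] using b2
          · simpa [norm_smul] using b3
      _ ≤ 32 * C / R := le_of_eq (by field_simp; ring)
      _ = 32 * C * R⁻¹ := by ring
  have hfin : ∫ t : ℝ, (poissonKer z t : ℂ) * (g t - g z) = 0 := by
    simp_rw [hreal, integral_const_mul, hzero, mul_zero]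
  simp only [mul_sub] at hfin
  rw [integral_sub hgint hcint, integral_mul_const, integral_complex_ofReal,
    integral_poissonKer hz] at hfin
  simpa [sub_eq_zero] using hfin

/-- The harmonic measure of `K` seen from `z`. -/
noncomputable def harm (K : Set ℝ) (z : ℂ) : ℝ := ∫ t in K, poissonKer z t

lemma harm_nonneg (K : Set ℝ) {z : ℂ} (hz : 0 < z.im) : 0 ≤ harm K z :=
  integral_nonneg fun t => poissonKer_nonneg hz t

lemma harm_add_compl {K : Set ℝ} (hK : MeasurableSet K) {z : ℂ} (hz : 0 < z.im) :
    harm K z + harm Kᶜ z = 1 := by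
  unfold harm
  rw [integral_add_compl hK (integrable_poissonKer hz), integral_poissonKer hz]

lemma harm_pos {K : Set ℝ} (hv : volume K ≠ 0) {z : ℂ} (hz : 0 < z.im) : 0 < harm K z := by
  unfold harm
  rw [integral_pos_iff_support_of_nonneg (fun t => poissonKer_nonneg hz t)
    (integrable_poissonKer hz).integrableOn]
  have : Function.support (poissonKer z) = univ := by
    ext t; simp [(poissonKer_pos hz t).ne']
  rw [this, Measure.restrict_apply_univ]
  exact pos_iff_ne_zero.2 hv

lemma ofReal_harm (K : Set ℝ) {z : ℂ} (hz : 0 < z.im) :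
    ENNReal.ofReal (harm K z) = ∫⁻ t in K, ENNReal.ofReal (poissonKer z t) :=
  ofReal_integral_eq_lintegral_ofReal (integrable_poissonKer hz).integrableOn
    (Eventually.of_forall fun t => poissonKer_nonneg hz t)

lemma poissonKer_symm (t s ε : ℝ) :
    poissonKer (t + ε * Complex.I) s = poissonKer (s + ε * Complex.I) t := by
  simp only [poissonKer, Complex.add_re, Complex.ofReal_re, Complex.mul_re, Complex.I_re,
    Complex.ofReal_im, Complex.I_im, Complex.add_im, Complex.mul_im]
  ring_nf

lemma measurable_poissonKer_line (ε : ℝ) :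
    Measurable fun p : ℝ × ℝ => poissonKer (p.1 + ε * Complex.I) p.2 := by
  simp only [poissonKer, Complex.add_re, Complex.ofReal_re, Complex.mul_re, Complex.I_re,
    Complex.ofReal_im, Complex.I_im, Complex.add_im, Complex.mul_im]
  fun_prop

lemma lintegral_poissonKer_line {ε : ℝ} (hε : 0 < ε) (t : ℝ) {F : ℝ → ENNReal}
    (hF : Measurable F) :
    ∫⁻ s, ENNReal.ofReal (poissonKer (t + ε * Complex.I) s) * F s =
      ∫⁻ r, ENNReal.ofReal (poissonKer Complex.I r) * F (t + ε * r) := by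
  have hk : Measurable fun s => ENNReal.ofReal (poissonKer (t + ε * Complex.I) s) * F s :=
    ((continuous_poissonKer (z := t + ε * Complex.I)
      (by simpa using hε)).measurable.ennreal_ofReal).mul hF
  have hk2 : Measurable fun a => ENNReal.ofReal (poissonKer (t + ε * Complex.I) ((t + a : ℝ))) *
      F (t + a) := hk.comp (measurable_const_add t)
  rw [← lintegral_add_left_eq_self _ t]
  have h1 := Real.smul_map_volume_mul_left hε.ne'
  conv_lhs => rw [← h1]
  rw [lintegral_smul_measure, lintegral_map hk2
    (measurable_const_mul ε), smul_eq_mul, ← lintegral_const_mul]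
  · refine lintegral_congr fun r => ?_
    rw [← mul_assoc, ← ENNReal.ofReal_mul (abs_nonneg _)]
    congr 2
    simp only [poissonKer, abs_of_pos hε]
    simp
    field_simp
  · exact hk2.comp (measurable_const_mul ε)

lemma tendsto_lintegral_harm {K : Set ℝ} (hK : IsCompact K) :
    Tendsto (fun ε : ℝ => ∫⁻ t in K, ENNReal.ofReal (harm Kᶜ (t + ε * Complex.I)))
      (𝓝[>] 0) (𝓝 0) := by
  have hKm := hK.measurableSet
  have hI : (0 : ℝ) < Complex.I.im := by simp
  set S : ℝ → ENNReal := fun a => volume ((a +ᵥ K) \ K) with hS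
  have hSlim : Tendsto S (𝓝 0) (𝓝 0) := by
    have := tendsto_measure_vadd_sdiff_isCompact_isClosed (μ := (volume : Measure ℝ)) hK hK.isClosed
    simpa using this
  have hSeq : ∀ a, ∫⁻ t in K, (Kᶜ.indicator 1 (t + a) : ENNReal) = S a := by
    intro a
    have hm : MeasurableSet ((fun t : ℝ => t + a) ⁻¹' Kᶜ) :=
      (measurable_add_const a) hKm.compl
    have : (fun t : ℝ => (Kᶜ.indicator 1 (t + a) : ENNReal))
        = ((fun t : ℝ => t + a) ⁻¹' Kᶜ).indicator 1 := by
      ext t; rfl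
    rw [this, lintegral_indicator_one hm, Measure.restrict_apply hm, hS]
    have h2 : (fun t : ℝ => t + a) ⁻¹' Kᶜ ∩ K = (-a) +ᵥ ((a +ᵥ K) \ K) := by
      ext t
      simp [mem_vadd_set_iff_neg_vadd_mem, add_comm, and_comm]
    rw [h2]
    exact measure_vadd _ _ _
  have key : ∀ ε : ℝ, 0 < ε → ∫⁻ t in K, ENNReal.ofReal (harm Kᶜ (t + ε * Complex.I)) =
      ∫⁻ r, ENNReal.ofReal (poissonKer Complex.I r) * S (ε * r) := by
    intro ε hε
    have hmi : Measurable (Kᶜ.indicator (1 : ℝ → ENNReal)) := measurable_one.indicator hKm.compl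
    calc ∫⁻ t in K, ENNReal.ofReal (harm Kᶜ (t + ε * Complex.I))
        = ∫⁻ t in K, ∫⁻ r, ENNReal.ofReal (poissonKer Complex.I r) *
            Kᶜ.indicator 1 (t + ε * r) := by
          refine lintegral_congr fun t => ?_
          rw [ofReal_harm _ (by simpa using hε), ← lintegral_poissonKer_line hε t hmi,
            ← lintegral_indicator hKm.compl]
          refine lintegral_congr fun s => ?_
          by_cases h : s ∈ K <;> simp [h]
      _ = ∫⁻ r, ∫⁻ t in K, ENNReal.ofReal (poissonKer Complex.I r) *
            Kᶜ.indicator 1 (t + ε * r) := by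
          apply lintegral_lintegral_swap
          refine Measurable.aemeasurable ?_
          refine Measurable.mul ?_ ?_
          · exact ((continuous_poissonKer hI).measurable.comp measurable_snd).ennreal_ofReal
          · exact hmi.comp (by fun_prop)
      _ = _ := by
          refine lintegral_congr fun r => ?_
          have h2 : Measurable fun t : ℝ => Kᶜ.indicator (1 : ℝ → ENNReal) (t + ε * r) :=
            hmi.comp (measurable_add_const _)
          rw [lintegral_const_mul _ h2, hSeq]
  have h0 : Tendsto (fun ε : ℝ => ∫⁻ r, ENNReal.ofReal (poissonKer Complex.I r) * S (ε * r))
      (𝓝[>] 0) (𝓝 (∫⁻ r : ℝ, 0)) := by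
    have hSle : ∀ a, S a ≤ volume K := fun a =>
      (measure_mono sdiff_subset).trans (measure_vadd _ _ _).le
    refine tendsto_lintegral_filter_of_dominated_convergence
      (fun r => ENNReal.ofReal (poissonKer Complex.I r) * volume K) ?_ ?_ ?_ ?_
    · refine Eventually.of_forall fun ε => ?_
      refine ((continuous_poissonKer hI).measurable.ennreal_ofReal).mul ?_
      simp_rw [← hSeq]
      have hmi : Measurable (Kᶜ.indicator (1 : ℝ → ENNReal)) := measurable_one.indicator hKm.compl
      have : Measurable fun p : ℝ × ℝ => Kᶜ.indicator (1 : ℝ → ENNReal) (p.2 + ε * p.1) :=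
        hmi.comp (by fun_prop)
      exact this.lintegral_prod_right'
    · exact Eventually.of_forall fun ε => Eventually.of_forall fun r =>
        mul_le_mul_right (hSle _) _
    · rw [lintegral_mul_const _ (continuous_poissonKer hI).measurable.ennreal_ofReal,
        ← ofReal_integral_eq_lintegral_ofReal (integrable_poissonKer hI)
          (Eventually.of_forall fun t => poissonKer_nonneg hI t)]
      exact ENNReal.mul_ne_top ENNReal.ofReal_ne_top hK.measure_lt_top.ne
    · refine Eventually.of_forall fun r => ?_
      have h1 : Tendsto (fun ε : ℝ => ε * r) (𝓝[>] 0) (𝓝 0) := by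
        have : Tendsto (fun ε : ℝ => ε * r) (𝓝 0) (𝓝 (0 * r)) := tendsto_id.mul_const r
        rw [zero_mul] at this
        exact this.mono_left nhdsWithin_le_nhds
      have := ENNReal.Tendsto.const_mul (a := ENNReal.ofReal (poissonKer Complex.I r))
        (hSlim.comp h1) (Or.inr ENNReal.ofReal_ne_top)
      simpa using this
  rw [lintegral_zero] at h0
  refine h0.congr' ?_
  filter_upwards [self_mem_nhdsWithin] with ε hε
  exact (key ε hε).symm

lemma lintegral_harm_symm {K : Set ℝ} {ε : ℝ} (hε : 0 < ε) :
    ∫⁻ t in Kᶜ, ENNReal.ofReal (harm K (t + ε * Complex.I)) =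
      ∫⁻ t in K, ENNReal.ofReal (harm Kᶜ (t + ε * Complex.I)) := by
  have h : ∀ t : ℝ, 0 < (t + ε * Complex.I).im := fun t => by simpa using hε
  simp_rw [ofReal_harm _ (h _)]
  rw [lintegral_lintegral_swap (measurable_poissonKer_line ε).ennreal_ofReal.aemeasurable]
  simp_rw [poissonKer_symm]

/-- The holomorphic completion of the harmonic measure. -/
noncomputable def harmC (K : Set ℝ) (z : ℂ) : ℂ :=
  ∫ t in K, ((Real.pi : ℂ) * Complex.I * ((t : ℂ) - z))⁻¹

lemma im_sub_le_norm (t : ℝ) (z : ℂ) : |z.im| ≤ ‖(t : ℂ) - z‖ := by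
  have := Complex.abs_im_le_norm ((t : ℂ) - z)
  simpa using this

lemma continuous_cauchyKer {z : ℂ} (hz : 0 < z.im) :
    Continuous fun t : ℝ => ((Real.pi : ℂ) * Complex.I * ((t : ℂ) - z))⁻¹ := by
  refine Continuous.inv₀ (by fun_prop) fun t h => ?_
  have h1 : (t : ℂ) - z = 0 := by simpa [Real.pi_ne_zero] using h
  have := im_sub_le_norm t z
  rw [h1, norm_zero, abs_of_pos hz] at this
  linarith

lemma re_harmC {K : Set ℝ} (hK : IsCompact K) {z : ℂ} (hz : 0 < z.im) :
    (harmC K z).re = harm K z := by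
  have hi : IntegrableOn (fun t : ℝ => ((Real.pi : ℂ) * Complex.I * ((t : ℂ) - z))⁻¹) K :=
    (continuous_cauchyKer hz).continuousOn.integrableOn_compact hK
  unfold harmC harm
  rw [← RCLike.re_eq_complex_re, ← integral_re hi]
  refine integral_congr_ae (Eventually.of_forall fun t => ?_)
  simp only [RCLike.re_eq_complex_re, poissonKer, Complex.inv_re, Complex.normSq_apply]
  simp
  have : 0 < (t - z.re) ^ 2 + z.im ^ 2 := by positivity
  have h3 : 0 < z.im * z.im + (t - z.re) * (t - z.re) := by nlinarith
  have := Real.pi_pos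
  field_simp
  ring_nf

lemma differentiableOn_harmC {K : Set ℝ} (hK : IsCompact K) :
    DifferentiableOn ℂ (harmC K) {z | 0 < z.im} := by
  intro z hz
  have hz : 0 < z.im := hz
  refine DifferentiableAt.differentiableWithinAt ?_
  have hball : ∀ w ∈ Metric.ball z (z.im / 2), z.im / 2 ≤ w.im := by
    intro w hw
    have h1 : |(w - z).im| ≤ ‖w - z‖ := Complex.abs_im_le_norm _
    rw [mem_ball_iff_norm] at hw
    have := abs_le.1 (h1.trans hw.le)
    simp only [Complex.sub_im] at this
    linarith [this.1]
  have hne : ∀ w ∈ Metric.ball z (z.im / 2), ∀ t : ℝ, z.im / 2 ≤ ‖(t : ℂ) - w‖ := by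
    intro w hw t
    exact (hball w hw).trans ((le_abs_self _).trans (im_sub_le_norm t w))
  have : IsFiniteMeasure (volume.restrict K) := ⟨by simpa using hK.measure_lt_top⟩
  refine (hasDerivAt_integral_of_dominated_loc_of_deriv_le (μ := volume.restrict K)
    (s := Metric.ball z (z.im / 2))
    (F' := fun w t => ((Real.pi : ℂ) * Complex.I)⁻¹ * (((t : ℂ) - w) ^ 2)⁻¹)
    (bound := fun _ => ‖((Real.pi : ℂ) * Complex.I)⁻¹‖ * ((z.im / 2) ^ 2)⁻¹)
    (Metric.ball_mem_nhds z (by positivity)) ?_ ?_ ?_ ?_ ?_ ?_).2.differentiableAt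
  · filter_upwards [Metric.ball_mem_nhds z (half_pos hz)] with w hw
    exact (continuous_cauchyKer (by linarith [hball w hw])).aestronglyMeasurable
  · exact (continuous_cauchyKer hz).continuousOn.integrableOn_compact hK
  · refine (Continuous.mul continuous_const (Continuous.inv₀ (by fun_prop) fun t h => ?_))
      |>.aestronglyMeasurable
    have := hne z (Metric.mem_ball_self (by positivity)) t
    have h1 : (t : ℂ) - z = 0 := by simpa using h
    rw [h1, norm_zero] at this
    linarith
  · refine Eventually.of_forall fun t w hw => ?_
    rw [norm_mul, norm_inv (((t : ℂ) - w) ^ 2), norm_pow]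
    gcongr
    exact hne w hw t
  · exact integrable_const _
  · refine Eventually.of_forall fun t w hw => ?_
    have h0 : (t : ℂ) - w ≠ 0 := by
      intro h
      have := hne w hw t
      rw [h, norm_zero] at this
      linarith
    have h1 : HasDerivAt (fun w : ℂ => (Real.pi : ℂ) * Complex.I * ((t : ℂ) - w))
        ((Real.pi : ℂ) * Complex.I * (-1)) w :=
      ((hasDerivAt_id w).const_sub _).const_mul _
    have hpi : (Real.pi : ℂ) ≠ 0 := by exact_mod_cast Real.pi_ne_zero
    refine (h1.inv (by simp [h0, Real.pi_ne_zero])).congr_deriv ?_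
    field_simp

/-- A bounded holomorphic function on the upper half-plane whose size is controlled by the
harmonic measure of the complement of a set of positive measure vanishes. -/
theorem eq_zero_of_norm_le_harm {K : Set ℝ} (hK : IsCompact K) (hv : volume K ≠ 0) {g : ℂ → ℂ}
    (hg : DifferentiableOn ℂ g {z | 0 < z.im}) {C c : ℝ} (hc : 0 ≤ c)
    (hC : ∀ z, 0 < z.im → ‖g z‖ ≤ C) (hgc : ∀ z, 0 < z.im → ‖g z‖ ≤ c * harm Kᶜ z)
    {z : ℂ} (hz : 0 < z.im) : g z = 0 := by
  have hKm := hK.measurableSet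
  have hC0 : 0 ≤ C := (norm_nonneg _).trans (hC z hz)
  have hle1 : ∀ w : ℂ, 0 < w.im → harm K w ≤ 1 := fun w hw => by
    linarith [harm_add_compl hKm hw, harm_nonneg Kᶜ hw]
  -- the auxiliary functions are bounded by `C` uniformly in `N`
  have main : ∀ N : ℕ, ‖g z * Complex.exp (N * harmC K z)‖ ≤ C := by
    intro N
    set B : ℂ → ℂ := fun w => g w * Complex.exp (N * harmC K w) with hB
    have hBd : DifferentiableOn ℂ B {z | 0 < z.im} :=
      hg.mul ((differentiableOn_harmC hK).const_mul _).cexp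
    have hBn : ∀ w : ℂ, 0 < w.im → ‖B w‖ = ‖g w‖ * Real.exp (N * harm K w) := by
      intro w hw
      rw [hB]
      simp only [norm_mul, Complex.norm_exp]
      congr 2
      rw [← re_harmC hK hw]
      simp
    have hBb : ∀ w : ℂ, 0 < w.im → ‖B w‖ ≤ C * Real.exp N := by
      intro w hw
      rw [hBn w hw]
      have := hle1 w hw
      gcongr
      · exact hC w hw
      · nlinarith [(Nat.cast_nonneg N : (0:ℝ) ≤ N)]
    set D : ℝ := (c + C) * Real.exp N with hD
    have hD0 : 0 ≤ D := by positivity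
    set ψ : ℝ → ℝ → ENNReal := fun ε t =>
      K.indicator (fun t => ENNReal.ofReal (harm Kᶜ (t + ε * Complex.I))) t +
      Kᶜ.indicator (fun t => ENNReal.ofReal (harm K (t + ε * Complex.I))) t with hψ
    have hline : ∀ ε : ℝ, 0 < ε → ∀ t : ℝ,
        ENNReal.ofReal ‖B (t + ε * Complex.I)‖ ≤
          ENNReal.ofReal C + ENNReal.ofReal D * ψ ε t := by
      intro ε hε t
      have hw : 0 < ((t : ℂ) + ε * Complex.I).im := by simpa using hε
      set w := (t : ℂ) + ε * Complex.I
      rw [hBn w hw]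
      have hsum := harm_add_compl hKm hw
      by_cases ht : t ∈ K
      · have : ψ ε t = ENNReal.ofReal (harm Kᶜ w) := by simp [hψ, ht, w]
        rw [this, ← ENNReal.ofReal_mul hD0,
          ← ENNReal.ofReal_add hC0 (mul_nonneg hD0 (harm_nonneg _ hw))]
        apply ENNReal.ofReal_le_ofReal
        calc ‖g w‖ * Real.exp (N * harm K w) ≤ (c * harm Kᶜ w) * Real.exp N := by
              have := hle1 w hw
              gcongr
              · exact mul_nonneg hc (harm_nonneg _ hw)
              · exact hgc w hw
              · nlinarith [(Nat.cast_nonneg N : (0:ℝ) ≤ N)]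
          _ ≤ (c * harm Kᶜ w) * Real.exp N + (C * harm Kᶜ w) * Real.exp N := by
              have := harm_nonneg Kᶜ hw
              have : 0 ≤ (C * harm Kᶜ w) * Real.exp N := by positivity
              linarith
          _ = D * harm Kᶜ w := by rw [hD]; ring
          _ ≤ _ := by linarith
      · have : ψ ε t = ENNReal.ofReal (harm K w) := by simp [hψ, ht, w]
        rw [this, ← ENNReal.ofReal_mul hD0,
          ← ENNReal.ofReal_add hC0 (mul_nonneg hD0 (harm_nonneg _ hw))]
        apply ENNReal.ofReal_le_ofReal
        have hx0 := harm_nonneg K hw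
        have hx1 := hle1 w hw
        have hexp : Real.exp (N * harm K w) ≤ 1 + harm K w * Real.exp N := by
          have hcv := convexOn_exp.2 (mem_univ (0:ℝ)) (mem_univ (N:ℝ)) (by linarith : 0 ≤ 1 - harm K w)
            hx0 (by ring)
          simp only [smul_eq_mul, mul_zero, zero_add, Real.exp_zero, mul_one] at hcv
          rw [mul_comm (harm K w) (N : ℝ)] at hcv
          linarith
        calc ‖g w‖ * Real.exp (N * harm K w) ≤ C * (1 + harm K w * Real.exp N) := by
              gcongr
              exact hC w hw
          _ ≤ C + D * harm K w := by
              have : 0 ≤ c * Real.exp N * harm K w := by positivity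
              rw [hD]; nlinarith
    have hψint : ∀ ε : ℝ, 0 < ε → ∫⁻ t, ψ ε t =
        2 * ∫⁻ t in K, ENNReal.ofReal (harm Kᶜ (t + ε * Complex.I)) := by
      intro ε hε
      have hmeas : ∀ S : Set ℝ, Measurable fun t : ℝ =>
          ENNReal.ofReal (harm S (t + ε * Complex.I)) := by
        intro S
        have h : ∀ t : ℝ, 0 < (t + ε * Complex.I).im := fun t => by simpa using hε
        simp_rw [ofReal_harm _ (h _)]
        exact (measurable_poissonKer_line ε).ennreal_ofReal.lintegral_prod_right'
      rw [hψ]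
      simp only
      rw [lintegral_add_left ((hmeas _).indicator hKm), lintegral_indicator hKm,
        lintegral_indicator hKm.compl, lintegral_harm_symm hε, two_mul]
    have hP : ∀ ε : ℝ, 0 < ε → ENNReal.ofReal ‖B (z + ε * Complex.I)‖ ≤
        ENNReal.ofReal C + ENNReal.ofReal (Real.pi⁻¹ * z.im⁻¹) * (ENNReal.ofReal D *
          (2 * ∫⁻ t in K, ENNReal.ofReal (harm Kᶜ (t + ε * Complex.I)))) := by
      intro ε hε
      rw [← integral_poissonKer_smul hBd hBb hε hz, ofReal_norm]
      refine (enorm_integral_le_lintegral_enorm _).trans ?_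
      calc ∫⁻ t : ℝ, ‖(poissonKer z t : ℂ) * B (t + ε * Complex.I)‖ₑ
          ≤ ∫⁻ t : ℝ, (ENNReal.ofReal (poissonKer z t) * ENNReal.ofReal C +
              ENNReal.ofReal (Real.pi⁻¹ * z.im⁻¹) * (ENNReal.ofReal D * ψ ε t)) := by
            refine lintegral_mono fun t => ?_
            simp only
            rw [← ofReal_norm, norm_mul, ENNReal.ofReal_mul (norm_nonneg _)]
            rw [Complex.norm_real, Real.norm_of_nonneg (poissonKer_nonneg hz t)]
            refine (mul_le_mul_right (hline ε hε t) _).trans ?_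
            rw [mul_add]
            gcongr
            exact poissonKer_le hz t
        _ = _ := by
            rw [lintegral_add_left
              ((continuous_poissonKer hz).measurable.ennreal_ofReal.mul_const _),
              lintegral_mul_const _ (continuous_poissonKer hz).measurable.ennreal_ofReal,
              ← ofReal_integral_eq_lintegral_ofReal (integrable_poissonKer hz)
                (Eventually.of_forall fun t => poissonKer_nonneg hz t), integral_poissonKer hz,
              lintegral_const_mul' _ _ ENNReal.ofReal_ne_top,
              lintegral_const_mul' _ _ ENNReal.ofReal_ne_top, hψint ε hε]
            simp
    have hlim1 : Tendsto (fun ε : ℝ => ENNReal.ofReal ‖B (z + ε * Complex.I)‖) (𝓝[>] 0)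
        (𝓝 (ENNReal.ofReal ‖B z‖)) := by
      have hcont : ContinuousAt B z :=
        (hBd.differentiableAt ((isOpen_lt continuous_const Complex.continuous_im).mem_nhds
          hz)).continuousAt
      have h1 : Tendsto (fun ε : ℝ => z + ε * Complex.I) (𝓝[>] 0) (𝓝 z) := by
        have : Continuous fun ε : ℝ => z + ε * Complex.I := by fun_prop
        have h2 := this.tendsto 0
        simp only [Complex.ofReal_zero, zero_mul, add_zero] at h2
        exact h2.mono_left nhdsWithin_le_nhds
      exact (ENNReal.continuous_ofReal.tendsto _).comp ((hcont.tendsto.comp h1).norm)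
    have hlim2 : Tendsto (fun ε : ℝ => ENNReal.ofReal C +
        ENNReal.ofReal (Real.pi⁻¹ * z.im⁻¹) * (ENNReal.ofReal D *
          (2 * ∫⁻ t in K, ENNReal.ofReal (harm Kᶜ (t + ε * Complex.I))))) (𝓝[>] 0)
        (𝓝 (ENNReal.ofReal C)) := by
      have h1 := ENNReal.Tendsto.const_mul (a := 2) (tendsto_lintegral_harm hK)
        (Or.inr (by simp))
      have h2 := ENNReal.Tendsto.const_mul (a := ENNReal.ofReal D) h1 (Or.inr ENNReal.ofReal_ne_top)
      have h3 := ENNReal.Tendsto.const_mul (a := ENNReal.ofReal (Real.pi⁻¹ * z.im⁻¹)) h2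
        (Or.inr ENNReal.ofReal_ne_top)
      have h4 := (tendsto_const_nhds (x := ENNReal.ofReal C)).add h3
      simpa using h4
    have := le_of_tendsto_of_tendsto hlim1 hlim2
      (by filter_upwards [self_mem_nhdsWithin] with ε hε using hP ε hε)
    exact (ENNReal.ofReal_le_ofReal_iff hC0).1 this
  have hpos := harm_pos hv hz
  have hbd : ∀ N : ℕ, ‖g z‖ ≤ C * Real.exp (-(N * harm K z)) := by
    intro N
    have := main N
    rw [norm_mul, Complex.norm_exp] at this
    have h2 : ((N : ℂ) * harmC K z).re = N * harm K z := by rw [← re_harmC hK hz]; simp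
    rw [h2] at this
    rw [Real.exp_neg, ← div_eq_mul_inv, le_div_iff₀ (Real.exp_pos _)]
    exact this
  have hlim : Tendsto (fun N : ℕ => C * Real.exp (-(N * harm K z))) atTop (𝓝 (C * 0)) := by
    refine Tendsto.const_mul _ (Real.tendsto_exp_neg_atTop_nhds_zero.comp ?_)
    exact tendsto_natCast_atTop_atTop.atTop_mul_const hpos
  rw [mul_zero] at hlim
  have := ge_of_tendsto' hlim hbd
  exact norm_le_zero_iff.1 this

/-- Truncated continued fraction of the half-line Green function. -/
noncomputable def approx : ℕ → (ℕ → ℝ) → ℂ → ℂ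
  | 0, a, z => z - a 0
  | k + 1, a, z => z - a 0 - (approx k (fun n => a (n + 1)) z)⁻¹

lemma im_neg_inv (w : ℂ) : (-w⁻¹).im = w.im / ‖w‖ ^ 2 := by
  rw [Complex.neg_im, Complex.inv_im, Complex.normSq_eq_norm_sq]
  ring

lemma im_riccati (z w : ℂ) (x : ℝ) : (z - x - w⁻¹).im = z.im + w.im / ‖w‖ ^ 2 := by
  rw [← im_neg_inv]; simp; ring

lemma norm_pos_of_im {y : ℝ} {w : ℂ} (_ : 0 < y) (hw : y ≤ w.im) : y ≤ ‖w‖ :=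
  hw.trans ((le_abs_self _).trans (Complex.abs_im_le_norm w))

lemma im_div_le {y : ℝ} {w : ℂ} (hy : 0 < y) (hw : y ≤ w.im) : w.im / ‖w‖ ^ 2 ≤ y⁻¹ := by
  have h1 : w.im ≤ ‖w‖ := (le_abs_self _).trans (Complex.abs_im_le_norm w)
  have h0 : 0 < w.im := hy.trans_le hw
  have hpos : 0 < ‖w‖ ^ 2 := by have := h0.trans_le h1; positivity
  rw [div_le_iff₀ hpos, inv_mul_eq_div, le_div_iff₀ hy]
  nlinarith

lemma le_im_approx {z : ℂ} (hz : 0 < z.im) : ∀ (k : ℕ) (a : ℕ → ℝ), z.im ≤ (approx k a z).im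
  | 0, a => by simp [approx]
  | k + 1, a => by
    rw [approx, im_riccati]
    have := le_im_approx hz k (fun n => a (n + 1))
    have : 0 ≤ (approx k (fun n => a (n + 1)) z).im := by linarith
    have : 0 ≤ (approx k (fun n => a (n + 1)) z).im / ‖approx k (fun n => a (n + 1)) z‖ ^ 2 := by
      positivity
    linarith

lemma approx_ne_zero {z : ℂ} (hz : 0 < z.im) (k : ℕ) (a : ℕ → ℝ) : approx k a z ≠ 0 := by
  intro h
  have := le_im_approx hz k a
  rw [h] at this
  simp at this
  linarith

lemma im_approx_le {z : ℂ} (hz : 0 < z.im) : ∀ (k : ℕ) (a : ℕ → ℝ),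
    (approx k a z).im ≤ z.im + z.im⁻¹
  | 0, a => by simp [approx]; exact hz.le
  | k + 1, a => by
    rw [approx, im_riccati]
    gcongr
    exact im_div_le hz (le_im_approx hz k _)

lemma riccati_contract {z w w' : ℂ} {x D : ℝ} (hz : 0 < z.im) (hw : z.im ≤ w.im)
    (hw' : z.im ≤ w'.im) (h : ‖w - w'‖ ^ 2 ≤ D * (w.im * w'.im)) :
    ‖(z - x - w⁻¹) - (z - x - w'⁻¹)‖ ^ 2 ≤
      (D * ((1 + z.im ^ 2)⁻¹) ^ 2) * ((z - x - w⁻¹).im * (z - x - w'⁻¹).im) := by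
  have hn : 0 < ‖w‖ := hz.trans_le (norm_pos_of_im hz hw)
  have hn' : 0 < ‖w'‖ := hz.trans_le (norm_pos_of_im hz hw')
  have h0 : 0 < w.im := hz.trans_le hw
  have h0' : 0 < w'.im := hz.trans_le hw'
  have hD : 0 ≤ D := by
    by_contra hD
    have h2 : D * (w.im * w'.im) < 0 := mul_neg_of_neg_of_pos (not_le.1 hD) (by positivity)
    nlinarith [sq_nonneg ‖w - w'‖]
  have e1 : (z - x - w⁻¹) - (z - x - w'⁻¹) = (w - w') / (w * w') := by
    have : w ≠ 0 := norm_pos_iff.1 hn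
    have : w' ≠ 0 := norm_pos_iff.1 hn'
    field_simp
    ring
  have key : ∀ v : ℂ, z.im ≤ v.im → (1 + z.im ^ 2) * (v.im / ‖v‖ ^ 2) ≤ z.im + v.im / ‖v‖ ^ 2 := by
    intro v hv
    have := im_div_le hz hv
    have h3 : z.im ^ 2 * (v.im / ‖v‖ ^ 2) ≤ z.im ^ 2 * z.im⁻¹ := by gcongr
    have h4 : z.im ^ 2 * z.im⁻¹ = z.im := by field_simp
    linarith
  rw [e1, im_riccati, im_riccati, norm_div, norm_mul, div_pow]
  have k1 := key w hw
  have k2 := key w' hw'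
  have h5 : ((1 + z.im ^ 2) * (w.im / ‖w‖ ^ 2)) * ((1 + z.im ^ 2) * (w'.im / ‖w'‖ ^ 2)) ≤
    (z.im + w.im / ‖w‖ ^ 2) * (z.im + w'.im / ‖w'‖ ^ 2) := by gcongr
  calc ‖w - w'‖ ^ 2 / (‖w‖ * ‖w'‖) ^ 2 ≤ D * (w.im * w'.im) / (‖w‖ * ‖w'‖) ^ 2 := by gcongr
    _ = (D * ((1 + z.im ^ 2)⁻¹) ^ 2) * (((1 + z.im ^ 2) * (w.im / ‖w‖ ^ 2)) *
          ((1 + z.im ^ 2) * (w'.im / ‖w'‖ ^ 2))) := by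
        field_simp
    _ ≤ _ := by gcongr

lemma norm_approx_sub_sq_le {z : ℂ} (hz : 0 < z.im) : ∀ (k : ℕ) (a : ℕ → ℝ),
    ‖approx (k + 1) a z - approx k a z‖ ^ 2 ≤
      ((z.im⁻¹ ^ 2) ^ 2 * (((1 + z.im ^ 2)⁻¹) ^ 2) ^ k) *
        ((approx (k + 1) a z).im * (approx k a z).im)
  | 0, a => by
    have h1 := le_im_approx hz 1 a
    have h2 := le_im_approx hz 0 a
    have h3 : ‖approx 1 a z - approx 0 a z‖ ≤ z.im⁻¹ := by
      simp only [approx]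
      rw [sub_sub_cancel_left, norm_neg, norm_inv]
      exact inv_anti₀ hz (norm_pos_of_im hz (le_im_approx hz 0 fun n => a (n + 1)))
    calc ‖approx (0 + 1) a z - approx 0 a z‖ ^ 2 ≤ (z.im⁻¹) ^ 2 := by
          gcongr
      _ = ((z.im⁻¹ ^ 2) ^ 2 * (((1 + z.im ^ 2)⁻¹) ^ 2) ^ 0) * (z.im * z.im) := by
          field_simp
      _ ≤ _ := by
          gcongr
          linarith
  | k + 1, a => by
    have := riccati_contract (x := a 0) hz (le_im_approx hz _ _) (le_im_approx hz _ _)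
      (norm_approx_sub_sq_le hz k (fun n => a (n + 1)))
    rw [mul_assoc (((z.im⁻¹) ^ 2) ^ 2), ← pow_succ] at this
    exact this

lemma norm_approx_sub_le {z : ℂ} {δ R : ℝ} (hδ : 0 < δ) (h1 : δ ≤ z.im) (h2 : z.im ≤ R) (k : ℕ)
    (a : ℕ → ℝ) :
    ‖approx (k + 1) a z - approx k a z‖ ≤ (δ⁻¹ ^ 2 * (R + δ⁻¹)) * ((1 + δ ^ 2)⁻¹) ^ k := by
  have hz := hδ.trans_le h1
  have hR := hz.trans_le h2
  refine le_of_sq_le_sq ?_ (by positivity)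
  refine (norm_approx_sub_sq_le hz k a).trans ?_
  have i1 := im_approx_le hz (k + 1) a
  have i2 := im_approx_le hz k a
  have i3 := le_im_approx hz (k + 1) a
  have i4 := le_im_approx hz k a
  have j : z.im + z.im⁻¹ ≤ R + δ⁻¹ := by gcongr
  calc ((z.im⁻¹ ^ 2) ^ 2 * (((1 + z.im ^ 2)⁻¹) ^ 2) ^ k) *
        ((approx (k + 1) a z).im * (approx k a z).im)
      ≤ ((δ⁻¹ ^ 2) ^ 2 * (((1 + δ ^ 2)⁻¹) ^ 2) ^ k) * ((R + δ⁻¹) * (R + δ⁻¹)) := by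
        have i5 : 0 ≤ (approx (k + 1) a z).im := by linarith
        have i6 : 0 ≤ (approx k a z).im := by linarith
        gcongr
        · linarith
        · linarith
    _ = _ := by ring

/-- The half-line continued fraction. -/
noncomputable def cfrac (a : ℕ → ℝ) (z : ℂ) : ℂ :=
  approx 0 a z + ∑' k, (approx (k + 1) a z - approx k a z)

lemma summable_cfrac_bound {δ R : ℝ} (hδ : 0 < δ) :
    Summable fun k : ℕ => (δ⁻¹ ^ 2 * (R + δ⁻¹)) * ((1 + δ ^ 2)⁻¹) ^ k := by
  refine Summable.mul_left _ (summable_geometric_of_lt_one (by positivity) ?_)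
  exact inv_lt_one_of_one_lt₀ (by nlinarith [sq_pos_of_pos hδ])

lemma summable_approx_sub {z : ℂ} (hz : 0 < z.im) (a : ℕ → ℝ) :
    Summable fun k => approx (k + 1) a z - approx k a z :=
  Summable.of_norm_bounded (summable_cfrac_bound hz)
    fun k => norm_approx_sub_le hz le_rfl le_rfl k a

lemma tendsto_approx {z : ℂ} (hz : 0 < z.im) (a : ℕ → ℝ) :
    Tendsto (fun k => approx k a z) atTop (𝓝 (cfrac a z)) := by
  have h := (summable_approx_sub hz a).hasSum.tendsto_sum_nat
  have h2 := h.const_add (approx 0 a z)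
  refine h2.congr fun k => ?_
  rw [Finset.sum_range_sub (fun k => approx k a z)]
  ring

lemma norm_cfrac_sub_approx_le {z : ℂ} {δ R : ℝ} (hδ : 0 < δ) (h1 : δ ≤ z.im) (h2 : z.im ≤ R)
    (k : ℕ) (a : ℕ → ℝ) :
    ‖cfrac a z - approx k a z‖ ≤
      ∑' j, (δ⁻¹ ^ 2 * (R + δ⁻¹)) * ((1 + δ ^ 2)⁻¹) ^ (j + k) := by
  have hz := hδ.trans_le h1
  have hs := summable_approx_sub hz a
  have : cfrac a z - approx k a z = ∑' j, (approx (j + k + 1) a z - approx (j + k) a z) := by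
    have := hs.sum_add_tsum_nat_add k
    rw [cfrac, ← this, Finset.sum_range_sub (fun k => approx k a z)]
    ring
  rw [this]
  refine tsum_of_norm_bounded ?_ fun j => norm_approx_sub_le hδ h1 h2 (j + k) a
  exact ((summable_nat_add_iff k).2 (summable_cfrac_bound hδ)).hasSum

lemma tendsto_cfrac_bound {δ R : ℝ} :
    Tendsto (fun k : ℕ => ∑' j, (δ⁻¹ ^ 2 * (R + δ⁻¹)) * ((1 + δ ^ 2)⁻¹) ^ (j + k))
      atTop (𝓝 0) :=
  tendsto_sum_nat_add fun j : ℕ => (δ⁻¹ ^ 2 * (R + δ⁻¹)) * ((1 + δ ^ 2)⁻¹) ^ j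

lemma le_im_cfrac {z : ℂ} (hz : 0 < z.im) (a : ℕ → ℝ) : z.im ≤ (cfrac a z).im :=
  ge_of_tendsto' ((Complex.continuous_im.tendsto _).comp (tendsto_approx hz a))
    fun k => le_im_approx hz k a

lemma cfrac_ne_zero {z : ℂ} (hz : 0 < z.im) (a : ℕ → ℝ) : cfrac a z ≠ 0 := by
  intro h
  have := le_im_cfrac hz a
  rw [h] at this
  simp at this
  linarith

lemma cfrac_eq {z : ℂ} (hz : 0 < z.im) (a : ℕ → ℝ) :
    cfrac a z = z - a 0 - (cfrac (fun n => a (n + 1)) z)⁻¹ := by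
  have h1 := (tendsto_approx hz a).comp (tendsto_add_atTop_nat 1)
  have h2 := ((tendsto_approx hz (fun n => a (n + 1))).inv₀ (cfrac_ne_zero hz _)).const_sub
    (z - a 0)
  exact tendsto_nhds_unique h1 h2

lemma continuousOn_approx : ∀ k : ℕ,
    ContinuousOn (fun p : (ℕ → ℝ) × ℂ => approx k p.1 p.2) {p | 0 < p.2.im}
  | 0 => by
    simp only [approx]
    fun_prop
  | k + 1 => by
    simp only [approx]
    have h : ContinuousOn (fun p : (ℕ → ℝ) × ℂ => approx k (fun n => p.1 (n + 1)) p.2)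
        {p | 0 < p.2.im} :=
      (continuousOn_approx k).comp
        (f := fun p : (ℕ → ℝ) × ℂ => ((fun n => p.1 (n + 1)), p.2)) (by fun_prop) fun p hp => hp
    refine ContinuousOn.sub (by fun_prop) (h.inv₀ fun p hp => approx_ne_zero hp _ _)

lemma differentiableOn_approx : ∀ (k : ℕ) (a : ℕ → ℝ),
    DifferentiableOn ℂ (approx k a) {z | 0 < z.im}
  | 0, a => by
    have : approx 0 a = fun z : ℂ => z - a 0 := rfl
    rw [this]
    fun_prop
  | k + 1, a => by
    have : approx (k + 1) a = fun z => z - a 0 - (approx k (fun n => a (n + 1)) z)⁻¹ := rfl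
    rw [this]
    refine DifferentiableOn.sub (by fun_prop)
      ((differentiableOn_approx k _).inv fun z hz => approx_ne_zero hz _ _)

lemma continuousOn_cfrac :
    ContinuousOn (fun p : (ℕ → ℝ) × ℂ => cfrac p.1 p.2) {p | 0 < p.2.im} := by
  refine (continuousOn_approx 0).add ?_
  intro p hp
  have hp : 0 < p.2.im := hp
  have hopen : IsOpen {q : (ℕ → ℝ) × ℂ | p.2.im / 2 < q.2.im ∧ q.2.im < p.2.im + 1} :=
    (isOpen_lt continuous_const (Complex.continuous_im.comp continuous_snd)).inter
      (isOpen_lt (Complex.continuous_im.comp continuous_snd) continuous_const)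
  refine ContinuousAt.continuousWithinAt ?_
  refine ContinuousOn.continuousAt
    (s := {q : (ℕ → ℝ) × ℂ | p.2.im / 2 < q.2.im ∧ q.2.im < p.2.im + 1}) ?_
    (hopen.mem_nhds ⟨by linarith, by linarith⟩)
  have hsub : ∀ k : ℕ, ContinuousOn (fun p : (ℕ → ℝ) × ℂ => approx k p.1 p.2)
      {q : (ℕ → ℝ) × ℂ | p.2.im / 2 < q.2.im ∧ q.2.im < p.2.im + 1} := fun k =>
    (continuousOn_approx k).mono fun q hq => by
      have : p.2.im / 2 < q.2.im := hq.1
      show 0 < q.2.im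
      linarith
  exact continuousOn_tsum (fun k => (hsub (k + 1)).sub (hsub k))
    (summable_cfrac_bound (half_pos hp) (R := p.2.im + 1))
    fun k q hq => norm_approx_sub_le (half_pos hp) hq.1.le hq.2.le k q.1

lemma differentiableOn_cfrac (a : ℕ → ℝ) : DifferentiableOn ℂ (cfrac a) {z | 0 < z.im} := by
  refine (differentiableOn_approx 0 a).add ?_
  intro w hw
  have hw : 0 < w.im := hw
  have hopen : IsOpen {q : ℂ | w.im / 2 < q.im ∧ q.im < w.im + 1} :=
    (isOpen_lt continuous_const Complex.continuous_im).inter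
      (isOpen_lt Complex.continuous_im continuous_const)
  refine DifferentiableAt.differentiableWithinAt ?_
  refine DifferentiableOn.differentiableAt
    (s := {q : ℂ | w.im / 2 < q.im ∧ q.im < w.im + 1}) ?_
    (hopen.mem_nhds ⟨by linarith, by linarith⟩)
  have hsub : ∀ k : ℕ, DifferentiableOn ℂ (approx k a)
      {q : ℂ | w.im / 2 < q.im ∧ q.im < w.im + 1} := fun k =>
    (differentiableOn_approx k a).mono fun q hq => by
      have : w.im / 2 < q.im := hq.1
      show 0 < q.im
      linarith
  exact Complex.differentiableOn_tsum_of_summable_norm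
    (summable_cfrac_bound (half_pos hw) (R := w.im + 1))
    (fun k => (hsub (k + 1)).sub (hsub k)) hopen
    fun k q hq => norm_approx_sub_le (half_pos hw) hq.1.le hq.2.le k a

/-- The left half-line function at height `ε` above the real energy `y.1`. -/
noncomputable def pfun (ε : ℝ) (y : ℝ × (ℤ → ℝ)) : ℂ :=
  cfrac (fun n => y.2 (-n)) (y.1 + ε * Complex.I)

/-- The right half-line function at height `ε` above the real energy `y.1`. -/
noncomputable def qfun (ε : ℝ) (y : ℝ × (ℤ → ℝ)) : ℂ :=
  -(cfrac (fun n => y.2 (n + 1)) (y.1 + ε * Complex.I))⁻¹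

/-- The shift acting on the fibres of `ℝ × (ℤ → ℝ)`. -/
def fshift (y : ℝ × (ℤ → ℝ)) : ℝ × (ℤ → ℝ) := (y.1, shift ℝ y.2)

lemma continuous_shift : Continuous (shift ℝ) := by unfold shift; fun_prop

lemma continuous_fshift : Continuous fshift := by
  unfold fshift
  exact continuous_fst.prodMk (continuous_shift.comp continuous_snd)

lemma im_line {ε : ℝ} (E : ℝ) : ((E : ℂ) + ε * Complex.I).im = ε := by simp

lemma pfun_fshift {ε : ℝ} (hε : 0 < ε) (y : ℝ × (ℤ → ℝ)) :
    pfun ε (fshift y) = y.1 + ε * Complex.I - y.2 1 - (pfun ε y)⁻¹ := by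
  unfold pfun fshift shift
  rw [cfrac_eq (by rwa [im_line])]
  simp

lemma qfun_fshift {ε : ℝ} (hε : 0 < ε) (y : ℝ × (ℤ → ℝ)) :
    qfun ε (fshift y) = -(qfun ε y)⁻¹ - (y.1 + ε * Complex.I - y.2 1) := by
  unfold qfun fshift shift
  simp only [inv_neg, inv_inv, neg_neg]
  conv_rhs => rw [cfrac_eq (by rwa [im_line])]
  simp

lemma lt_im_pfun {ε : ℝ} (hε : 0 < ε) (y : ℝ × (ℤ → ℝ)) : ε < (pfun ε y).im := by
  unfold pfun
  have hz : 0 < ((y.1 : ℂ) + ε * Complex.I).im := by rwa [im_line]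
  rw [cfrac_eq hz, im_riccati, im_line]
  have h1 := le_im_cfrac hz (fun n => y.2 (-((n + 1 : ℕ) : ℤ)))
  have h2 := norm_pos_of_im hz h1
  have h3 := hz.trans_le h1
  have h4 := hz.trans_le h2
  have : 0 < (cfrac (fun n => y.2 (-((n + 1 : ℕ) : ℤ))) (y.1 + ε * Complex.I)).im /
    ‖cfrac (fun n => y.2 (-((n + 1 : ℕ) : ℤ))) (y.1 + ε * Complex.I)‖ ^ 2 := by positivity
  linarith

lemma im_qfun_pos {ε : ℝ} (hε : 0 < ε) (y : ℝ × (ℤ → ℝ)) : 0 < (qfun ε y).im := by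
  unfold qfun
  have hz : 0 < ((y.1 : ℂ) + ε * Complex.I).im := by rwa [im_line]
  rw [im_neg_inv]
  have h1 := le_im_cfrac hz (fun n => y.2 (n + 1))
  have h2 := norm_pos_of_im hz h1
  have h3 := hz.trans_le h1
  have h4 := hz.trans_le h2
  positivity

lemma pfun_ne_zero {ε : ℝ} (hε : 0 < ε) (y : ℝ × (ℤ → ℝ)) : pfun ε y ≠ 0 := fun h => by
  have := lt_im_pfun hε y
  rw [h] at this
  simp at this
  linarith

lemma qfun_ne_zero {ε : ℝ} (hε : 0 < ε) (y : ℝ × (ℤ → ℝ)) : qfun ε y ≠ 0 := fun h => by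
  have := im_qfun_pos hε y
  rw [h] at this
  simp at this

lemma pfun_add_qfun_ne_zero {ε ε' : ℝ} (hε : 0 < ε) (hε' : 0 < ε') (y : ℝ × (ℤ → ℝ)) :
    pfun ε y + qfun ε' y ≠ 0 := fun h => by
  have h1 := im_qfun_pos hε' y
  have h2 := lt_im_pfun hε y
  have : (pfun ε y + qfun ε' y).im = 0 := by rw [h]; rfl
  rw [Complex.add_im] at this
  linarith

lemma continuousOn_pfun :
    ContinuousOn (fun p : ℝ × (ℝ × (ℤ → ℝ)) => pfun p.1 p.2) {p | 0 < p.1} := by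
  unfold pfun
  refine continuousOn_cfrac.comp
    (f := fun p : ℝ × (ℝ × (ℤ → ℝ)) =>
      ((fun n : ℕ => p.2.2 (-n)), ((p.2.1 : ℂ) + p.1 * Complex.I)))
    (Continuous.continuousOn ?_) fun p hp => ?_
  · exact (by fun_prop : Continuous fun p : ℝ × (ℝ × (ℤ → ℝ)) => (fun n : ℕ => p.2.2 (-n))).prodMk
      (by fun_prop)
  · simpa using hp

lemma continuous_pfun {ε : ℝ} (hε : 0 < ε) : Continuous (pfun ε) := by
  rw [← continuousOn_univ]
  exact continuousOn_pfun.comp (f := fun y => (ε, y)) (by fun_prop) fun y _ => hε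

lemma continuous_qfun {ε : ℝ} (hε : 0 < ε) : Continuous (qfun ε) := by
  unfold qfun
  refine Continuous.neg (Continuous.inv₀ ?_ fun y => cfrac_ne_zero (by rwa [im_line]) _)
  rw [← continuousOn_univ]
  refine continuousOn_cfrac.comp
    (f := fun y : ℝ × (ℤ → ℝ) => ((fun n : ℕ => y.2 (n + 1)), ((y.1 : ℂ) + ε * Complex.I)))
    (Continuous.continuousOn ?_) fun p _ => ?_
  · exact (by fun_prop : Continuous fun y : ℝ × (ℤ → ℝ) => (fun n : ℕ => y.2 (n + 1))).prodMk
      (by fun_prop)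
  · simpa using hε

section Integrals

variable {ρ : Measure (ℝ × (ℤ → ℝ))} {Y : Set (ℝ × (ℤ → ℝ))}

lemma integrable_of_continuous [IsFiniteMeasure ρ] (hY : IsCompact Y) (hρ : ρ Yᶜ = 0)
    {f : ℝ × (ℤ → ℝ) → ℝ} (hf : Continuous f) : Integrable f ρ := by
  have h1 : IntegrableOn f Y ρ := hf.continuousOn.integrableOn_compact hY
  rwa [IntegrableOn, Measure.restrict_eq_self_of_ae_mem] at h1
  rw [ae_iff]
  exact hρ

lemma integral_sub_add_const_mul {f g h : ℝ × (ℤ → ℝ) → ℝ} (hf : Integrable f ρ)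
    (hg : Integrable g ρ) (hh : Integrable h ρ) (c : ℝ) :
    ∫ y, (f y - g y + c * h y) ∂ρ = ∫ y, f y ∂ρ - ∫ y, g y ∂ρ + c * ∫ y, h y ∂ρ := by
  have h1 : Integrable (fun y => f y - g y) ρ := hf.sub hg
  rw [integral_add h1 (hh.const_mul c), integral_sub hf hg, integral_const_mul]

lemma integral_fshift (hS : MeasurePreserving fshift ρ ρ) {f : ℝ × (ℤ → ℝ) → ℝ}
    (hf : Continuous f) : ∫ y, f (fshift y) ∂ρ = ∫ y, f y ∂ρ := by
  conv_rhs => rw [← hS.map_eq]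
  rw [integral_map hS.measurable.aemeasurable hf.aestronglyMeasurable]

/-- The integrated Lyapunov exponent. -/
noncomputable def intLyap (ρ : Measure (ℝ × (ℤ → ℝ))) (ε : ℝ) : ℝ := ∫ y, Real.log ‖pfun ε y‖ ∂ρ

lemma add_fshift {ε ε' : ℝ} (hε : 0 < ε) (hε' : 0 < ε') (y : ℝ × (ℤ → ℝ)) :
    pfun ε (fshift y) + qfun ε' (fshift y) =
      -((1 - (ε - ε') * Complex.I * (pfun ε y * qfun ε' y / (pfun ε y + qfun ε' y))) *
        (pfun ε y + qfun ε' y) / (pfun ε y * qfun ε' y)) := by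
  rw [pfun_fshift hε, qfun_fshift hε']
  have := pfun_ne_zero hε y
  have := qfun_ne_zero hε' y
  have := pfun_add_qfun_ne_zero hε hε' y
  field_simp
  ring

lemma one_sub_ne_zero {ε ε' : ℝ} (hε : 0 < ε) (hε' : 0 < ε') (y : ℝ × (ℤ → ℝ)) :
    1 - (ε - ε') * Complex.I * (pfun ε y * qfun ε' y / (pfun ε y + qfun ε' y)) ≠ 0 := by
  intro h
  have := add_fshift hε hε' y
  rw [h] at this
  simp only [zero_mul, zero_div, neg_zero] at this
  exact pfun_add_qfun_ne_zero hε hε' _ this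

lemma integral_log_add [IsFiniteMeasure ρ] (hS : MeasurePreserving fshift ρ ρ) (hY : IsCompact Y)
    (hρ : ρ Yᶜ = 0) {ε ε' : ℝ} (hε : 0 < ε) (hε' : 0 < ε') :
    ∫ y, Real.log ‖pfun ε y‖ ∂ρ + ∫ y, Real.log ‖qfun ε' y‖ ∂ρ =
      ∫ y, Real.log ‖1 - (ε - ε') * Complex.I *
        (pfun ε y * qfun ε' y / (pfun ε y + qfun ε' y))‖ ∂ρ := by
  have cp := continuous_pfun hε
  have cq := continuous_qfun hε'
  have hs := pfun_add_qfun_ne_zero hε hε'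
  have hp := pfun_ne_zero hε
  have hq := qfun_ne_zero hε'
  have h1 := one_sub_ne_zero hε hε'
  have c1 : Continuous fun y => Real.log ‖pfun ε y + qfun ε' y‖ :=
    (cp.add cq).norm.log fun y => norm_ne_zero_iff.2 (hs y)
  have c2 : Continuous fun y => Real.log ‖pfun ε y‖ := cp.norm.log fun y => norm_ne_zero_iff.2 (hp y)
  have c3 : Continuous fun y => Real.log ‖qfun ε' y‖ :=
    cq.norm.log fun y => norm_ne_zero_iff.2 (hq y)
  have c4 : Continuous fun y => Real.log ‖1 - (ε - ε') * Complex.I *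
        (pfun ε y * qfun ε' y / (pfun ε y + qfun ε' y))‖ :=
    (continuous_const.sub (continuous_const.mul ((cp.mul cq).div (cp.add cq) hs))).norm.log
      fun y => norm_ne_zero_iff.2 (h1 y)
  have e := integral_fshift hS c1
  have e2 : ∀ y, Real.log ‖pfun ε (fshift y) + qfun ε' (fshift y)‖ =
      Real.log ‖1 - (ε - ε') * Complex.I * (pfun ε y * qfun ε' y / (pfun ε y + qfun ε' y))‖ +
      Real.log ‖pfun ε y + qfun ε' y‖ - (Real.log ‖pfun ε y‖ + Real.log ‖qfun ε' y‖) := by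
    intro y
    rw [add_fshift hε hε', norm_neg, norm_div, norm_mul, norm_mul,
      Real.log_div (mul_ne_zero (norm_ne_zero_iff.2 (h1 y)) (norm_ne_zero_iff.2 (hs y)))
        (mul_ne_zero (norm_ne_zero_iff.2 (hp y)) (norm_ne_zero_iff.2 (hq y))),
      Real.log_mul (norm_ne_zero_iff.2 (h1 y)) (norm_ne_zero_iff.2 (hs y)),
      Real.log_mul (norm_ne_zero_iff.2 (hp y)) (norm_ne_zero_iff.2 (hq y))]
  have i1 := integrable_of_continuous hY hρ c1
  have i2 := integrable_of_continuous hY hρ c2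
  have i3 := integrable_of_continuous hY hρ c3
  have i4 := integrable_of_continuous hY hρ c4
  simp_rw [e2] at e
  have i41 : Integrable (fun y => Real.log ‖1 - (ε - ε') * Complex.I *
      (pfun ε y * qfun ε' y / (pfun ε y + qfun ε' y))‖ + Real.log ‖pfun ε y + qfun ε' y‖) ρ :=
    i4.add i1
  have i23 : Integrable (fun y => Real.log ‖pfun ε y‖ + Real.log ‖qfun ε' y‖) ρ := i2.add i3
  rw [integral_sub i41 i23, integral_add i4 i1, integral_add i2 i3] at e
  linarith

lemma integral_log_qfun [IsFiniteMeasure ρ] (hS : MeasurePreserving fshift ρ ρ) (hY : IsCompact Y)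
    (hρ : ρ Yᶜ = 0) {ε : ℝ} (hε : 0 < ε) : ∫ y, Real.log ‖qfun ε y‖ ∂ρ = -intLyap ρ ε := by
  have := integral_log_add hS hY hρ hε hε
  simp only [sub_self, zero_mul, sub_zero, norm_one, Real.log_one, integral_zero] at this
  unfold intLyap
  linarith

lemma intLyap_eq_left [IsFiniteMeasure ρ] (hS : MeasurePreserving fshift ρ ρ) (hY : IsCompact Y)
    (hρ : ρ Yᶜ = 0) {ε : ℝ} (hε : 0 < ε) :
    2 * intLyap ρ ε = ∫ y, Real.log (1 + ε / ((pfun ε y).im - ε)) ∂ρ := by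
  have cp := continuous_pfun hε
  have cim : Continuous fun y => (pfun ε y).im := Complex.continuous_im.comp cp
  have hlt := lt_im_pfun hε
  have hp0 : ∀ y, 0 < ‖pfun ε y‖ := fun y => norm_pos_iff.2 (pfun_ne_zero hε y)
  have c1 : Continuous fun y => Real.log (1 + ε / ((pfun ε y).im - ε)) := by
    refine Continuous.log (continuous_const.add (continuous_const.div (cim.sub continuous_const)
      fun y => ?_)) fun y => ?_
    · linarith [hlt y]
    · have : 0 < (pfun ε y).im - ε := by linarith [hlt y]
      positivity
  have c2 : Continuous fun y => Real.log (pfun ε y).im :=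
    cim.log fun y => (hε.trans (hlt y)).ne'
  have c3 : Continuous fun y => Real.log ‖pfun ε y‖ := cp.norm.log fun y => (hp0 y).ne'
  have him : ∀ y, (pfun ε (fshift y)).im = ε + (pfun ε y).im / ‖pfun ε y‖ ^ 2 := by
    intro y
    rw [pfun_fshift hε, im_riccati, im_line]
  have e1 := integral_fshift hS c1
  have e2 := integral_fshift hS c2
  have e3 : ∀ y, Real.log (1 + ε / ((pfun ε (fshift y)).im - ε)) =
      Real.log (pfun ε (fshift y)).im - Real.log (pfun ε y).im + 2 * Real.log ‖pfun ε y‖ := by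
    intro y
    have h0 : 0 < (pfun ε y).im := hε.trans (hlt y)
    have h1 := hp0 y
    have h2 : 0 < (pfun ε y).im / ‖pfun ε y‖ ^ 2 := by positivity
    have : 1 + ε / ((pfun ε (fshift y)).im - ε) =
        (pfun ε (fshift y)).im / (pfun ε y).im * ‖pfun ε y‖ ^ 2 := by
      rw [him, add_sub_cancel_left]
      field_simp
      ring
    have h3 : (pfun ε (fshift y)).im ≠ 0 := (hε.trans (hlt _)).ne'
    rw [this, Real.log_mul (div_ne_zero h3 h0.ne') (by positivity), Real.log_div h3 h0.ne',
      Real.log_pow]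
    norm_num
  have i2 := integrable_of_continuous hY hρ c2
  have i2' := integrable_of_continuous hY hρ (c2.comp continuous_fshift)
  have i3 := integrable_of_continuous hY hρ c3
  simp_rw [e3] at e1
  rw [← e1]
  refine Eq.trans ?_ (integral_sub_add_const_mul i2' i2 i3 2).symm
  simp only [Function.comp_apply, e2, intLyap]
  ring

lemma intLyap_eq_right [IsFiniteMeasure ρ] (hS : MeasurePreserving fshift ρ ρ) (hY : IsCompact Y)
    (hρ : ρ Yᶜ = 0) {ε : ℝ} (hε : 0 < ε) :
    2 * intLyap ρ ε = ∫ y, Real.log (1 + ε / (qfun ε y).im) ∂ρ := by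
  have cq := continuous_qfun hε
  have cim : Continuous fun y => (qfun ε y).im := Complex.continuous_im.comp cq
  have hlt := im_qfun_pos hε
  have hq0 : ∀ y, 0 < ‖qfun ε y‖ := fun y => norm_pos_iff.2 (qfun_ne_zero hε y)
  have c1 : Continuous fun y => Real.log (1 + ε / (qfun ε y).im) := by
    refine Continuous.log (continuous_const.add (continuous_const.div cim fun y => (hlt y).ne'))
      fun y => ?_
    have := hlt y
    positivity
  have c2 : Continuous fun y => Real.log (qfun ε y).im := cim.log fun y => (hlt y).ne'
  have c3 : Continuous fun y => Real.log ‖qfun ε y‖ := cq.norm.log fun y => (hq0 y).ne'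
  have him : ∀ y, (qfun ε (fshift y)).im + ε = (qfun ε y).im / ‖qfun ε y‖ ^ 2 := by
    intro y
    rw [qfun_fshift hε, ← im_neg_inv]
    simp
  have e1 := integral_fshift hS c1
  have e2 := integral_fshift hS c2
  have e3 : ∀ y, Real.log (1 + ε / (qfun ε (fshift y)).im) =
      Real.log (qfun ε y).im - Real.log (qfun ε (fshift y)).im + -2 * Real.log ‖qfun ε y‖ := by
    intro y
    have h0 := hlt y
    have h1 := hq0 y
    have h2 := hlt (fshift y)
    have : 1 + ε / (qfun ε (fshift y)).im =
        (qfun ε y).im / (qfun ε (fshift y)).im / ‖qfun ε y‖ ^ 2 := by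
      have h3 : (qfun ε y).im = ((qfun ε (fshift y)).im + ε) * ‖qfun ε y‖ ^ 2 := by
        rw [him]; field_simp
      rw [h3]
      field_simp
    rw [this, Real.log_div (by positivity) (by positivity), Real.log_div h0.ne' h2.ne',
      Real.log_pow]
    push_cast
    ring
  have i2 := integrable_of_continuous hY hρ c2
  have i2' := integrable_of_continuous hY hρ (c2.comp continuous_fshift)
  have i3 := integrable_of_continuous hY hρ c3
  simp_rw [e3] at e1
  rw [← e1]
  refine Eq.trans ?_ (integral_sub_add_const_mul i2 i2' i3 (-2)).symm
  rw [integral_log_qfun hS hY hρ hε]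
  simp only [Function.comp_apply, e2]
  ring

end Integrals

lemma abs_log_norm_one_add_sub_le {u : ℂ} (hu : ‖u‖ ≤ 1 / 2) :
    |Real.log ‖1 + u‖ - u.re| ≤ ‖u‖ ^ 2 := by
  have h := Complex.norm_log_one_add_sub_self_le (z := u) (by linarith)
  have h1 := Complex.abs_re_le_norm (Complex.log (1 + u) - u)
  rw [Complex.sub_re, Complex.log_re] at h1
  refine h1.trans (h.trans ?_)
  have : (1 - ‖u‖)⁻¹ ≤ 2 := by
    rw [inv_le_comm₀ (by linarith) (by norm_num)]; linarith
  nlinarith [sq_nonneg ‖u‖, norm_nonneg u]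

section Integrals

variable {ρ : Measure (ℝ × (ℤ → ℝ))} {Y : Set (ℝ × (ℤ → ℝ))}

lemma continuousOn_mixed {ε : ℝ} (hε : 0 < ε) : ContinuousOn
    (fun p : ℝ × (ℝ × (ℤ → ℝ)) => pfun p.1 p.2 * qfun ε p.2 / (pfun p.1 p.2 + qfun ε p.2))
    {p | 0 < p.1} := by
  have cq : ContinuousOn (fun p : ℝ × (ℝ × (ℤ → ℝ)) => qfun ε p.2) {p | 0 < p.1} :=
    ((continuous_qfun hε).comp continuous_snd).continuousOn
  exact (continuousOn_pfun.mul cq).div (continuousOn_pfun.add cq)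
    fun p hp => pfun_add_qfun_ne_zero hp hε p.2

lemma hasDerivAt_intLyap [IsFiniteMeasure ρ] (hS : MeasurePreserving fshift ρ ρ)
    (hY : IsCompact Y) (hρ : ρ Yᶜ = 0) {ε : ℝ} (hε : 0 < ε) :
    HasDerivAt (intLyap ρ) (∫ y, (-(pfun ε y + qfun ε y)⁻¹).im ∂ρ) ε := by
  set X : ℝ → ℝ × (ℤ → ℝ) → ℂ := fun t y => pfun t y * qfun ε y / (pfun t y + qfun ε y) with hX
  have hYae : ∀ᵐ y ∂ρ, y ∈ Y := by rw [ae_iff]; exact hρ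
  have hXc : ContinuousOn (fun p : ℝ × (ℝ × (ℤ → ℝ)) => X p.1 p.2) {p | 0 < p.1} :=
    continuousOn_mixed hε
  have hXy : ∀ t, 0 < t → Continuous (X t) := fun t ht => by
    rw [← continuousOn_univ]
    exact hXc.comp (f := fun y => (t, y)) (by fun_prop) fun y _ => ht
  have hXt : ∀ y, ContinuousAt (fun t => X t y) ε := fun y => by
    have : ContinuousOn (fun t => X t y) (Ioi 0) :=
      hXc.comp (f := fun t => (t, y)) (by fun_prop) fun t ht => ht
    exact this.continuousAt (Ioi_mem_nhds hε)
  have hlim : ∫ y, (-(pfun ε y + qfun ε y)⁻¹).im ∂ρ = ∫ y, (X ε y).im ∂ρ := by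
    have hc : Continuous fun y => (-(pfun ε y + qfun ε y)⁻¹).im :=
      Complex.continuous_im.comp (((continuous_pfun hε).add (continuous_qfun hε)).inv₀
        (pfun_add_qfun_ne_zero hε hε)).neg
    rw [← integral_fshift hS hc]
    refine integral_congr_ae (Eventually.of_forall fun y => ?_)
    simp only [hX]
    rw [add_fshift hε hε]
    congr 1
    simp
  obtain ⟨M, hM⟩ : ∃ M, ∀ t ∈ Icc (ε / 2) (2 * ε), ∀ y ∈ Y, ‖X t y‖ ≤ M := by
    have hc : IsCompact (Icc (ε / 2) (2 * ε) ×ˢ Y) := isCompact_Icc.prod hY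
    obtain ⟨M, hM⟩ := hc.exists_bound_of_continuousOn (hXc.mono fun p hp => by
      have : ε / 2 ≤ p.1 := hp.1.1
      show 0 < p.1
      linarith)
    exact ⟨M, fun t ht y hy => hM (t, y) ⟨ht, hy⟩⟩
  set M' := max M 1 with hM'
  have hM1 : 1 ≤ M' := le_max_right _ _
  have hpt : ∀ t y, t ≠ ε → ‖X t y‖ ≤ M' → |t - ε| * M' ≤ 1 / 2 →
      |(t - ε)⁻¹ * Real.log ‖1 - (t - ε) * Complex.I * X t y‖ - (X t y).im| ≤
        |t - ε| * M' ^ 2 := by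
    intro t y hne h1 h2
    have hn : ‖-((t - ε) * Complex.I * X t y)‖ = |t - ε| * ‖X t y‖ := by
      rw [norm_neg, norm_mul, norm_mul, Complex.norm_I, mul_one, ← Complex.ofReal_sub,
        Complex.norm_real, Real.norm_eq_abs]
    have h3 : ‖-((t - ε) * Complex.I * X t y)‖ ≤ 1 / 2 := by
      rw [hn]
      exact (mul_le_mul_of_nonneg_left h1 (abs_nonneg _)).trans h2
    have h4 := abs_log_norm_one_add_sub_le h3
    have h5 : (-((t - ε) * Complex.I * X t y)).re = (t - ε) * (X t y).im := by
      simp [Complex.mul_re]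
    rw [h5, hn, ← sub_eq_add_neg] at h4
    have h6 : 0 < |t - ε| := abs_pos.2 (sub_ne_zero.2 hne)
    have h7 : (t - ε)⁻¹ * Real.log ‖1 - (t - ε) * Complex.I * X t y‖ - (X t y).im =
        (t - ε)⁻¹ * (Real.log ‖1 - (t - ε) * Complex.I * X t y‖ - (t - ε) * (X t y).im) := by
      have : t - ε ≠ 0 := sub_ne_zero.2 hne
      field_simp
    rw [h7, abs_mul, abs_inv, inv_mul_le_iff₀ h6]
    refine h4.trans ?_
    have : ‖X t y‖ ^ 2 ≤ M' ^ 2 := by gcongr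
    have := mul_le_mul_of_nonneg_left this (sq_nonneg |t - ε|)
    calc (|t - ε| * ‖X t y‖) ^ 2 = |t - ε| ^ 2 * ‖X t y‖ ^ 2 := by ring
      _ ≤ |t - ε| ^ 2 * M' ^ 2 := this
      _ = _ := by ring
  rw [hlim, hasDerivAt_iff_tendsto_slope]
  have hnear : ∀ᶠ t in 𝓝[≠] ε, t ∈ Icc (ε / 2) (2 * ε) ∧ |t - ε| * M' ≤ 1 / 2 ∧ t ≠ ε := by
    have h1 : ∀ᶠ t in 𝓝 ε, t ∈ Icc (ε / 2) (2 * ε) :=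
      Icc_mem_nhds (by linarith) (by linarith)
    have h3 : ∀ᶠ t in 𝓝[≠] ε, t ≠ ε := self_mem_nhdsWithin
    have hc : Continuous fun t => |t - ε| * M' := by fun_prop
    have : Tendsto (fun t => |t - ε| * M') (𝓝 ε) (𝓝 0) := by
      have := hc.tendsto ε
      simpa using this
    have h2 : ∀ᶠ t in 𝓝 ε, |t - ε| * M' ≤ 1 / 2 :=
      this.eventually (ge_mem_nhds (by norm_num : (0:ℝ) < 1 / 2))
    filter_upwards [h1.filter_mono nhdsWithin_le_nhds, h2.filter_mono nhdsWithin_le_nhds, h3]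
      with t ht1 ht2 ht3 using ⟨ht1, ht2, ht3⟩
  have hslope : ∀ᶠ t in 𝓝[≠] ε, slope (intLyap ρ) ε t =
      ∫ y, (t - ε)⁻¹ * Real.log ‖1 - (t - ε) * Complex.I * X t y‖ ∂ρ := by
    filter_upwards [hnear] with t ht
    have ht0 : 0 < t := by linarith [ht.1.1]
    have h := integral_log_add hS hY hρ ht0 hε
    rw [integral_log_qfun hS hY hρ hε] at h
    rw [slope_def_field, integral_const_mul, ← h]
    simp only [intLyap]
    rw [div_eq_inv_mul]
    ring
  refine Tendsto.congr' (EventuallyEq.symm hslope) ?_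
  refine tendsto_integral_filter_of_dominated_convergence (fun _ => M' + 1 / 2 * M') ?_ ?_
    (integrable_const _) ?_
  · filter_upwards [hnear] with t ht
    have ht0 : 0 < t := by linarith [ht.1.1]
    refine Continuous.aestronglyMeasurable (continuous_const.mul ?_)
    refine Continuous.log (continuous_const.sub (continuous_const.mul (hXy t ht0))).norm
      fun y => norm_ne_zero_iff.2 (one_sub_ne_zero ht0 hε y)
  · filter_upwards [hnear] with t ht
    filter_upwards [hYae] with y hy
    have h0 : ‖X t y‖ ≤ M' := (hM t ht.1 y hy).trans (le_max_left _ _)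
    have h1 := hpt t y ht.2.2 h0 ht.2.1
    have h2 := (Complex.abs_im_le_norm (X t y)).trans h0
    rw [Real.norm_eq_abs]
    have h3 := abs_sub_abs_le_abs_sub
      ((t - ε)⁻¹ * Real.log ‖1 - (t - ε) * Complex.I * X t y‖) (X t y).im
    nlinarith [ht.2.1]
  · filter_upwards [hYae] with y hy
    have h1 : Tendsto (fun t => (X t y).im) (𝓝[≠] ε) (𝓝 (X ε y).im) :=
      ((Complex.continuous_im.tendsto _).comp (hXt y)).mono_left nhdsWithin_le_nhds
    refine tendsto_of_tendsto_of_dist h1 ?_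
    have h2 : Tendsto (fun t => |t - ε| * M' ^ 2) (𝓝[≠] ε) (𝓝 0) := by
      have hc : Continuous fun t => |t - ε| * M' ^ 2 := by fun_prop
      have := hc.tendsto ε
      simp only [sub_self, abs_zero, zero_mul] at this
      exact this.mono_left nhdsWithin_le_nhds
    refine squeeze_zero' (Eventually.of_forall fun t => dist_nonneg) ?_ h2
    filter_upwards [hnear] with t ht
    rw [dist_comm, Real.dist_eq]
    exact hpt t y ht.2.2 ((hM t ht.1 y hy).trans (le_max_left _ _)) ht.2.1

/-- The reflection defect. -/
noncomputable def defect (ε : ℝ) (y : ℝ × (ℤ → ℝ)) : ℂ :=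
  (pfun ε y + Complex.I)⁻¹ + (starRingEnd ℂ) (qfun ε y + Complex.I)⁻¹

lemma add_I_ne_zero {w : ℂ} (hw : 0 < w.im) : w + Complex.I ≠ 0 := fun h => by
  have : (w + Complex.I).im = 0 := by rw [h]; rfl
  simp at this
  linarith

lemma continuous_defect {ε : ℝ} (hε : 0 < ε) : Continuous (defect ε) := by
  unfold defect
  refine Continuous.add ?_ (Complex.continuous_conj.comp ?_)
  · exact ((continuous_pfun hε).add continuous_const).inv₀
      fun y => add_I_ne_zero (hε.trans (lt_im_pfun hε y))
  · exact ((continuous_qfun hε).add continuous_const).inv₀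
      fun y => add_I_ne_zero (im_qfun_pos hε y)

lemma defect_real_bound {A B R ε N m l : ℝ} (hε : 0 < ε) (hN0 : 0 < (A + B) ^ 2 + R ^ 2)
    (hkey : (A + B) ^ 2 + R ^ 2 ≤ 8 * N * m) (hm : 1 ≤ m)
    (hI : N / 4 - (A + B) / ((A + B) ^ 2 + R ^ 2) =
      N / 4 * (R ^ 2 + (A - B) ^ 2) / ((A + B) ^ 2 + R ^ 2))
    (hl : N / 4 ≤ l) :
    (R ^ 2 + (A - B + ε) ^ 2) / m ≤ 64 * (l - (A + B) / ((A + B) ^ 2 + R ^ 2)) + 2 * ε ^ 2 := by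
  have h1 : R ^ 2 + (A - B + ε) ^ 2 ≤ 2 * (R ^ 2 + (A - B) ^ 2) + 2 * ε ^ 2 := by
    linarith [sq_nonneg (A - B - ε), sq_nonneg R]
  have h2 : 2 * (R ^ 2 + (A - B) ^ 2) / m ≤
      64 * (N / 4 * (R ^ 2 + (A - B) ^ 2) / ((A + B) ^ 2 + R ^ 2)) := by
    rw [div_le_iff₀ (by positivity), ← mul_div_assoc, div_mul_eq_mul_div, le_div_iff₀ hN0]
    have := mul_le_mul_of_nonneg_left hkey (by positivity : 0 ≤ 2 * (R ^ 2 + (A - B) ^ 2))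
    linarith
  have h3 : 2 * ε ^ 2 / m ≤ 2 * ε ^ 2 := div_le_self (by positivity) hm
  have h4 : (R ^ 2 + (A - B + ε) ^ 2) / m ≤
      (2 * (R ^ 2 + (A - B) ^ 2) + 2 * ε ^ 2) / m := by gcongr
  rw [add_div (2 * _)] at h4
  rw [← hI] at h2
  linarith

set_option maxHeartbeats 1000000 in
/-- The pointwise inequality behind Kotani's theorem. -/
lemma norm_sq_le_of_im {p q : ℂ} {ε : ℝ} (hε : 0 < ε) (hε2 : ε ≤ 2) (hp : ε < p.im)
    (hq : 0 < q.im) :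
    ‖(p + Complex.I)⁻¹ + (starRingEnd ℂ) (q + Complex.I)⁻¹‖ ^ 2 ≤
      64 * ((Real.log (1 + ε / (p.im - ε)) + Real.log (1 + ε / q.im)) / (4 * ε)
        - (-(p + q)⁻¹).im) + 2 * ε ^ 2 := by
  have hp0 := add_I_ne_zero (hε.trans hp)
  have hq0 := add_I_ne_zero hq
  set a := p.im - ε with ha
  set b := q.im with hb
  have ha0 : 0 < a := by linarith
  set A := a + ε / 2 with hA
  set B := b + ε / 2 with hB
  have hA0 : 0 < A := by positivity
  have hB0 : 0 < B := by positivity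
  set R := p.re + q.re with hR
  have hN0 : 0 < (A + B) ^ 2 + R ^ 2 := by positivity
  have hpq : ‖p + q‖ ^ 2 = (A + B) ^ 2 + R ^ 2 := by
    rw [← Complex.normSq_eq_norm_sq, Complex.normSq_apply]
    simp only [Complex.add_re, Complex.add_im]
    have : p.im + q.im = A + B := by rw [hA, hB, ha]; ring
    rw [this]; ring
  have him : (-(p + q)⁻¹).im = (A + B) / ((A + B) ^ 2 + R ^ 2) := by
    rw [im_neg_inv, hpq]
    congr 1
    rw [Complex.add_im, hA, hB, ha]; ring
  have hlog : ∀ x : ℝ, 0 < x → (x + ε / 2)⁻¹ ≤ Real.log (1 + ε / x) / ε := by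
    intro x hx
    have := Real.le_log_one_add_of_nonneg (x := ε / x) (by positivity)
    rw [le_div_iff₀ hε]
    refine le_trans (le_of_eq ?_) this
    field_simp
    ring
  have hl : (A⁻¹ + B⁻¹) / 4 ≤ (Real.log (1 + ε / a) + Real.log (1 + ε / b)) / (4 * ε) := by
    have h1 := hlog a ha0
    have h2 := hlog b hq
    have h3 : (Real.log (1 + ε / a) + Real.log (1 + ε / b)) / (4 * ε) =
      (Real.log (1 + ε / a) / ε + Real.log (1 + ε / b) / ε) / 4 := by field_simp
    rw [h3]
    gcongr
  -- lower bounds on the denominators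
  set u := ‖p + Complex.I‖ with hu
  set v := ‖q + Complex.I‖ with hv
  have hu1 : p.im + 1 ≤ u := by
    have := (le_abs_self _).trans (Complex.abs_im_le_norm (p + Complex.I))
    simpa using this
  have hv1 : q.im + 1 ≤ v := by
    have := (le_abs_self _).trans (Complex.abs_im_le_norm (q + Complex.I))
    simpa using this
  have huA : A ≤ u := by rw [hA, ha]; linarith
  have hvB : B ≤ v := by rw [hB]; linarith
  have hu1' : 1 ≤ u := by linarith
  have hv1' : 1 ≤ v := by linarith
  have hsum : ‖p + q‖ ≤ u + v + 2 := by
    have : p + q = (p + Complex.I) + (q + Complex.I) - 2 * Complex.I := by ring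
    rw [this]
    refine (norm_sub_le _ _).trans ?_
    have := norm_add_le (p + Complex.I) (q + Complex.I)
    have h2 : ‖2 * Complex.I‖ = 2 := by simp
    rw [h2]
    linarith
  have hkey : (A + B) ^ 2 + R ^ 2 ≤ 8 * (A⁻¹ + B⁻¹) * (u ^ 2 * v ^ 2) := by
    rw [← hpq]
    have h1 : u⁻¹ ≤ A⁻¹ := inv_anti₀ hA0 huA
    have h2 : v⁻¹ ≤ B⁻¹ := inv_anti₀ hB0 hvB
    calc ‖p + q‖ ^ 2 ≤ (u + v + 2) ^ 2 := by gcongr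
      _ ≤ 4 * (u + v) * (u + v) := by nlinarith
      _ ≤ 4 * (u + v) * (2 * (u * v)) := by
          gcongr
          nlinarith
      _ = 8 * (u⁻¹ + v⁻¹) * (u ^ 2 * v ^ 2) := by field_simp; ring
      _ ≤ _ := by gcongr
  have hnorm : ‖(p + Complex.I)⁻¹ + (starRingEnd ℂ) (q + Complex.I)⁻¹‖ ^ 2 =
      (R ^ 2 + (A - B + ε) ^ 2) / (u ^ 2 * v ^ 2) := by
    have hq0' : (starRingEnd ℂ) (q + Complex.I) ≠ 0 := (map_ne_zero _).2 hq0
    have e1 : (p + Complex.I)⁻¹ + (starRingEnd ℂ) (q + Complex.I)⁻¹ =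
        (p + (starRingEnd ℂ) q) / ((p + Complex.I) * (starRingEnd ℂ) (q + Complex.I)) := by
      rw [map_inv₀]
      field_simp
      simp
      ring
    rw [e1, norm_div, norm_mul, Complex.norm_conj, div_pow, mul_pow]
    congr 1
    rw [← Complex.normSq_eq_norm_sq, Complex.normSq_apply]
    simp only [Complex.add_re, Complex.add_im, Complex.conj_re, Complex.conj_im]
    have : p.im + -q.im = A - B + ε := by rw [hA, hB, ha]; ring
    rw [this]; ring
  have huv : 1 ≤ u ^ 2 * v ^ 2 := by
    have h1 : 1 ≤ u ^ 2 := one_le_pow₀ hu1'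
    have h2 : 1 ≤ v ^ 2 := one_le_pow₀ hv1'
    exact one_le_mul_of_one_le_of_one_le h1 h2
  have hI : (A⁻¹ + B⁻¹) / 4 - (A + B) / ((A + B) ^ 2 + R ^ 2) =
      (A⁻¹ + B⁻¹) / 4 * (R ^ 2 + (A - B) ^ 2) / ((A + B) ^ 2 + R ^ 2) := by
    field_simp
    ring
  rw [hnorm, him]
  exact defect_real_bound hε hN0 hkey huv hI hl

lemma integral_defect_le [IsFiniteMeasure ρ] (hS : MeasurePreserving fshift ρ ρ)
    (hY : IsCompact Y) (hρ : ρ Yᶜ = 0) {ε : ℝ} (hε : 0 < ε) (hε2 : ε ≤ 2) :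
    ∫ y, ‖defect ε y‖ ^ 2 ∂ρ ≤
      64 * (intLyap ρ ε / ε - ∫ y, (-(pfun ε y + qfun ε y)⁻¹).im ∂ρ) + 2 * ε ^ 2 * ρ.real univ := by
  have hlt := lt_im_pfun hε
  have hqp := im_qfun_pos hε
  have c1 : Continuous fun y => Real.log (1 + ε / ((pfun ε y).im - ε)) := by
    refine Continuous.log (continuous_const.add (continuous_const.div
      ((Complex.continuous_im.comp (continuous_pfun hε)).sub continuous_const)
      fun y => ?_)) fun y => ?_
    · linarith [hlt y]
    · have : 0 < (pfun ε y).im - ε := by linarith [hlt y]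
      positivity
  have c2 : Continuous fun y => Real.log (1 + ε / (qfun ε y).im) := by
    refine Continuous.log (continuous_const.add (continuous_const.div
      (Complex.continuous_im.comp (continuous_qfun hε)) fun y => (hqp y).ne'))
      fun y => ?_
    have := hqp y
    positivity
  have c3 : Continuous fun y => (-(pfun ε y + qfun ε y)⁻¹).im :=
    Complex.continuous_im.comp (((continuous_pfun hε).add (continuous_qfun hε)).inv₀
      (pfun_add_qfun_ne_zero hε hε)).neg
  have i0 := integrable_of_continuous hY hρ ((continuous_defect hε).norm.pow 2)
  have i1 := integrable_of_continuous hY hρ c1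
  have i2 := integrable_of_continuous hY hρ c2
  have i3 := integrable_of_continuous hY hρ c3
  have i12 : Integrable (fun y => (Real.log (1 + ε / ((pfun ε y).im - ε)) +
    Real.log (1 + ε / (qfun ε y).im)) / (4 * ε)) ρ := (i1.add i2).div_const _
  have i4 : Integrable (fun y => 64 * ((Real.log (1 + ε / ((pfun ε y).im - ε)) +
    Real.log (1 + ε / (qfun ε y).im)) / (4 * ε) - (-(pfun ε y + qfun ε y)⁻¹).im)) ρ :=
    (i12.sub i3).const_mul _
  have h := integral_mono i0 (i4.add (integrable_const (2 * ε ^ 2)))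
    fun y => norm_sq_le_of_im hε hε2 (hlt y) (hqp y)
  refine h.trans (le_of_eq ?_)
  simp only [Pi.add_apply]
  rw [integral_add i4 (integrable_const _), integral_const_mul, integral_sub i12 i3,
    integral_div, integral_add i1 i2, ← intLyap_eq_left hS hY hρ hε,
    ← intLyap_eq_right hS hY hρ hε, integral_const]
  congr 1
  · congr 2
    field_simp
    ring
  · simp [mul_comm]

/-- If the integrated Lyapunov exponent vanishes linearly at the real axis, the reflection defect
is not bounded below. -/
lemma exists_defect_lt [IsFiniteMeasure ρ] (hS : MeasurePreserving fshift ρ ρ)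
    (hY : IsCompact Y) (hρ : ρ Yᶜ = 0) {C : ℝ} (hC : ∀ ε, 0 < ε → intLyap ρ ε ≤ C * ε)
    {c ε₀ : ℝ} (hc : 0 < c) (hε₀ : 0 < ε₀) :
    ∃ ε, 0 < ε ∧ ε < ε₀ ∧ ∫ y, ‖defect ε y‖ ^ 2 ∂ρ < c := by
  by_contra! hcon
  obtain ⟨ε₁, h1pos, h1a, h1b, h1c⟩ : ∃ ε₁, 0 < ε₁ ∧ ε₁ < ε₀ ∧ ε₁ ≤ 2 ∧
      2 * ε₁ ^ 2 * ρ.real univ ≤ c / 2 := by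
    have hcts : Continuous fun t : ℝ => 2 * t ^ 2 * ρ.real univ := by fun_prop
    have h1 : ∀ᶠ t in 𝓝[>] (0 : ℝ), 2 * t ^ 2 * ρ.real univ ≤ c / 2 := by
      refine (hcts.tendsto' 0 0 (by simp)).mono_left nhdsWithin_le_nhds
        |>.eventually (ge_mem_nhds (by positivity))
    have h2 : ∀ᶠ t in 𝓝[>] (0 : ℝ), t ∈ Ioo 0 (min ε₀ 2) :=
      Ioo_mem_nhdsGT (by positivity)
    obtain ⟨t, ht1, ht2⟩ := (h1.and h2).exists
    exact ⟨t, ht2.1, ht2.2.trans_le (min_le_left _ _), (ht2.2.trans_le (min_le_right _ _)).le, ht1⟩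
  set c' := c / 128 with hc'
  set D : ℝ → ℝ := fun ε => ∫ y, (-(pfun ε y + qfun ε y)⁻¹).im ∂ρ with hD
  have hder : ∀ ε, 0 < ε → ε ≤ ε₁ → c' ≤ intLyap ρ ε / ε - D ε := by
    intro ε h0 h1
    have h2 := integral_defect_le hS hY hρ h0 (h1.trans h1b)
    have h3 := hcon ε h0 (h1.trans_lt h1a)
    have h4 : 2 * ε ^ 2 * ρ.real univ ≤ 2 * ε₁ ^ 2 * ρ.real univ := by gcongr
    rw [hc', hD]
    linarith
  set G : ℝ → ℝ := fun ε => intLyap ρ ε / ε + c' * Real.log ε with hG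
  have hGd : ∀ ε, 0 < ε → HasDerivAt G ((D ε * ε - intLyap ρ ε * 1) / ε ^ 2 + c' * ε⁻¹) ε := by
    intro ε h0
    exact ((hasDerivAt_intLyap hS hY hρ h0).div (hasDerivAt_id ε) h0.ne').add
      ((Real.hasDerivAt_log h0.ne').const_mul c')
  have hanti : AntitoneOn G (Ioc 0 ε₁) := by
    refine antitoneOn_of_deriv_nonpos (convex_Ioc _ _)
      (fun x hx => (hGd x hx.1).continuousAt.continuousWithinAt) ?_ ?_
    · rw [interior_Ioc]
      exact fun x hx => (hGd x hx.1).differentiableAt.differentiableWithinAt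
    · rw [interior_Ioc]
      intro x hx
      rw [(hGd x hx.1).deriv]
      have h1 := hder x hx.1 hx.2.le
      have hx0 := hx.1
      have : (D x * x - intLyap ρ x * 1) / x ^ 2 + c' * x⁻¹ =
          x⁻¹ * (c' - (intLyap ρ x / x - D x)) := by field_simp; ring
      rw [this]
      exact mul_nonpos_of_nonneg_of_nonpos (by positivity) (by linarith)
  have hlow : ∀ ε ∈ Ioc 0 ε₁, G ε₁ ≤ C + c' * Real.log ε := by
    intro ε hε
    have h1 := hanti hε ⟨h1pos, le_rfl⟩ hε.2
    have h2 : intLyap ρ ε / ε ≤ C := by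
      rw [div_le_iff₀ hε.1]; exact hC ε hε.1
    calc G ε₁ ≤ G ε := h1
      _ ≤ _ := by rw [hG]; linarith
  have hlog : Tendsto (fun ε => C + c' * Real.log ε) (𝓝[>] 0) atBot :=
    tendsto_atBot_add_const_left _ _
      (Real.tendsto_log_nhdsGT_zero.const_mul_atBot (by positivity))
  have h1 := hlog.eventually (eventually_lt_atBot (G ε₁))
  have h2 : ∀ᶠ t in 𝓝[>] (0 : ℝ), t ∈ Ioc 0 ε₁ := Ioc_mem_nhdsGT h1pos
  obtain ⟨t, ht1, ht2⟩ := (h1.and h2).exists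
  exact absurd (hlow t ht2) (not_le.2 ht1)

end Integrals

section MatNorm

variable {M N : Matrix (Fin 2) (Fin 2) ℝ}

lemma matNorm_sq (M : Matrix (Fin 2) (Fin 2) ℝ) :
    matNorm M ^ 2 = M 0 0 ^ 2 + M 0 1 ^ 2 + (M 1 0 ^ 2 + M 1 1 ^ 2) := by
  unfold matNorm
  rw [Real.sq_sqrt (by positivity)]
  simp [Fin.sum_univ_two]

lemma matNorm_nonneg (M : Matrix (Fin 2) (Fin 2) ℝ) : 0 ≤ matNorm M := Real.sqrt_nonneg _

lemma matNorm_mul_le (M N : Matrix (Fin 2) (Fin 2) ℝ) :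
    matNorm (M * N) ≤ matNorm M * matNorm N := by
  refine le_of_sq_le_sq ?_ (mul_nonneg (matNorm_nonneg _) (matNorm_nonneg _))
  rw [mul_pow, matNorm_sq, matNorm_sq, matNorm_sq]
  simp only [Matrix.mul_apply, Fin.sum_univ_two]
  have key : ∀ a b c d : ℝ, (a * c + b * d) ^ 2 ≤ (a ^ 2 + b ^ 2) * (c ^ 2 + d ^ 2) := by
    intro a b c d
    nlinarith [sq_nonneg (a * d - b * c)]
  have h1 := key (M 0 0) (M 0 1) (N 0 0) (N 1 0)
  have h2 := key (M 0 0) (M 0 1) (N 0 1) (N 1 1)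
  have h3 := key (M 1 0) (M 1 1) (N 0 0) (N 1 0)
  have h4 := key (M 1 0) (M 1 1) (N 0 1) (N 1 1)
  linarith

lemma abs_le_matNorm (M : Matrix (Fin 2) (Fin 2) ℝ) (i j : Fin 2) : |M i j| ≤ matNorm M := by
  refine abs_le_of_sq_le_sq ?_ (matNorm_nonneg _)
  rw [matNorm_sq]
  fin_cases i <;> fin_cases j <;> simp <;>
    nlinarith [sq_nonneg (M 0 0), sq_nonneg (M 0 1), sq_nonneg (M 1 0), sq_nonneg (M 1 1)]

lemma one_le_matNorm (hM : M.det = 1) : 1 ≤ matNorm M := by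
  refine le_of_sq_le_sq ?_ (matNorm_nonneg _)
  rw [matNorm_sq]
  rw [Matrix.det_fin_two] at hM
  nlinarith [sq_nonneg (M 0 0 - M 1 1), sq_nonneg (M 0 1 + M 1 0)]

lemma matNorm_adjugate (M : Matrix (Fin 2) (Fin 2) ℝ) : matNorm M.adjugate = matNorm M := by
  have h : matNorm M.adjugate ^ 2 = matNorm M ^ 2 := by
    rw [matNorm_sq, matNorm_sq, Matrix.adjugate_fin_two]
    simp
    ring
  exact (sq_eq_sq₀ (matNorm_nonneg _) (matNorm_nonneg _)).1 h

lemma continuous_matNorm : Continuous matNorm := by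
  unfold matNorm
  fun_prop

end MatNorm

lemma iterate_shift {α : Type*} (k : ℕ) (ω : ℤ → α) (n : ℤ) :
    (shift α)^[k] ω n = ω (n + k) := by
  induction k generalizing ω with
  | zero => simp
  | succ k ih =>
    rw [Function.iterate_succ_apply, ih]
    simp only [shift]
    congr 1
    push_cast
    ring

lemma cocycle_add {α G : Type*} [Monoid G] (A : (ℤ → α) → G) (m n : ℕ) (ω : ℤ → α) :
    cocycle A (m + n) ω = cocycle A m ((shift α)^[n] ω) * cocycle A n ω := by
  induction m with
  | zero => simp [cocycle]
  | succ m ih =>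
    rw [Nat.add_right_comm]
    simp only [cocycle]
    rw [ih, ← mul_assoc, ← Function.iterate_add_apply]

lemma det_transferMat (E : ℝ) (ω : ℤ → ℝ) : (transferMat E ω).det = 1 := by
  simp [transferMat, Matrix.det_fin_two]

lemma det_cocycle (E : ℝ) (n : ℕ) (ω : ℤ → ℝ) : (cocycle (transferMat E) n ω).det = 1 := by
  induction n with
  | zero => simp [cocycle]
  | succ n ih => simp only [cocycle]; rw [Matrix.det_mul, ih, det_transferMat, one_mul]

/-- The logarithm of the norm of the transfer matrix over `n` steps. -/
noncomputable def logNorm (E : ℝ) (n : ℕ) (ω : ℤ → ℝ) : ℝ :=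
  Real.log (matNorm (cocycle (transferMat E) n ω))

lemma matNorm_cocycle_pos (E : ℝ) (n : ℕ) (ω : ℤ → ℝ) :
    0 < matNorm (cocycle (transferMat E) n ω) :=
  one_pos.trans_le (one_le_matNorm (det_cocycle E n ω))

lemma logNorm_nonneg (E : ℝ) (n : ℕ) (ω : ℤ → ℝ) : 0 ≤ logNorm E n ω :=
  Real.log_nonneg (one_le_matNorm (det_cocycle E n ω))

lemma logNorm_add_le (E : ℝ) (m n : ℕ) (ω : ℤ → ℝ) :
    logNorm E (m + n) ω ≤ logNorm E m ((shift ℝ)^[n] ω) + logNorm E n ω := by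
  unfold logNorm
  rw [← Real.log_mul (matNorm_cocycle_pos _ _ _).ne' (matNorm_cocycle_pos _ _ _).ne', cocycle_add]
  refine Real.log_le_log ?_ (matNorm_mul_le _ _)
  rw [← cocycle_add]
  exact matNorm_cocycle_pos _ _ _

lemma cocycle_congr (E : ℝ) {n : ℕ} {ω ω' : ℤ → ℝ}
    (h : ∀ i : ℕ, i < n → ω (1 + i) = ω' (1 + i)) :
    cocycle (transferMat E) n ω = cocycle (transferMat E) n ω' := by
  induction n with
  | zero => rfl
  | succ n ih =>
    simp only [cocycle]
    rw [ih fun i hi => h i (by omega)]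
    simp only [transferMat, iterate_shift]
    rw [h n (by omega)]

lemma continuous_cocycle (n : ℕ) :
    Continuous fun y : ℝ × (ℤ → ℝ) => cocycle (transferMat y.1) n y.2 := by
  induction n with
  | zero => simp only [cocycle]; exact continuous_const
  | succ n ih =>
    simp only [cocycle, transferMat, iterate_shift]
    refine Continuous.mul ?_ ih
    refine continuous_matrix fun i j => ?_
    fin_cases i <;> fin_cases j <;> simp <;> fun_prop

lemma continuous_logNorm (n : ℕ) : Continuous fun y : ℝ × (ℤ → ℝ) => logNorm y.1 n y.2 :=
  (continuous_matNorm.comp (continuous_cocycle n)).log fun _ => (matNorm_cocycle_pos _ _ _).ne'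

lemma logNorm_one_le {E R : ℝ} {ω : ℤ → ℝ} (h : |E - ω 1| ≤ R) :
    logNorm E 1 ω ≤ Real.log (2 + R) := by
  have h0 : cocycle (transferMat E) 1 ω = transferMat E ω := by simp [cocycle]
  refine Real.log_le_log (matNorm_cocycle_pos _ _ _) ?_
  rw [h0]
  have hR : 0 ≤ R := (abs_nonneg _).trans h
  refine le_of_sq_le_sq ?_ (by linarith)
  rw [matNorm_sq]
  have := sq_le_sq' (abs_le.1 h).1 (abs_le.1 h).2
  simp [transferMat]
  nlinarith

lemma logNorm_le {E R : ℝ} {ω : ℤ → ℝ} (h : ∀ n, |E - ω n| ≤ R) (n : ℕ) :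
    logNorm E n ω ≤ Real.log 2 + n * Real.log (2 + R) := by
  induction n with
  | zero =>
    simp only [CharP.cast_eq_zero, zero_mul, add_zero]
    refine Real.log_le_log (matNorm_cocycle_pos _ _ _) ?_
    refine le_of_sq_le_sq ?_ (by norm_num)
    rw [matNorm_sq]
    simp [cocycle]
    norm_num
  | succ n ih =>
    rw [add_comm n 1]
    refine (logNorm_add_le E 1 n ω).trans ?_
    have := logNorm_one_le (E := E) (R := R) (ω := (shift ℝ)^[n] ω) (by rw [iterate_shift]; exact h _)
    push_cast
    linarith

/-- Sliding the window by one step changes the logarithm of the norm by a bounded amount. -/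
lemma abs_logNorm_shift_sub_le {E R : ℝ} {ω : ℤ → ℝ} (h : ∀ n, |E - ω n| ≤ R) (n : ℕ) :
    |logNorm E n (shift ℝ ω) - logNorm E n ω| ≤ 2 * Real.log (2 + R) := by
  have hs : ∀ k : ℕ, logNorm E 1 ((shift ℝ)^[k] ω) ≤ Real.log (2 + R) := fun k =>
    logNorm_one_le (by rw [iterate_shift]; exact h _)
  have hR : 0 ≤ R := (abs_nonneg _).trans (h 0)
  have h1 : cocycle (transferMat E) n (shift ℝ ω) * cocycle (transferMat E) 1 ω =
      cocycle (transferMat E) 1 ((shift ℝ)^[n] ω) * cocycle (transferMat E) n ω := by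
    have e1 := cocycle_add (transferMat E) n 1 ω
    have e2 := cocycle_add (transferMat E) 1 n ω
    rw [add_comm 1 n, e1] at e2
    simpa using e2
  have key : ∀ P Q S W : Matrix (Fin 2) (Fin 2) ℝ, P.det = 1 → Q.det = 1 → S.det = 1 → W.det = 1 →
      P * Q = S * W → Real.log (matNorm P) ≤
        Real.log (matNorm S) + Real.log (matNorm W) + Real.log (matNorm Q) := by
    intro P Q S W hP hQ hS hW e
    have e' : P = S * W * Q.adjugate := by
      rw [← e, mul_assoc, Matrix.mul_adjugate, hQ, one_smul, mul_one]
    have hp := one_le_matNorm hP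
    have hq := one_le_matNorm hQ
    have hs := one_le_matNorm hS
    have hw := one_le_matNorm hW
    rw [← Real.log_mul (by linarith) (by linarith), ← Real.log_mul (by nlinarith) (by linarith)]
    refine Real.log_le_log (by linarith) ?_
    rw [← matNorm_adjugate Q]
    conv_lhs => rw [e']
    refine (matNorm_mul_le _ _).trans ?_
    exact mul_le_mul_of_nonneg_right (matNorm_mul_le _ _) (matNorm_nonneg _)
  have d := det_cocycle E
  have k1 := key _ _ _ _ (d _ _) (d _ _) (d _ _) (d _ _) h1
  have k2 : Real.log (matNorm (cocycle (transferMat E) n ω)) ≤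
      Real.log (matNorm (cocycle (transferMat E) 1 ((shift ℝ)^[n] ω))) +
      Real.log (matNorm (cocycle (transferMat E) n (shift ℝ ω))) +
      Real.log (matNorm (cocycle (transferMat E) 1 ω)) := by
    have e' : cocycle (transferMat E) n ω = (cocycle (transferMat E) 1 ((shift ℝ)^[n] ω)).adjugate *
        (cocycle (transferMat E) n (shift ℝ ω) * cocycle (transferMat E) 1 ω) := by
      rw [h1, ← mul_assoc, Matrix.adjugate_mul, d, one_smul, one_mul]
    have p1 := matNorm_cocycle_pos E 1 ((shift ℝ)^[n] ω)
    have p2 := matNorm_cocycle_pos E n (shift ℝ ω)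
    have p3 := matNorm_cocycle_pos E 1 ω
    rw [← Real.log_mul p1.ne' p2.ne', ← Real.log_mul (mul_pos p1 p2).ne' p3.ne']
    refine Real.log_le_log (matNorm_cocycle_pos _ _ _) ?_
    conv_lhs => rw [e']
    refine (matNorm_mul_le _ _).trans ?_
    rw [matNorm_adjugate, mul_assoc]
    exact mul_le_mul_of_nonneg_left (matNorm_mul_le _ _) (matNorm_nonneg _)
  have s0 := hs 0
  have sn := hs n
  simp only [Function.iterate_zero, id] at s0
  unfold logNorm at *
  rw [abs_le]
  constructor <;> linarith

/-- The logarithmic bump `½ log (1 + x⁻²)`. -/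
noncomputable def logBump (x : ℝ) : ℝ := Real.log (1 + (x⁻¹) ^ 2) / 2

lemma logBump_nonneg (x : ℝ) : 0 ≤ logBump x := by
  unfold logBump
  have := Real.log_nonneg (by nlinarith [sq_nonneg x⁻¹] : (1:ℝ) ≤ 1 + (x⁻¹) ^ 2)
  linarith

lemma measurable_logBump : Measurable logBump := by
  unfold logBump
  fun_prop

lemma logBump_le (x : ℝ) :
    logBump x ≤ (1 + x ^ 2)⁻¹ + (Icc (-1 : ℝ) 1).indicator (fun x => |Real.log x| + 1) x := by
  by_cases hx : x ∈ Icc (-1 : ℝ) 1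
  · rw [indicator_of_mem hx]
    rcases eq_or_ne x 0 with rfl | h0
    · simp [logBump]
    have hx2 : x ^ 2 ≤ 1 := by nlinarith [hx.1, hx.2]
    have hx3 : 0 < x ^ 2 := by positivity
    have h1 : 1 + (x⁻¹) ^ 2 ≤ 2 * (x⁻¹) ^ 2 := by
      have : 1 ≤ (x⁻¹) ^ 2 := by rw [inv_pow]; exact (one_le_inv₀ hx3).2 hx2
      linarith
    have h2 : Real.log (1 + (x⁻¹) ^ 2) ≤ Real.log 2 - 2 * Real.log x := by
      refine (Real.log_le_log (by positivity) h1).trans (le_of_eq ?_)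
      rw [Real.log_mul (by norm_num) (by positivity), Real.log_pow, Real.log_inv]
      push_cast
      ring
    have h3 := neg_le_abs (Real.log x)
    have h4 : (0:ℝ) ≤ (1 + x ^ 2)⁻¹ := by positivity
    have := Real.log_two_lt_d9
    unfold logBump
    linarith
  · rw [indicator_of_notMem hx, add_zero]
    have hx2 : 1 < x ^ 2 := by
      rw [mem_Icc, not_and_or, not_le, not_le] at hx
      rcases hx with hx | hx <;> nlinarith
    have h1 := Real.log_le_sub_one_of_pos (x := 1 + (x⁻¹) ^ 2) (by positivity)
    have h2 : (x⁻¹) ^ 2 / 2 ≤ (1 + x ^ 2)⁻¹ := by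
      rw [inv_pow, inv_eq_one_div, inv_eq_one_div, div_div, div_le_div_iff₀ (by positivity)
        (by positivity)]
      linarith
    unfold logBump
    linarith

lemma integrable_logBump : Integrable logBump := by
  have h1 : Integrable fun x : ℝ => (1 + x ^ 2)⁻¹ := integrable_inv_one_add_sq
  have h2 : Integrable ((Icc (-1 : ℝ) 1).indicator (fun x => |Real.log x| + 1)) := by
    rw [integrable_indicator_iff measurableSet_Icc]
    have : IntervalIntegrable Real.log volume (-1) 1 := intervalIntegral.intervalIntegrable_log'
    rw [intervalIntegrable_iff_integrableOn_Icc_of_le (by norm_num)] at this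
    exact this.abs.add (integrableOn_const (by simp))
  refine (h1.add h2).mono' measurable_logBump.aestronglyMeasurable (Eventually.of_forall fun x => ?_)
  rw [Real.norm_eq_abs, abs_of_nonneg (logBump_nonneg x)]
  exact logBump_le x

lemma log_norm_line_sub {E ε r : ℝ} (hE : E ≠ r) (hε : 0 < ε) :
    Real.log ‖(E : ℂ) + ε * Complex.I - r‖ = Real.log ‖(E : ℂ) - r‖ + logBump ((E - r) / ε) := by
  have h0 : E - r ≠ 0 := sub_ne_zero.2 hE
  have hsq : 0 < (E - r) ^ 2 := by positivity
  have e1 : ‖(E : ℂ) + ε * Complex.I - r‖ ^ 2 = (E - r) ^ 2 + ε ^ 2 := by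
    rw [← Complex.normSq_eq_norm_sq, Complex.normSq_apply]
    simp
    ring
  have e2 : ‖(E : ℂ) - r‖ ^ 2 = (E - r) ^ 2 := by
    rw [← Complex.ofReal_sub, Complex.norm_real, Real.norm_eq_abs, sq_abs]
  have e3 : ∀ x : ℝ, Real.log x = Real.log (x ^ 2) / 2 := fun x => by
    rw [Real.log_pow]; push_cast; ring
  rw [e3 ‖_‖, e3 ‖(E : ℂ) - r‖, e1, e2, logBump, ← add_div, ← Real.log_mul (by positivity)
    (by positivity)]
  congr 2
  field_simp

/-- For a product of linear factors with real roots, the logarithm of the modulus increases by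
a uniformly integrable amount when one moves off the real axis. -/
lemma exists_log_norm_line_le {ε : ℝ} (hε : 0 < ε) (s : Multiset ℝ) :
    ∃ g : ℝ → ℝ, Integrable g ∧ (∀ x, 0 ≤ g x) ∧ ∫ x, g x = s.card * (ε * ∫ x, logBump x) ∧
      ∀ᵐ E : ℝ, (s.map fun r : ℝ => (E : ℂ) - r).prod ≠ 0 ∧
        Real.log ‖(s.map fun r : ℝ => (E : ℂ) + ε * Complex.I - r).prod‖ =
          Real.log ‖(s.map fun r : ℝ => (E : ℂ) - r).prod‖ + g E := by
  induction s using Multiset.induction_on with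
  | empty => exact ⟨0, integrable_zero _ _ _, fun _ => le_rfl, by simp, by simp⟩
  | cons r s ih =>
    obtain ⟨g, hg, hg0, hgi, hge⟩ := ih
    have hb : Integrable fun E : ℝ => logBump ((E - r) / ε) := by
      have := (integrable_logBump.comp_div hε.ne').comp_sub_right r
      exact this
    refine ⟨fun E => logBump ((E - r) / ε) + g E, hb.add hg,
      fun x => add_nonneg (logBump_nonneg _) (hg0 x), ?_, ?_⟩
    · rw [integral_add hb hg, hgi, integral_sub_right_eq_self (fun E => logBump (E / ε)) r,
        Measure.integral_comp_div logBump ε, Multiset.card_cons, abs_of_pos hε, smul_eq_mul]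
      push_cast
      ring
    · have hr : ∀ᵐ E : ℝ, E ≠ r := by simp [ae_iff]
      filter_upwards [hge, hr] with E hE hEr
      have h1 : (E : ℂ) - r ≠ 0 := by
        rw [← Complex.ofReal_sub]; exact_mod_cast sub_ne_zero.2 hEr
      have h2 : (s.map fun r : ℝ => (E : ℂ) + ε * Complex.I - r).prod ≠ 0 := by
        refine Multiset.prod_ne_zero fun h => ?_
        obtain ⟨t, -, ht⟩ := Multiset.mem_map.1 h
        have := congrArg Complex.im ht
        simp at this
        exact hε.ne' this
      have h3 : (E : ℂ) + ε * Complex.I - r ≠ 0 := fun h => by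
        have := congrArg Complex.im h
        simp at this
        exact hε.ne' this
      simp only [Multiset.map_cons, Multiset.prod_cons]
      refine ⟨mul_ne_zero h1 hE.1, ?_⟩
      rw [norm_mul, norm_mul, Real.log_mul (norm_ne_zero_iff.2 h3) (norm_ne_zero_iff.2 h2),
        Real.log_mul (norm_ne_zero_iff.2 h1) (norm_ne_zero_iff.2 hE.1), hE.2,
        log_norm_line_sub hEr hε]
      ring

open Polynomial in
/-- The Dirichlet polynomials. -/
noncomputable def dpoly (ω : ℤ → ℝ) : ℕ → ℝ[X]
  | 0 => 1
  | 1 => X - C (ω 1)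
  | n + 2 => (X - C (ω (n + 2))) * dpoly ω (n + 1) - dpoly ω n

open Polynomial in
lemma dpoly_monic (ω : ℤ → ℝ) (n : ℕ) : (dpoly ω n).Monic ∧ (dpoly ω n).natDegree = n ∧
    (dpoly ω (n + 1)).Monic ∧ (dpoly ω (n + 1)).natDegree = n + 1 := by
  induction n with
  | zero =>
    simp only [dpoly]
    exact ⟨monic_one, natDegree_one, monic_X_sub_C _, natDegree_X_sub_C _⟩
  | succ n ih =>
    obtain ⟨h1, h2, h3, h4⟩ := ih
    refine ⟨h3, h4, ?_⟩
    have hm := (monic_X_sub_C (ω (n + 2))).mul h3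
    have hd : ((X - C (ω (n + 2))) * dpoly ω (n + 1)).natDegree = n + 2 := by
      rw [Monic.natDegree_mul (monic_X_sub_C _) h3, h4, natDegree_X_sub_C]; ring
    have hlt : (dpoly ω n).degree < ((X - C (ω (n + 2))) * dpoly ω (n + 1)).degree := by
      rw [degree_eq_natDegree h1.ne_zero, degree_eq_natDegree hm.ne_zero, h2, hd]
      exact_mod_cast (by omega)
    have : dpoly ω (n + 1 + 1) = (X - C (ω (n + 2))) * dpoly ω (n + 1) - dpoly ω n := rfl
    rw [this]
    exact ⟨hm.sub_of_left hlt, by rw [natDegree_sub_eq_left_of_natDegree_lt (by rw [h2, hd]; omega), hd]⟩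

open Polynomial in
lemma cocycle_apply_zero (E : ℝ) (ω : ℤ → ℝ) (n : ℕ) :
    cocycle (transferMat E) n ω 0 0 = (dpoly ω n).eval E ∧
    cocycle (transferMat E) (n + 1) ω 1 0 = (dpoly ω n).eval E ∧
    cocycle (transferMat E) (n + 1) ω 0 0 = (dpoly ω (n + 1)).eval E := by
  induction n with
  | zero => simp [cocycle, transferMat, dpoly]
  | succ n ih =>
    obtain ⟨-, h2, h3⟩ := ih
    refine ⟨h3, ?_, ?_⟩
    · rw [cocycle]
      simp only [Matrix.mul_apply, Fin.sum_univ_two]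
      rw [h2, h3]
      simp [transferMat]
    · rw [cocycle]
      simp only [Matrix.mul_apply, Fin.sum_univ_two]
      rw [h2, h3]
      have : dpoly ω (n + 1 + 1) = (X - C (ω (n + 2))) * dpoly ω (n + 1) - dpoly ω n := rfl
      rw [this]
      have e : (1 : ℤ) + ((n + 1 : ℕ) : ℤ) = n + 2 := by push_cast; ring
      simp only [transferMat, iterate_shift, e]
      simp
      ring

open Polynomial in
lemma aeval_dpoly_succ {z : ℂ} (hz : 0 < z.im) (ω : ℤ → ℝ) (n : ℕ) :
    aeval z (dpoly ω n) ≠ 0 ∧ aeval z (dpoly ω (n + 1)) =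
      approx n (fun i => ω (n + 1 - i)) z * aeval z (dpoly ω n) := by
  induction n with
  | zero => simp [dpoly, approx]
  | succ n ih =>
    obtain ⟨h1, h2⟩ := ih
    have h3 : aeval z (dpoly ω (n + 1)) ≠ 0 := by
      rw [h2]; exact mul_ne_zero (approx_ne_zero hz _ _) h1
    refine ⟨h3, ?_⟩
    have : dpoly ω (n + 1 + 1) = (X - C (ω (n + 2))) * dpoly ω (n + 1) - dpoly ω n := rfl
    rw [this, approx]
    have e : (fun i : ℕ => ω (((n + 1 : ℕ) : ℤ) + 1 - ((i + 1 : ℕ) : ℤ))) =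
        fun i : ℕ => ω ((n : ℤ) + 1 - i) := by
      funext i; congr 1; push_cast; ring
    have e2 : ((n + 1 : ℕ) : ℤ) + 1 - ((0 : ℕ) : ℤ) = n + 2 := by push_cast; ring
    rw [e, e2]
    have h4 := approx_ne_zero hz n fun i => ω ((n : ℤ) + 1 - i)
    simp only [map_sub, map_mul, aeval_X, aeval_C]
    rw [sub_mul _ (approx n (fun i : ℕ => ω ((n : ℤ) + 1 - i)) z)⁻¹, h2,
      inv_mul_cancel_left₀ h4]
    rfl

open Polynomial in
lemma aeval_dpoly_eq_prod {z : ℂ} (hz : 0 < z.im) (ω : ℤ → ℝ) (n : ℕ) :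
    aeval z (dpoly ω n) = ∏ j ∈ Finset.range n, approx j (fun i => ω (j + 1 - i)) z := by
  induction n with
  | zero => simp [dpoly]
  | succ n ih => rw [Finset.prod_range_succ, ← ih, (aeval_dpoly_succ hz ω n).2, mul_comm]

open Polynomial in
lemma exists_roots_dpoly (ω : ℤ → ℝ) (n : ℕ) : ∃ s : Multiset ℝ, s.card = n ∧
    ∀ z : ℂ, aeval z (dpoly ω n) = (s.map fun r : ℝ => z - r).prod := by
  obtain ⟨hm, hd, -⟩ := dpoly_monic ω n
  set p := (dpoly ω n).map (algebraMap ℝ ℂ) with hp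
  have hpm : p.Monic := hm.map _
  have hs := (IsAlgClosed.splits p)
  have him : ∀ r ∈ p.roots, ((r.re : ℝ) : ℂ) = r := by
    intro r hr
    rw [mem_roots hpm.ne_zero, IsRoot.def, hp, eval_map_algebraMap] at hr
    have h1 : ¬ 0 < r.im := fun h => (aeval_dpoly_succ h ω n).1 hr
    have h2 : ¬ 0 < ((starRingEnd ℂ) r).im := fun h => by
      refine (aeval_dpoly_succ h ω n).1 ?_
      rw [aeval_conj, hr, map_zero]
    rw [Complex.conj_im] at h2
    refine Complex.ext (by simp) ?_
    simp
    linarith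
  refine ⟨p.roots.map Complex.re, ?_, fun z => ?_⟩
  · rw [Multiset.card_map, ← hs.natDegree_eq_card_roots, hp, natDegree_map, hd]
  · rw [← eval_map_algebraMap, ← hp]
    conv_lhs => rw [hs.eq_prod_roots_of_monic hpm]
    rw [eval_multiset_prod, Multiset.map_map, Multiset.map_map]
    congr 1
    refine Multiset.map_congr rfl fun r hr => ?_
    simp [him r hr]

/-- Sequences bounded by `R`. -/
def boundedSeq (R : ℝ) : Set (ℤ → ℝ) := {ω | ∀ n, |ω n| ≤ R}

lemma isCompact_boundedSeq (R : ℝ) : IsCompact (boundedSeq R) := by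
  have : boundedSeq R = Set.pi univ fun _ : ℤ => Icc (-R) R := by
    ext ω; simp only [boundedSeq, abs_le, mem_ofPred_eq, mem_univ_pi, mem_Icc]
  rw [this]
  exact isCompact_univ_pi fun _ => isCompact_Icc

section

variable {ν : Measure (ℤ → ℝ)} {K : Set ℝ} {R : ℝ}

lemma measurePreserving_fshift [SFinite ν] (hT : MeasurePreserving (shift ℝ) ν ν)
    (K : Set ℝ) : MeasurePreserving fshift ((volume.restrict K).prod ν)
      ((volume.restrict K).prod ν) :=
  (MeasurePreserving.id _).prod hT

lemma prod_compl_null [SFinite ν] (hK : IsCompact K) (hν : ν (boundedSeq R)ᶜ = 0) :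
    ((volume.restrict K).prod ν) (K ×ˢ boundedSeq R)ᶜ = 0 := by
  rw [compl_prod_eq_union]
  refine measure_union_null ?_ ?_
  · rw [Measure.prod_prod, Measure.restrict_apply hK.measurableSet.compl]
    simp
  · rw [Measure.prod_prod, hν, mul_zero]

instance isFiniteMeasure_prod_restrict [Fact (IsCompact K)] [IsFiniteMeasure ν] :
    IsFiniteMeasure ((volume.restrict K).prod ν) := by
  have : IsFiniteMeasure (volume.restrict K) :=
    ⟨by rw [Measure.restrict_apply_univ]; exact (Fact.out : IsCompact K).measure_lt_top⟩
  infer_instance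

lemma measurePreserving_iterate (hT : MeasurePreserving (shift ℝ) ν ν) [SFinite ν] (n : ℕ) :
    MeasurePreserving (fun y : ℝ × (ℤ → ℝ) => (y.1, fun k => y.2 (k + n)))
      ((volume.restrict K).prod ν) ((volume.restrict K).prod ν) := by
  have := (measurePreserving_fshift hT K).iterate n
  convert this using 1
  funext y
  have h : ∀ m : ℕ, ∀ y, fshift^[m] y = (y.1, (shift ℝ)^[m] y.2) := by
    intro m
    induction m with
    | zero => intro y; rfl
    | succ m ih => intro y; rw [Function.iterate_succ_apply, ih]; rfl
  rw [h]
  ext k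
  · rfl
  · simp [iterate_shift]

lemma continuous_log_approx {ε : ℝ} (hε : 0 < ε) (k : ℕ) (c : ℤ) :
    Continuous fun y : ℝ × (ℤ → ℝ) =>
      Real.log ‖approx k (fun i => y.2 (c - i)) (y.1 + ε * Complex.I)‖ := by
  refine Continuous.log ?_ fun y => norm_ne_zero_iff.2 (approx_ne_zero (by rwa [im_line]) _ _)
  refine Continuous.norm ?_
  rw [← continuousOn_univ]
  refine (continuousOn_approx k).comp
    (f := fun y : ℝ × (ℤ → ℝ) => ((fun i : ℕ => y.2 (c - i)), ((y.1 : ℂ) + ε * Complex.I)))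
    (Continuous.continuousOn ?_) fun p _ => ?_
  · exact (by fun_prop : Continuous fun y : ℝ × (ℤ → ℝ) => (fun i : ℕ => y.2 (c - i))).prodMk
      (by fun_prop)
  · simpa using hε

lemma abs_log_sub_log_le {x y δ : ℝ} (hδ : 0 < δ) (hx : δ ≤ x) (hy : δ ≤ y) :
    |Real.log x - Real.log y| ≤ δ⁻¹ * |x - y| := by
  have key : ∀ x y : ℝ, δ ≤ x → δ ≤ y → Real.log x - Real.log y ≤ δ⁻¹ * |x - y| := by
    intro x y hx hy
    have hx0 := hδ.trans_le hx
    have hy0 := hδ.trans_le hy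
    rw [← Real.log_div hx0.ne' hy0.ne']
    refine (Real.log_le_sub_one_of_pos (by positivity)).trans ?_
    have : x / y - 1 = y⁻¹ * (x - y) := by field_simp
    rw [this]
    calc y⁻¹ * (x - y) ≤ y⁻¹ * |x - y| := by gcongr; exact le_abs_self _
      _ ≤ _ := by gcongr
  rw [abs_le]
  have h1 := key x y hx hy
  have h2 := key y x hy hx
  rw [abs_sub_comm] at h2
  constructor <;> linarith

lemma tendsto_integral_log_approx [IsFiniteMeasure ν] (hK : IsCompact K)
    (hν : ν (boundedSeq R)ᶜ = 0) {ε : ℝ} (hε : 0 < ε) :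
    Tendsto (fun k => ∫ y, Real.log ‖approx k (fun i => y.2 (-i)) (y.1 + ε * Complex.I)‖
      ∂((volume.restrict K).prod ν)) atTop (𝓝 (intLyap ((volume.restrict K).prod ν) ε)) := by
  have : Fact (IsCompact K) := ⟨hK⟩
  have hY := hK.prod (isCompact_boundedSeq R)
  have hρ := prod_compl_null hK hν
  set ρ := (volume.restrict K).prod ν with hρd
  set b : ℕ → ℝ := fun k => ∑' j : ℕ, (ε⁻¹ ^ 2 * (ε + ε⁻¹)) * ((1 + ε ^ 2)⁻¹) ^ (j + k) with hb
  have hbt : Tendsto (fun k => ε⁻¹ * b k * ρ.real univ) atTop (𝓝 0) := by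
    have := ((tendsto_cfrac_bound (δ := ε) (R := ε)).const_mul ε⁻¹).mul_const (ρ.real univ)
    simpa only [mul_zero, zero_mul] using this
  rw [tendsto_iff_dist_tendsto_zero]
  refine squeeze_zero (fun _ => dist_nonneg) (fun k => ?_) hbt
  have c1 : Continuous fun y : ℝ × (ℤ → ℝ) =>
      Real.log ‖approx k (fun i => y.2 (-i)) (y.1 + ε * Complex.I)‖ := by
    simpa using continuous_log_approx hε k 0
  have c2 : Continuous fun y => Real.log ‖pfun ε y‖ :=
    (continuous_pfun hε).norm.log fun y => norm_ne_zero_iff.2 (pfun_ne_zero hε y)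
  rw [Real.dist_eq, intLyap, ← integral_sub (integrable_of_continuous hY hρ c1)
    (integrable_of_continuous hY hρ c2), ← Real.norm_eq_abs]
  refine norm_integral_le_of_norm_le_const (Eventually.of_forall fun y => ?_)
  have hz : 0 < ((y.1 : ℂ) + ε * Complex.I).im := by rwa [im_line]
  have h1 := norm_pos_of_im hε ((im_line y.1).symm.le.trans (le_im_approx hz k fun i => y.2 (-i)))
  have h2 := norm_pos_of_im hε (lt_im_pfun hε y).le
  rw [Real.norm_eq_abs]
  refine (abs_log_sub_log_le hε h1 h2).trans ?_
  gcongr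
  refine (abs_norm_sub_norm_le _ _).trans ?_
  rw [norm_sub_rev]
  exact norm_cfrac_sub_approx_le hε (im_line y.1).symm.le (im_line y.1).le k _

lemma log_norm_dpoly_le (E : ℝ) (ω : ℤ → ℝ) (n : ℕ) :
    Real.log ‖Polynomial.aeval (E : ℂ) (dpoly ω n)‖ ≤ logNorm E n ω := by
  have h1 : Polynomial.aeval (E : ℂ) (dpoly ω n) = ((dpoly ω n).eval E : ℝ) := by
    have := Polynomial.aeval_algebraMap_apply ℂ E (dpoly ω n)
    simpa using this
  rw [h1, Complex.norm_real, Real.norm_eq_abs, ← (cocycle_apply_zero E ω n).1]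
  rcases eq_or_ne (cocycle (transferMat E) n ω 0 0) 0 with h | h
  · rw [h]; simpa using logNorm_nonneg E n ω
  · exact Real.log_le_log (abs_pos.2 h) (abs_le_matNorm _ _ _)

lemma abs_log_dpoly_integral_le [IsFiniteMeasure ν] (hK : IsCompact K)
    (hT : MeasurePreserving (shift ℝ) ν ν) (hν : ν (boundedSeq R)ᶜ = 0) {ε : ℝ} (hε : 0 < ε)
    (n : ℕ) :
    ∑ j ∈ Finset.range n, ∫ y, Real.log ‖approx j (fun i => y.2 (-i)) (y.1 + ε * Complex.I)‖
      ∂((volume.restrict K).prod ν) ≤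
    ∫ y, logNorm y.1 n y.2 ∂((volume.restrict K).prod ν) +
      n * (ε * ∫ x, logBump x) * ν.real univ := by
  have : Fact (IsCompact K) := ⟨hK⟩
  have hY := hK.prod (isCompact_boundedSeq R)
  have hρ := prod_compl_null hK hν
  set ρ := (volume.restrict K).prod ν with hρd
  have e1 : ∀ j : ℕ, ∫ y, Real.log ‖approx j (fun i => y.2 (-i)) (y.1 + ε * Complex.I)‖ ∂ρ =
      ∫ y, Real.log ‖approx j (fun i => y.2 (j + 1 - i)) (y.1 + ε * Complex.I)‖ ∂ρ := by
    intro j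
    have h := (measurePreserving_iterate (K := K) hT (j + 1))
    have c := continuous_log_approx hε j 0
    have := integral_map (μ := ρ) h.measurable.aemeasurable
      (c.aestronglyMeasurable (μ := Measure.map _ ρ))
    rw [h.map_eq] at this
    simp only [zero_sub] at this
    rw [this]
    congr 1
    funext y
    congr 4
    funext i
    have e : -(i : ℤ) + ((j + 1 : ℕ) : ℤ) = j + 1 - i := by push_cast; ring
    rw [e]
  have c1 : ∀ j : ℕ, Continuous fun y : ℝ × (ℤ → ℝ) =>
      Real.log ‖approx j (fun i => y.2 (j + 1 - i)) (y.1 + ε * Complex.I)‖ :=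
    fun j => continuous_log_approx hε j (j + 1)
  have c2 : Continuous fun y : ℝ × (ℤ → ℝ) => ∑ j ∈ Finset.range n,
      Real.log ‖approx j (fun i => y.2 (j + 1 - i)) (y.1 + ε * Complex.I)‖ :=
    continuous_finsetSum _ fun j _ => c1 j
  simp only [e1]
  rw [← integral_finsetSum _ fun j _ => integrable_of_continuous hY hρ (c1 j)]
  have i1 := integrable_of_continuous hY hρ c2
  have i2 := integrable_of_continuous hY hρ (continuous_logNorm n)
  have hfin : IsFiniteMeasure (volume.restrict K) :=
    ⟨by rw [Measure.restrict_apply_univ]; exact hK.measure_lt_top⟩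
  rw [hρd, integral_prod_symm _ i1, integral_prod_symm _ i2]
  have hconst : (n * (ε * ∫ x, logBump x)) * ν.real univ =
      ∫ _ω : ℤ → ℝ, (n * (ε * ∫ x, logBump x)) ∂ν := by
    rw [integral_const, smul_eq_mul, mul_comm]
  have j1 := i1.integral_prod_right
  have j2 := i2.integral_prod_right
  rw [hconst, ← integral_add j2 (integrable_const _)]
  refine integral_mono j1 (j2.add (integrable_const _)) fun ω => ?_
  obtain ⟨s, hs, hsz⟩ := exists_roots_dpoly ω n
  obtain ⟨g, hg, hg0, hgi, hge⟩ := exists_log_norm_line_le hε s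
  have k1 : IntegrableOn (fun E : ℝ => logNorm E n ω) K := by
    refine ContinuousOn.integrableOn_compact hK (Continuous.continuousOn ?_)
    exact (continuous_logNorm n).comp (f := fun E : ℝ => (E, ω)) (by fun_prop)
  have k2 : IntegrableOn (fun E : ℝ => ∑ j ∈ Finset.range n,
      Real.log ‖approx j (fun i => ω (j + 1 - i)) (E + ε * Complex.I)‖) K := by
    refine ContinuousOn.integrableOn_compact hK (Continuous.continuousOn ?_)
    exact c2.comp (f := fun E : ℝ => (E, ω)) (by fun_prop)
  show ∫ E in K, _ ≤ (∫ E in K, logNorm E n ω) + _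
  calc _ ≤ ∫ E in K, (logNorm E n ω + g E) := by
        refine integral_mono_ae k2 (k1.add hg.integrableOn) ?_
        filter_upwards [ae_restrict_of_ae hge] with E hE
        have hz : 0 < ((E : ℂ) + ε * Complex.I).im := by rwa [im_line]
        have h1 : ∑ j ∈ Finset.range n,
            Real.log ‖approx j (fun i => ω (j + 1 - i)) (E + ε * Complex.I)‖ =
            Real.log ‖Polynomial.aeval ((E : ℂ) + ε * Complex.I) (dpoly ω n)‖ := by
          rw [aeval_dpoly_eq_prod hz, norm_prod, Real.log_prod]
          exact fun j _ => norm_ne_zero_iff.2 (approx_ne_zero hz _ _)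
        show (∑ j ∈ Finset.range n, _) ≤ _
        rw [h1, hsz, hE.2, ← hsz]
        gcongr
        exact log_norm_dpoly_le E ω n
    _ = (∫ E in K, logNorm E n ω) + ∫ E in K, g E := integral_add k1 hg.integrableOn
    _ ≤ _ := by
        gcongr
        rw [← hs, ← hgi]
        exact setIntegral_le_integral hg (Eventually.of_forall hg0)

/-- If the Lyapunov exponent vanishes on `K`, then it grows at most linearly off the real axis. -/
lemma intLyap_le [IsProbabilityMeasure ν] (hK : IsCompact K)
    (hT : MeasurePreserving (shift ℝ) ν ν) (hν : ν (boundedSeq R)ᶜ = 0)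
    (hΛ : ∀ E ∈ K, Tendsto (fun n : ℕ => (n : ℝ)⁻¹ * ∫ ω, logNorm E n ω ∂ν) atTop (𝓝 0))
    {ε : ℝ} (hε : 0 < ε) :
    intLyap ((volume.restrict K).prod ν) ε ≤ (∫ x, logBump x) * ε := by
  have : Fact (IsCompact K) := ⟨hK⟩
  have hY := hK.prod (isCompact_boundedSeq R)
  have hρ := prod_compl_null hK hν
  have hfin : IsFiniteMeasure (volume.restrict K) :=
    ⟨by rw [Measure.restrict_apply_univ]; exact hK.measure_lt_top⟩
  have i2 := fun n => integrable_of_continuous hY hρ (continuous_logNorm n)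
  obtain ⟨B, hB⟩ := hK.exists_bound_of_continuousOn (f := fun x : ℝ => x) continuousOn_id
  have hbd : ∀ n : ℕ, ∀ E ∈ K, |(n : ℝ)⁻¹ * ∫ ω, logNorm E n ω ∂ν| ≤
      Real.log 2 + Real.log (2 + (B + R)) := by
    intro n E hE
    have h0 : 0 ≤ ∫ ω, logNorm E n ω ∂ν := integral_nonneg fun ω => logNorm_nonneg _ _ _
    rw [abs_of_nonneg (by positivity)]
    have hae : ∀ᵐ ω ∂ν, ω ∈ boundedSeq R := by rw [ae_iff]; exact hν
    have hle : ∀ᵐ ω ∂ν, ‖logNorm E n ω‖ ≤ Real.log 2 + n * Real.log (2 + (B + R)) := by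
      filter_upwards [hae] with ω hω
      rw [Real.norm_eq_abs, abs_of_nonneg (logNorm_nonneg _ _ _)]
      refine logNorm_le (fun k => ?_) n
      exact (abs_sub _ _).trans (add_le_add (hB E hE) (hω k))
    have h1 := norm_integral_le_of_norm_le_const hle
    rw [Real.norm_eq_abs, abs_of_nonneg h0] at h1
    simp only [probReal_univ, mul_one] at h1
    have hBR : 0 ≤ B + R := by
      obtain ⟨ω, hω⟩ := hae.exists
      exact add_nonneg ((norm_nonneg _).trans (hB E hE)) ((abs_nonneg _).trans (hω 0))
    have hl2 := Real.log_nonneg (by norm_num : (1:ℝ) ≤ 2)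
    have hl := Real.log_nonneg (by linarith : (1:ℝ) ≤ 2 + (B + R))
    rcases Nat.eq_zero_or_pos n with rfl | hn
    · simp; linarith
    · have hn1 : (1:ℝ) ≤ n := by exact_mod_cast hn
      rw [inv_mul_le_iff₀ (by linarith)]
      nlinarith
  have hmeas : ∀ n : ℕ, AEStronglyMeasurable (fun E => ∫ ω, logNorm E n ω ∂ν)
      (volume.restrict K) := fun n => (i2 n).integral_prod_left.aestronglyMeasurable
  have hF : Tendsto (fun n : ℕ => (n : ℝ)⁻¹ * ∫ y, logNorm y.1 n y.2 ∂((volume.restrict K).prod ν))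
      atTop (𝓝 0) := by
    have h1 : Tendsto (fun n : ℕ => ∫ E in K, (n : ℝ)⁻¹ * ∫ ω, logNorm E n ω ∂ν) atTop
        (𝓝 (∫ E in K, (0:ℝ))) := by
      refine tendsto_integral_of_dominated_convergence
        (fun _ => Real.log 2 + Real.log (2 + (B + R))) (fun n => (hmeas n).const_mul _)
        (integrable_const _) (fun n => ?_) ?_
      · filter_upwards [ae_restrict_mem hK.measurableSet] with E hE
        exact hbd n E hE
      · filter_upwards [ae_restrict_mem hK.measurableSet] with E hE
        exact hΛ E hE
    rw [integral_zero] at h1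
    refine h1.congr fun n => ?_
    rw [integral_const_mul, integral_prod _ (i2 n)]
  have hlhs := (tendsto_integral_log_approx hK hν hε).cesaro
  have hrhs : Tendsto (fun n : ℕ => (n : ℝ)⁻¹ *
      ∫ y, logNorm y.1 n y.2 ∂((volume.restrict K).prod ν) + (∫ x, logBump x) * ε) atTop
      (𝓝 (0 + (∫ x, logBump x) * ε)) := hF.add_const _
  rw [zero_add] at hrhs
  refine le_of_tendsto_of_tendsto hlhs hrhs ?_
  filter_upwards [eventually_gt_atTop 0] with n hn
  have h := abs_log_dpoly_integral_le hK hT hν hε n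
  have hn0 : (0:ℝ) < n := by exact_mod_cast hn
  rw [inv_mul_le_iff₀ hn0]
  refine h.trans (le_of_eq ?_)
  simp only [probReal_univ]
  field_simp

end

section Subshift

variable {Ω : Set (ℤ → ℝ)} {𝒜 : Set ℝ}

/-- Translation of a two-sided sequence. -/
def translate (k : ℤ) (ω : ℤ → ℝ) : ℤ → ℝ := fun n => ω (n + k)

lemma continuous_translate (k : ℤ) : Continuous (translate k) := by unfold translate; fun_prop

lemma translate_natCast (k : ℕ) : translate k = (shift ℝ)^[k] := by
  funext ω n; rw [iterate_shift]; rfl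

lemma translate_mem_nat (hΩ : IsSubshift Ω) (k : ℕ) {ω : ℤ → ℝ} (hω : ω ∈ Ω) :
    translate k ω ∈ Ω := by
  rw [translate_natCast]
  induction k with
  | zero => exact hω
  | succ k ih => rw [Function.iterate_succ_apply', ← hΩ.2]; exact mem_image_of_mem _ ih

lemma translate_mem (hΩ : IsSubshift Ω) (k : ℤ) {ω : ℤ → ℝ} (hω : ω ∈ Ω) :
    translate k ω ∈ Ω := by
  obtain ⟨n, rfl | rfl⟩ := k.eq_nat_or_neg
  · exact translate_mem_nat hΩ n hω
  · induction n with
    | zero =>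
      have : translate (-((0 : ℕ) : ℤ)) ω = ω := by funext m; simp [translate]
      rwa [this]
    | succ n ih =>
      rw [← hΩ.2] at ih
      obtain ⟨ω', h1, h2⟩ := ih
      have : translate (-((n + 1 : ℕ) : ℤ)) ω = ω' := by
        funext m
        have := congrFun h2 (m - 1)
        simp only [shift, translate, sub_add_cancel] at this ⊢
        rw [this]
        congr 1
        push_cast
        ring
      rwa [this]

lemma exists_subset_boundedSeq (h𝒜 : 𝒜.Finite) (hval : ∀ ω ∈ Ω, ∀ n : ℤ, ω n ∈ 𝒜) :
    ∃ R, 0 ≤ R ∧ Ω ⊆ boundedSeq R := by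
  obtain ⟨R, hR⟩ := h𝒜.isCompact.exists_bound_of_continuousOn (f := fun x : ℝ => x) continuousOn_id
  exact ⟨max R 0, le_max_right _ _, fun ω hω n => (hR _ (hval ω hω n)).trans (le_max_left _ _)⟩

lemma isCompact_subshift (h𝒜 : 𝒜.Finite) (hval : ∀ ω ∈ Ω, ∀ n : ℤ, ω n ∈ 𝒜)
    (hΩ : IsSubshift Ω) : IsCompact Ω := by
  obtain ⟨R, -, hR⟩ := exists_subset_boundedSeq h𝒜 hval
  exact (isCompact_boundedSeq R).of_isClosed_subset hΩ.1 hR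

lemma exists_translate_mem (hmin : IsMinimalSubshift Ω) {U : Set (ℤ → ℝ)} (hU : IsOpen U)
    (hne : (U ∩ Ω).Nonempty) {ω : ℤ → ℝ} (hω : ω ∈ Ω) : ∃ k : ℤ, translate k ω ∈ U := by
  obtain ⟨ω', h1, h2⟩ := hne
  obtain ⟨_, h3, k, rfl⟩ := mem_closure_iff.1 (hmin.2 ω hω h2) U hU h1
  exact ⟨k, h3⟩

lemma measure_translate_preimage {ν : Measure (ℤ → ℝ)} (hT : MeasurePreserving (shift ℝ) ν ν)
    (k : ℤ) {U : Set (ℤ → ℝ)} (hU : MeasurableSet U) : ν (translate k ⁻¹' U) = ν U := by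
  have hn : ∀ n : ℕ, ∀ V : Set (ℤ → ℝ), MeasurableSet V → ν (translate n ⁻¹' V) = ν V := by
    intro n V hV
    rw [translate_natCast]
    exact (hT.iterate n).measure_preimage hV.nullMeasurableSet
  obtain ⟨n, rfl | rfl⟩ := k.eq_nat_or_neg
  · exact hn n U hU
  · rw [← hn n _ ((continuous_translate _).measurable hU), ← preimage_comp]
    congr 1
    have : translate (-(n : ℤ)) ∘ translate (n : ℤ) = id := by
      funext ω m; simp [translate]
    rw [this, preimage_id]

/-- Invariant measures of minimal subshifts have full support. -/
lemma measure_pos_of_isOpen (hmin : IsMinimalSubshift Ω) {ν : Measure (ℤ → ℝ)}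
    [IsProbabilityMeasure ν] (hν : ν Ωᶜ = 0) (hT : MeasurePreserving (shift ℝ) ν ν)
    {U : Set (ℤ → ℝ)} (hU : IsOpen U) (hne : (U ∩ Ω).Nonempty) : ν U ≠ 0 := by
  intro h0
  have h1 : Ω ⊆ ⋃ k : ℤ, translate k ⁻¹' U := fun ω hω =>
    mem_iUnion.2 (exists_translate_mem hmin hU hne hω)
  have h2 : ν (⋃ k : ℤ, translate k ⁻¹' U) = 0 :=
    measure_iUnion_null fun k => by rw [measure_translate_preimage hT k hU.measurableSet, h0]
  have h3 : ν univ = 0 := by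
    rw [← union_compl_self Ω]
    exact measure_union_null (measure_mono_null h1 h2) hν
  simp at h3

/-- In an aperiodic subshift the past does not determine the future. -/
lemma exists_ne_of_aperiodic (h𝒜 : 𝒜.Finite) (hval : ∀ ω ∈ Ω, ∀ n : ℤ, ω n ∈ 𝒜)
    (hΩ : IsSubshift Ω) (hne : Ω.Nonempty) (haper : IsAperiodicSubshift Ω) :
    ∃ ω ∈ Ω, ∃ ω' ∈ Ω, (∀ n : ℤ, n ≤ 0 → ω n = ω' n) ∧ ω 1 ≠ ω' 1 := by
  have hcpt := isCompact_subshift h𝒜 hval hΩ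
  -- pairs agreeing on finite windows
  have hfin : ∀ N : ℕ, ∃ ω ∈ Ω, ∃ ω' ∈ Ω, (∀ n : ℤ, -N ≤ n → n ≤ 0 → ω n = ω' n) ∧
      ω 1 ≠ ω' 1 := by
    intro N
    by_contra! hcon
    obtain ⟨ω, hω⟩ := hne
    have : Fintype 𝒜 := h𝒜.fintype
    let win : ℤ → Fin (N + 1) → 𝒜 := fun m j => ⟨ω (m - j), hval ω hω _⟩
    have hwin : ∀ m m' : ℤ, win m = win m' → ω (m + 1) = ω (m' + 1) ∧ win (m + 1) = win (m' + 1) := by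
      intro m m' h
      have h' : ∀ j : ℕ, j ≤ N → ω (m - j) = ω (m' - j) := fun j hj =>
        congrArg Subtype.val (congrFun h ⟨j, by omega⟩)
      have h1 : ω (m + 1) = ω (m' + 1) := by
        have := hcon (translate m ω) (translate_mem hΩ m hω) (translate m' ω)
          (translate_mem hΩ m' hω) fun n hn1 hn2 => ?_
        · simpa [translate, add_comm] using this
        · have := h' (-n).toNat (by omega)
          have e : (((-n).toNat : ℕ) : ℤ) = -n := Int.toNat_of_nonneg (by omega)
          rw [e] at this
          simp only [translate]
          rw [show n + m = m - -n by ring, show n + m' = m' - -n by ring, this]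
      refine ⟨h1, ?_⟩
      funext j
      refine Subtype.ext ?_
      show ω (m + 1 - (j : ℕ)) = ω (m' + 1 - (j : ℕ))
      rcases Nat.eq_zero_or_pos (j : ℕ) with h0 | h0
      · rw [h0]; simpa using h1
      · have := h' ((j : ℕ) - 1) (by omega)
        rw [Nat.cast_sub h0] at this
        push_cast at this
        rw [show m + 1 - ((j : ℕ) : ℤ) = m - (((j : ℕ) : ℤ) - 1) by ring,
          show m' + 1 - ((j : ℕ) : ℤ) = m' - (((j : ℕ) : ℤ) - 1) by ring, this]
    have hper : ∀ m m' : ℤ, win m = win m' → ∀ k : ℕ, win (m + k) = win (m' + k) := by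
      intro m m' h k
      induction k with
      | zero => simpa using h
      | succ k ih =>
        have := (hwin _ _ ih).2
        push_cast
        rwa [← add_assoc, ← add_assoc]
    set W := Fintype.card (Fin (N + 1) → 𝒜) with hW
    refine haper ω hω (W.factorial : ℤ) (by exact_mod_cast W.factorial_ne_zero) ?_
    funext n
    -- two equal windows shortly before `n`
    obtain ⟨i, j, hij, h⟩ := Fintype.exists_ne_map_eq_of_card_lt
      (fun i : Fin (W + 1) => win (n - W + i)) (by simp [hW])
    wlog hlt : i < j generalizing i j
    · exact this j i hij.symm h.symm (lt_of_le_of_ne (not_lt.1 hlt) hij.symm)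
    obtain ⟨p, hp⟩ : ∃ p : ℕ, (j : ℕ) = i + p := ⟨j - i, by have : (i : ℕ) < j := hlt; omega⟩
    have hp0 : 0 < p := by have : (i : ℕ) < j := hlt; omega
    have hpW : p ≤ W := by have := j.2; omega
    have hstep : ∀ k : ℕ, ω (n - W + i + k) = ω (n - W + i + k + p) := by
      intro k
      have := hper _ _ h k
      have := congrArg Subtype.val (congrFun this 0)
      simp only [win, Fin.val_zero, Nat.cast_zero, sub_zero] at this
      rw [this, hp]
      congr 1
      push_cast
      ring
    have hmul : ∀ q : ℕ, ω (n + (q * p : ℕ)) = ω n := by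
      intro q
      induction q with
      | zero => simp
      | succ q ih =>
        have hk : (i : ℕ) ≤ W := by have := i.2; omega
        have := hstep (W - i + q * p)
        rw [← ih]
        push_cast [Nat.cast_sub hk] at this ⊢
        rw [show n + ((q : ℤ) + 1) * p = n - W + (i : ℕ) + (W - (i : ℕ) + q * p) + p by ring, ← this]
        congr 1
        ring
    obtain ⟨q, hq⟩ := Nat.dvd_factorial hp0 hpW
    rw [hq, mul_comm p q]
    exact hmul q
  have hDfin : ({x : ℝ | ∃ a ∈ 𝒜, ∃ b ∈ 𝒜, a ≠ b ∧ x = a - b}).Finite := by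
    refine ((h𝒜.prod h𝒜).image fun p => p.1 - p.2).subset ?_
    rintro x ⟨a, ha, b, hb, -, rfl⟩
    exact ⟨(a, b), ⟨ha, hb⟩, rfl⟩
  set D := {x : ℝ | ∃ a ∈ 𝒜, ∃ b ∈ 𝒜, a ≠ b ∧ x = a - b} with hD
  let t : ℕ → Set ((ℤ → ℝ) × (ℤ → ℝ)) := fun N =>
    (Ω ×ˢ Ω) ∩ ((⋂ n ∈ {n : ℤ | -N ≤ n ∧ n ≤ 0}, {x | x.1 n = x.2 n}) ∩ {x | x.1 1 - x.2 1 ∈ D})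
  have htcl : ∀ N, IsClosed (t N) := by
    intro N
    refine (hΩ.1.prod hΩ.1).inter (IsClosed.inter ?_ ?_)
    · exact isClosed_biInter fun n _ => isClosed_eq (by fun_prop) (by fun_prop)
    · exact hDfin.isClosed.preimage (by fun_prop)
  obtain ⟨⟨ω, ω'⟩, hx⟩ := IsCompact.nonempty_iInter_of_sequence_nonempty_isCompact_isClosed t
    (fun N x hx => by
      refine ⟨hx.1, ?_, hx.2.2⟩
      have := hx.2.1
      simp only [mem_iInter] at this ⊢
      intro n hn
      exact this n ⟨by have := hn.1; push_cast; omega, hn.2⟩)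
    (fun N => by
      obtain ⟨ω, hω, ω', hω', h1, h2⟩ := hfin N
      refine ⟨(ω, ω'), ⟨hω, hω'⟩, ?_, ω 1, hval _ hω _, ω' 1, hval _ hω' _, h2, rfl⟩
      simp only [mem_iInter]
      exact fun n hn => h1 n hn.1 hn.2)
    ((hcpt.prod hcpt).of_isClosed_subset (htcl 0) inter_subset_left) htcl
  rw [mem_iInter] at hx
  refine ⟨ω, (hx 0).1.1, ω', (hx 0).1.2, fun n hn => ?_, fun h => ?_⟩
  · have := (hx (-n).toNat).2.1
    simp only [mem_iInter] at this
    exact this n ⟨by omega, hn⟩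
  · obtain ⟨a, -, b, -, hab, h'⟩ := (hx 0).2.2
    simp only at h'
    rw [h, sub_self] at h'
    exact hab (sub_eq_zero.1 h'.symm)

end Subshift

/-- Bounded transform of the left half-line function. -/
noncomputable def leftFun (ω : ℤ → ℝ) (z : ℂ) : ℂ :=
  (cfrac (fun n => ω (-n)) z + Complex.I)⁻¹

/-- Bounded transform of the right half-line function. -/
noncomputable def rightFun (ω : ℤ → ℝ) (z : ℂ) : ℂ :=
  (-(cfrac (fun n => ω (n + 1)) z)⁻¹ + Complex.I)⁻¹

lemma im_neg_inv_cfrac_pos {z : ℂ} (hz : 0 < z.im) (a : ℕ → ℝ) : 0 < (-(cfrac a z)⁻¹).im := by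
  rw [im_neg_inv]
  have h1 := le_im_cfrac hz a
  have h2 := norm_pos_of_im hz h1
  have h3 := hz.trans_le h1
  have h4 := hz.trans_le h2
  positivity

lemma im_cfrac_pos {z : ℂ} (hz : 0 < z.im) (a : ℕ → ℝ) : 0 < (cfrac a z).im :=
  hz.trans_le (le_im_cfrac hz a)

lemma norm_inv_add_I_le {w : ℂ} (hw : 0 < w.im) : ‖(w + Complex.I)⁻¹‖ ≤ 1 := by
  rw [norm_inv]
  refine inv_le_one_of_one_le₀ ?_
  have := (le_abs_self _).trans (Complex.abs_im_le_norm (w + Complex.I))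
  simp at this
  linarith

lemma norm_leftFun_le (ω : ℤ → ℝ) {z : ℂ} (hz : 0 < z.im) : ‖leftFun ω z‖ ≤ 1 :=
  norm_inv_add_I_le (im_cfrac_pos hz _)

lemma norm_rightFun_le (ω : ℤ → ℝ) {z : ℂ} (hz : 0 < z.im) : ‖rightFun ω z‖ ≤ 1 :=
  norm_inv_add_I_le (im_neg_inv_cfrac_pos hz _)

lemma differentiableOn_leftFun (ω : ℤ → ℝ) : DifferentiableOn ℂ (leftFun ω) {z | 0 < z.im} :=
  ((differentiableOn_cfrac _).add_const _).inv fun _ hz => add_I_ne_zero (im_cfrac_pos hz _)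

lemma differentiableOn_rightFun (ω : ℤ → ℝ) : DifferentiableOn ℂ (rightFun ω) {z | 0 < z.im} :=
  (((differentiableOn_cfrac _).inv fun _ hz => cfrac_ne_zero hz _).neg.add_const _).inv
    fun _ hz => add_I_ne_zero (im_neg_inv_cfrac_pos hz _)

lemma continuous_leftFun {z : ℂ} (hz : 0 < z.im) : Continuous fun ω => leftFun ω z := by
  unfold leftFun
  refine Continuous.inv₀ (Continuous.add ?_ continuous_const)
    fun ω => add_I_ne_zero (im_cfrac_pos hz _)
  rw [← continuousOn_univ]
  refine continuousOn_cfrac.comp (f := fun ω : ℤ → ℝ => ((fun n : ℕ => ω (-n)), z))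
    (Continuous.continuousOn ?_) fun _ _ => hz
  exact (by fun_prop : Continuous fun ω : ℤ → ℝ => (fun n : ℕ => ω (-n))).prodMk continuous_const

lemma continuous_rightFun {z : ℂ} (hz : 0 < z.im) : Continuous fun ω => rightFun ω z := by
  unfold rightFun
  refine Continuous.inv₀ (Continuous.add (Continuous.neg (Continuous.inv₀ ?_
    fun ω => cfrac_ne_zero hz _)) continuous_const) fun ω => add_I_ne_zero (im_neg_inv_cfrac_pos hz _)
  rw [← continuousOn_univ]
  refine continuousOn_cfrac.comp (f := fun ω : ℤ → ℝ => ((fun n : ℕ => ω (n + 1)), z))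
    (Continuous.continuousOn ?_) fun _ _ => hz
  exact (by fun_prop : Continuous fun ω : ℤ → ℝ => (fun n : ℕ => ω (n + 1))).prodMk
    continuous_const

/-- The sum of the bounded transforms, one of them conjugated. -/
noncomputable def reflSum (ω : ℤ → ℝ) (z : ℂ) : ℂ :=
  leftFun ω z + (starRingEnd ℂ) (rightFun ω z)

lemma norm_reflSum_le (ω : ℤ → ℝ) {z : ℂ} (hz : 0 < z.im) : ‖reflSum ω z‖ ≤ 2 := by
  refine (norm_add_le _ _).trans ?_
  rw [Complex.norm_conj]
  linarith [norm_leftFun_le ω hz, norm_rightFun_le ω hz]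

lemma continuous_reflSum {z : ℂ} (hz : 0 < z.im) : Continuous fun ω => reflSum ω z :=
  (continuous_leftFun hz).add (Complex.continuous_conj.comp (continuous_rightFun hz))

lemma continuousOn_reflSum (ω : ℤ → ℝ) : ContinuousOn (reflSum ω) {z | 0 < z.im} :=
  (differentiableOn_leftFun ω).continuousOn.add
    (Complex.continuous_conj.comp_continuousOn (differentiableOn_rightFun ω).continuousOn)

lemma continuous_reflSum_line (ω : ℤ → ℝ) {ε : ℝ} (hε : 0 < ε) :
    Continuous fun t : ℝ => reflSum ω (t + ε * Complex.I) := by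
  rw [← continuousOn_univ]
  exact (continuousOn_reflSum ω).comp (f := fun t : ℝ => (t : ℂ) + ε * Complex.I)
    (by fun_prop) fun t _ => by simpa using hε

lemma norm_reflSum_poisson_le (ω : ℤ → ℝ) {K : Set ℝ} (hK : IsCompact K) {z : ℂ} (hz : 0 < z.im)
    {ε : ℝ} (hε : 0 < ε) : ‖reflSum ω (z + ε * Complex.I)‖ ≤
      Real.pi⁻¹ * z.im⁻¹ * (∫ t in K, ‖defect ε (t, ω)‖) + 2 * harm Kᶜ z := by
  have him : ∀ t : ℝ, 0 < ((t : ℂ) + ε * Complex.I).im := fun t => by simpa using hε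
  have hc := continuous_reflSum_line ω hε
  have e : reflSum ω (z + ε * Complex.I) =
      ∫ t : ℝ, (poissonKer z t : ℂ) * reflSum ω (t + ε * Complex.I) := by
    have h1 := integral_poissonKer_smul (differentiableOn_leftFun ω)
      (fun z hz => norm_leftFun_le ω hz) hε hz
    have h2 := integral_poissonKer_smul (differentiableOn_rightFun ω)
      (fun z hz => norm_rightFun_le ω hz) hε hz
    have hfint : ∀ f : ℂ → ℂ, ContinuousOn f {z | 0 < z.im} → (∀ z, 0 < z.im → ‖f z‖ ≤ 1) →
        Integrable fun t : ℝ => (poissonKer z t : ℂ) * f (t + ε * Complex.I) := by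
      intro f hf hf1
      refine (integrable_poissonKer hz).ofReal.mul_bdd (c := 1) ?_ (Eventually.of_forall fun t => hf1 _ (him t))
      refine Continuous.aestronglyMeasurable ?_
      rw [← continuousOn_univ]
      exact hf.comp (f := fun t : ℝ => (t : ℂ) + ε * Complex.I) (by fun_prop) fun t _ => him t
    have h3 : (starRingEnd ℂ) (rightFun ω (z + ε * Complex.I)) =
        ∫ t : ℝ, (poissonKer z t : ℂ) * (starRingEnd ℂ) (rightFun ω (t + ε * Complex.I)) := by
      rw [← h2, ← integral_conj]
      simp
    rw [reflSum, h3, ← h1, ← integral_add]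
    · simp only [reflSum, mul_add]
    · exact hfint _ (differentiableOn_leftFun ω).continuousOn fun z hz => norm_leftFun_le ω hz
    · exact hfint (fun z => (starRingEnd ℂ) (rightFun ω z))
        (Complex.continuous_conj.comp_continuousOn (differentiableOn_rightFun ω).continuousOn)
        fun z hz => by rw [Complex.norm_conj]; exact norm_rightFun_le ω hz
  have hfint : Integrable fun t : ℝ => poissonKer z t * ‖reflSum ω (t + ε * Complex.I)‖ :=
    (integrable_poissonKer hz).mul_bdd (c := 2) hc.norm.aestronglyMeasurable
      (Eventually.of_forall fun t => by rw [norm_norm]; exact norm_reflSum_le ω (him t))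
  calc ‖reflSum ω (z + ε * Complex.I)‖
      ≤ ∫ t : ℝ, ‖(poissonKer z t : ℂ) * reflSum ω (t + ε * Complex.I)‖ := by
        rw [e]; exact norm_integral_le_integral_norm _
    _ = ∫ t : ℝ, poissonKer z t * ‖reflSum ω (t + ε * Complex.I)‖ := by
        congr 1; funext t
        rw [norm_mul, Complex.norm_real, Real.norm_eq_abs, abs_of_nonneg (poissonKer_nonneg hz t)]
    _ = (∫ t in K, poissonKer z t * ‖reflSum ω (t + ε * Complex.I)‖) +
        ∫ t in Kᶜ, poissonKer z t * ‖reflSum ω (t + ε * Complex.I)‖ :=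
        (integral_add_compl hK.measurableSet hfint).symm
    _ ≤ _ := by
        refine add_le_add ?_ ?_
        · rw [← integral_const_mul]
          refine integral_mono hfint.integrableOn ?_ fun t => ?_
          · exact (hc.norm.continuousOn.integrableOn_compact hK).const_mul _
          · show poissonKer z t * ‖reflSum ω (t + ε * Complex.I)‖ ≤
              Real.pi⁻¹ * z.im⁻¹ * ‖reflSum ω (t + ε * Complex.I)‖
            exact mul_le_mul_of_nonneg_right (poissonKer_le hz t) (norm_nonneg _)
        · unfold harm
          rw [← integral_const_mul]
          refine integral_mono hfint.integrableOn
            ((integrable_poissonKer hz).integrableOn.const_mul 2) fun t => ?_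
          show _ ≤ 2 * poissonKer z t
          rw [mul_comm]
          exact mul_le_mul_of_nonneg_right (norm_reflSum_le ω (him t)) (poissonKer_nonneg hz t)

section

variable {ν : Measure (ℤ → ℝ)} {K : Set ℝ} {R : ℝ} {Ω : Set (ℤ → ℝ)} {𝒜 : Set ℝ}

/-- Almost sure reflection estimate. -/
lemma ae_norm_reflSum_le [IsProbabilityMeasure ν] (hK : IsCompact K)
    (hT : MeasurePreserving (shift ℝ) ν ν) (hν : ν (boundedSeq R)ᶜ = 0)
    (hΛ : ∀ E ∈ K, Tendsto (fun n : ℕ => (n : ℝ)⁻¹ * ∫ ω, logNorm E n ω ∂ν) atTop (𝓝 0))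
    {z : ℂ} (hz : 0 < z.im) : ∀ᵐ ω ∂ν, ‖reflSum ω z‖ ≤ 2 * harm Kᶜ z := by
  have : Fact (IsCompact K) := ⟨hK⟩
  have hY := hK.prod (isCompact_boundedSeq R)
  have hρ := prod_compl_null hK hν
  have hS := measurePreserving_fshift hT K
  have hfin : IsFiniteMeasure (volume.restrict K) :=
    ⟨by rw [Measure.restrict_apply_univ]; exact hK.measure_lt_top⟩
  set ρ := (volume.restrict K).prod ν with hρd
  have hC : ∀ ε, 0 < ε → intLyap ρ ε ≤ (∫ x, logBump x) * ε := fun ε hε => intLyap_le hK hT hν hΛ hε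
  choose e he0 he1 he2 using fun j : ℕ => exists_defect_lt hS hY hρ hC
    (c := 1 / ((j : ℝ) + 1)) (ε₀ := 1 / ((j : ℝ) + 1)) (by positivity) (by positivity)
  have he : Tendsto e atTop (𝓝 0) :=
    squeeze_zero (fun j => (he0 j).le) (fun j => (he1 j).le) tendsto_one_div_add_atTop_nhds_zero_nat
  have hsq : Tendsto (fun j => ∫ y, ‖defect (e j) y‖ ^ 2 ∂ρ) atTop (𝓝 0) :=
    squeeze_zero (fun j => integral_nonneg fun y => by positivity) (fun j => (he2 j).le)
      tendsto_one_div_add_atTop_nhds_zero_nat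
  have hi1 : ∀ j, Integrable (fun y => ‖defect (e j) y‖) ρ := fun j =>
    integrable_of_continuous hY hρ (continuous_defect (he0 j)).norm
  have hi2 : ∀ j, Integrable (fun y => ‖defect (e j) y‖ ^ 2) ρ := fun j =>
    integrable_of_continuous hY hρ ((continuous_defect (he0 j)).norm.pow 2)
  have hl1 : Tendsto (fun j => ∫ y, ‖defect (e j) y‖ ∂ρ) atTop (𝓝 0) := by
    have hle : ∀ j, ∀ δ : ℝ, 0 < δ → ∫ y, ‖defect (e j) y‖ ∂ρ ≤
        δ * ρ.real univ + δ⁻¹ * ∫ y, ‖defect (e j) y‖ ^ 2 ∂ρ := by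
      intro j δ hδ
      have h1 : ∫ y, ‖defect (e j) y‖ ∂ρ ≤ ∫ y, (δ + δ⁻¹ * ‖defect (e j) y‖ ^ 2) ∂ρ := by
        refine integral_mono (hi1 j) ((integrable_const _).add ((hi2 j).const_mul _)) fun y => ?_
        show ‖defect (e j) y‖ ≤ δ + δ⁻¹ * ‖defect (e j) y‖ ^ 2
        have h2 : δ * ‖defect (e j) y‖ ≤ δ * (δ + δ⁻¹ * ‖defect (e j) y‖ ^ 2) := by
          have : δ * (δ + δ⁻¹ * ‖defect (e j) y‖ ^ 2) = δ ^ 2 + ‖defect (e j) y‖ ^ 2 := by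
            field_simp
          rw [this]
          nlinarith [sq_nonneg (δ - ‖defect (e j) y‖), sq_nonneg δ, sq_nonneg ‖defect (e j) y‖]
        exact le_of_mul_le_mul_left h2 hδ
      rw [integral_add (integrable_const _) ((hi2 j).const_mul _), integral_const,
        integral_const_mul, smul_eq_mul, mul_comm] at h1
      exact h1
    rw [Metric.tendsto_nhds]
    intro η hη
    have hm : 0 ≤ ρ.real univ := measureReal_nonneg
    set δ := η / (2 * (ρ.real univ + 1)) with hδ
    have hδ0 : 0 < δ := by positivity
    have h1 : δ * ρ.real univ < η / 2 := by
      rw [hδ, div_mul_eq_mul_div, div_lt_div_iff₀ (by positivity) (by norm_num)]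
      nlinarith
    have h2 : ∀ᶠ j in atTop, δ⁻¹ * ∫ y, ‖defect (e j) y‖ ^ 2 ∂ρ < η / 2 := by
      have := hsq.const_mul δ⁻¹
      rw [mul_zero] at this
      exact this.eventually (gt_mem_nhds (by positivity))
    filter_upwards [h2] with j hj
    rw [Real.dist_eq, sub_zero, abs_of_nonneg (integral_nonneg fun y => norm_nonneg _)]
    linarith [hle j δ hδ0]
  -- positive parts
  have him : ∀ j, 0 < (z + e j * Complex.I).im := fun j => by
    have := he0 j
    simp
    linarith
  set u : ℕ → (ℤ → ℝ) → ℝ := fun j ω =>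
    max (‖reflSum ω (z + e j * Complex.I)‖ - 2 * harm Kᶜ z) 0 with hu
  have huc : ∀ j, Continuous (u j) := fun j =>
    ((continuous_reflSum (him j)).norm.sub continuous_const).max continuous_const
  have hub : ∀ j ω, ‖u j ω‖ ≤ 2 := fun j ω => by
    rw [Real.norm_eq_abs, abs_of_nonneg (le_max_right _ _)]
    refine max_le ?_ (by norm_num)
    linarith [norm_reflSum_le ω (him j), harm_nonneg Kᶜ hz]
  have hui : ∀ j, Integrable (u j) ν := fun j =>
    Integrable.of_bound (huc j).aestronglyMeasurable 2 (Eventually.of_forall (hub j))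
  have hule : ∀ j, ∫ ω, u j ω ∂ν ≤ Real.pi⁻¹ * z.im⁻¹ * ∫ y, ‖defect (e j) y‖ ∂ρ := by
    intro j
    rw [hρd, integral_prod_symm _ (hi1 j), ← integral_const_mul]
    refine integral_mono (hui j) ((hi1 j).integral_prod_right.const_mul _) fun ω => ?_
    refine max_le ?_ ?_
    · have := norm_reflSum_poisson_le ω hK hz (he0 j)
      show _ ≤ Real.pi⁻¹ * z.im⁻¹ * ∫ t in K, ‖defect (e j) (t, ω)‖
      linarith
    · have : 0 ≤ ∫ t in K, ‖defect (e j) (t, ω)‖ := integral_nonneg fun t => norm_nonneg _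
      have := Real.pi_pos
      show 0 ≤ Real.pi⁻¹ * z.im⁻¹ * ∫ t in K, ‖defect (e j) (t, ω)‖
      positivity
  have hu0 : Tendsto (fun j => ∫ ω, u j ω ∂ν) atTop (𝓝 0) := by
    have := hl1.const_mul (Real.pi⁻¹ * z.im⁻¹)
    rw [mul_zero] at this
    exact squeeze_zero (fun j => integral_nonneg fun ω => le_max_right _ _) hule this
  have hulim : ∀ ω, Tendsto (fun j => u j ω) atTop (𝓝 (max (‖reflSum ω z‖ - 2 * harm Kᶜ z) 0)) := by
    intro ω
    have h1 : Tendsto (fun j => z + e j * Complex.I) atTop (𝓝 z) := by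
      have h2 : Continuous fun x : ℝ => z + x * Complex.I := by fun_prop
      exact (h2.tendsto' 0 z (by simp)).comp he
    have h2 : ContinuousAt (reflSum ω) z := (continuousOn_reflSum ω).continuousAt
      ((isOpen_lt continuous_const Complex.continuous_im).mem_nhds hz)
    exact ((h2.tendsto.comp h1).norm.sub_const _).max tendsto_const_nhds
  have hfint := tendsto_integral_of_dominated_convergence (fun _ => (2:ℝ))
    (fun j => (huc j).aestronglyMeasurable) (integrable_const _)
    (fun j => Eventually.of_forall (hub j)) (Eventually.of_forall hulim) (μ := ν)
  have hzero := tendsto_nhds_unique hfint hu0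
  have hlimc : Continuous fun ω => max (‖reflSum ω z‖ - 2 * harm Kᶜ z) 0 :=
    ((continuous_reflSum hz).norm.sub continuous_const).max continuous_const
  have hlint : Integrable (fun ω => max (‖reflSum ω z‖ - 2 * harm Kᶜ z) 0) ν :=
    Integrable.of_bound hlimc.aestronglyMeasurable 2 (Eventually.of_forall fun ω =>
      le_of_tendsto (hulim ω).norm (Eventually.of_forall fun j => hub j ω))
  have h0 := (integral_eq_zero_iff_of_nonneg
    (f := fun ω => max (‖reflSum ω z‖ - 2 * harm Kᶜ z) 0)
    (fun ω => le_max_right _ _) hlint).1 hzero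
  filter_upwards [h0] with ω hω
  have := le_max_left (‖reflSum ω z‖ - 2 * harm Kᶜ z) 0
  simp only [Pi.zero_apply] at hω
  linarith

/-- Kotani's theorem for aperiodic subshifts with finitely many values: a compact set of energies
with vanishing Lyapunov exponent is a null set. -/
theorem volume_eq_zero_of_lyapunov [IsProbabilityMeasure ν] (h𝒜 : 𝒜.Finite)
    (hval : ∀ ω ∈ Ω, ∀ n : ℤ, ω n ∈ 𝒜) (hmin : IsMinimalSubshift Ω) (hne : Ω.Nonempty)
    (haper : IsAperiodicSubshift Ω) (hT : MeasurePreserving (shift ℝ) ν ν) (hν : ν Ωᶜ = 0)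
    (hK : IsCompact K)
    (hΛ : ∀ E ∈ K, Tendsto (fun n : ℕ => (n : ℝ)⁻¹ * ∫ ω, logNorm E n ω ∂ν) atTop (𝓝 0)) :
    volume K = 0 := by
  by_contra hv
  obtain ⟨R, -, hR⟩ := exists_subset_boundedSeq h𝒜 hval
  have hνR : ν (boundedSeq R)ᶜ = 0 := measure_mono_null (compl_subset_compl.2 hR) hν
  have hall : ∀ ω ∈ Ω, ∀ z : ℂ, 0 < z.im → ‖reflSum ω z‖ ≤ 2 * harm Kᶜ z := by
    intro ω hω z hz
    by_contra! hlt
    have hU : IsOpen {ω : ℤ → ℝ | 2 * harm Kᶜ z < ‖reflSum ω z‖} :=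
      isOpen_lt continuous_const (continuous_reflSum hz).norm
    refine measure_pos_of_isOpen hmin hν hT hU ⟨ω, hlt, hω⟩ ?_
    have := ae_norm_reflSum_le hK hT hνR hΛ hz
    rw [ae_iff] at this
    simpa only [not_le] using this
  obtain ⟨ω, hω, ω', hω', hpast, hfut⟩ := exists_ne_of_aperiodic h𝒜 hval hmin.1 hne haper
  have hleft : ∀ z, leftFun ω z = leftFun ω' z := fun z => by
    unfold leftFun
    congr 3
    funext n
    exact hpast _ (by omega)
  have hzero : ∀ z : ℂ, 0 < z.im → rightFun ω z - rightFun ω' z = 0 := by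
    intro z hz
    refine eq_zero_of_norm_le_harm hK hv (g := fun z => rightFun ω z - rightFun ω' z) (C := 2)
      (c := 4) ((differentiableOn_rightFun ω).sub (differentiableOn_rightFun ω')) (by norm_num)
      (fun z hz => ?_) (fun z hz => ?_) hz
    · exact (norm_sub_le _ _).trans (by linarith [norm_rightFun_le ω hz, norm_rightFun_le ω' hz])
    · have e : rightFun ω z - rightFun ω' z =
          (starRingEnd ℂ) (reflSum ω z - reflSum ω' z) := by
        simp [reflSum, hleft]
      show ‖rightFun ω z - rightFun ω' z‖ ≤ _
      rw [e, Complex.norm_conj]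
      exact (norm_sub_le _ _).trans (by linarith [hall ω hω z hz, hall ω' hω' z hz])
  have hcf : ∀ z : ℂ, 0 < z.im →
      cfrac (fun n => ω (n + 1)) z = cfrac (fun n => ω' (n + 1)) z := by
    intro z hz
    have h := sub_eq_zero.1 (hzero z hz)
    unfold rightFun at h
    exact inv_injective (neg_injective (add_right_cancel (inv_injective h)))
  refine hfut ?_
  have hclose : ∀ y : ℝ, 0 < y → |ω 1 - ω' 1| ≤ 2 * y⁻¹ := by
    intro y hy
    have hz : 0 < ((y : ℂ) * Complex.I).im := by simpa using hy
    have him : ((y : ℂ) * Complex.I).im = y := by simp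
    have h := hcf _ hz
    rw [cfrac_eq hz, cfrac_eq hz (fun n => ω' (n + 1))] at h
    have hinv : ∀ a : ℕ → ℝ, ‖(cfrac a ((y : ℂ) * Complex.I))⁻¹‖ ≤ y⁻¹ := by
      intro a
      rw [norm_inv]
      exact inv_anti₀ hy (norm_pos_of_im hy (him.symm.le.trans (le_im_cfrac hz a)))
    set A := (cfrac (fun n : ℕ => ω (((n + 1 : ℕ) : ℤ) + 1)) ((y : ℂ) * Complex.I))⁻¹ with hA
    set B := (cfrac (fun n : ℕ => ω' (((n + 1 : ℕ) : ℤ) + 1)) ((y : ℂ) * Complex.I))⁻¹ with hB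
    have e : ((ω 1 - ω' 1 : ℝ) : ℂ) = B - A := by
      simp only [Nat.cast_zero, zero_add] at h
      push_cast
      linear_combination -h
    rw [← Real.norm_eq_abs, ← Complex.norm_real, e]
    have hA' : ‖A‖ ≤ y⁻¹ := hinv _
    have hB' : ‖B‖ ≤ y⁻¹ := hinv _
    exact (norm_sub_le _ _).trans (by linarith)
  have hlim : Tendsto (fun y : ℝ => 2 * y⁻¹) atTop (𝓝 0) := by
    simpa using tendsto_inv_atTop_zero.const_mul (2:ℝ)
  have h0 : |ω 1 - ω' 1| ≤ 0 :=
    ge_of_tendsto hlim ((eventually_gt_atTop 0).mono fun y hy => hclose y hy)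
  exact sub_eq_zero.1 (abs_nonpos_iff.1 h0)

end

section

variable {ν : Measure (ℤ → ℝ)} {Ω : Set (ℤ → ℝ)} {𝒜 : Set ℝ}

theorem iterate_shift_mem (hΩ : IsSubshift Ω) {ω : ℤ → ℝ} (hω : ω ∈ Ω) (k : ℕ) :
    (shift ℝ)^[k] ω ∈ Ω := by
  rw [← translate_natCast]
  exact translate_mem hΩ _ hω

/-- A point of a minimal aperiodic subshift has no periodic tail. -/
theorem exists_ne_add_period (h𝒜 : 𝒜.Finite) (hval : ∀ ω ∈ Ω, ∀ n : ℤ, ω n ∈ 𝒜)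
    (hΩ : IsSubshift Ω) (haper : IsAperiodicSubshift Ω) {ω : ℤ → ℝ} (hω : ω ∈ Ω) {p : ℤ}
    (hp : p ≠ 0) (i : ℤ) : ∃ q : ℕ, ω (i + q + p) ≠ ω (i + q) := by
  by_contra! h
  obtain ⟨τ, hτ, φ, hφ, hlim⟩ := (isCompact_subshift h𝒜 hval hΩ).tendsto_subseq
    (fun n : ℕ => iterate_shift_mem hΩ hω n)
  refine haper τ hτ p hp ?_
  funext m
  have h1 := tendsto_pi_nhds.1 hlim (m + p)
  have h2 := tendsto_pi_nhds.1 hlim m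
  refine tendsto_nhds_unique (h1.congr' ?_) h2
  have hev : ∀ᶠ n : ℕ in atTop, i - m ≤ ((φ n : ℕ) : ℤ) := by
    filter_upwards [hφ.tendsto_atTop.eventually_ge_atTop (i - m).toNat] with n hn
    omega
  filter_upwards [hev] with n hn
  simp only [Function.comp_apply, iterate_shift]
  have := h (m + φ n - i).toNat
  have e : (((m + φ n - i).toNat : ℕ) : ℤ) = m + φ n - i := Int.toNat_of_nonneg (by omega)
  rw [e] at this
  convert this using 2 <;> ring

/-- If a function of the words of length `l` varies slowly along orbits and is large only on
few words, then it is not large at all. -/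
theorem le_of_ncard_word_le (h𝒜 : 𝒜.Finite) (hval : ∀ ω ∈ Ω, ∀ n : ℤ, ω n ∈ 𝒜)
    (hΩ : IsSubshift Ω) (haper : IsAperiodicSubshift Ω) {l T : ℕ} {D : (ℤ → ℝ) → ℝ} {b c : ℝ}
    (hc0 : 0 ≤ c)
    (hD : ∀ ω ω' : ℤ → ℝ, (∀ i : ℕ, i < l → ω (1 + i) = ω' (1 + i)) → D ω = D ω')
    (hc : ∀ ω ∈ Ω, |D (shift ℝ ω) - D ω| ≤ c) {S : Finset (Fin l → ℝ)}
    (hS : ∀ ω ∈ Ω, b < D ω → (fun i : Fin l => ω (1 + (i : ℕ))) ∈ S) (hT : S.card < T)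
    (hl : 2 * T ≤ l) {ω : ℤ → ℝ} (hω : ω ∈ Ω) : D ω ≤ b + 2 * c * T := by
  by_contra! hlt
  have hstep : ∀ k n : ℕ, D ((shift ℝ)^[k] ω) - c * n ≤ D ((shift ℝ)^[k + n] ω) := by
    intro k n
    induction n with
    | zero => simp
    | succ n ih =>
      have := hc _ (iterate_shift_mem hΩ hω (k + n))
      rw [← Function.iterate_succ_apply' (shift ℝ)] at this
      have := (abs_le.1 this).1
      rw [← add_assoc]
      push_cast
      simp only [Nat.succ_eq_add_one] at this
      linarith
  set W : ℕ → Fin l → ℝ := fun k i => (shift ℝ)^[k] ω (1 + (i : ℕ)) with hW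
  have hWap : ∀ k (i : Fin l), W k i = ω (1 + (i : ℕ) + k) := fun k i => by
    simp [hW, iterate_shift]
  have hbig : ∀ k ≤ T, b + c * T < D ((shift ℝ)^[k] ω) := by
    intro k hk
    have := hstep 0 k
    simp only [Function.iterate_zero, id_eq, zero_add] at this
    have : c * k ≤ c * T := mul_le_mul_of_nonneg_left (by exact_mod_cast hk) hc0
    linarith
  have hcT : 0 ≤ c * T := by positivity
  have hmaps : ∀ k ∈ Finset.range (S.card + 1), W k ∈ S := by
    intro k hk
    rw [Finset.mem_range] at hk
    exact hS _ (iterate_shift_mem hΩ hω k) (by linarith [hbig k (by omega)])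
  obtain ⟨i, j, hij, hjS, hWij⟩ : ∃ i j, i < j ∧ j ≤ S.card ∧ W i = W j := by
    obtain ⟨x, hx, y, hy, hxy, he⟩ := Finset.exists_ne_map_eq_of_card_lt_of_maps_to
      (by simp : S.card < (Finset.range (S.card + 1)).card) hmaps
    simp only [Finset.mem_range] at hx hy
    rcases lt_or_gt_of_ne hxy with h | h
    · exact ⟨x, y, h, by omega, he⟩
    · exact ⟨y, x, h, by omega, he.symm⟩
  obtain ⟨p, rfl⟩ := Nat.exists_eq_add_of_lt hij
  set p' := p + 1 with hp'
  have hex := exists_ne_add_period h𝒜 hval hΩ haper hω (p := p') (by omega) (i + 1)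
  classical
  set q := Nat.find hex with hq
  have hqne : ω (i + 1 + q + p') ≠ ω (i + 1 + q) := Nat.find_spec hex
  have hqmin : ∀ x < q, ω (i + 1 + x + p') = ω (i + 1 + x) := fun x hx =>
    not_not.1 (Nat.find_min hex hx)
  have hlq : l ≤ q := by
    by_contra! h
    refine hqne ?_
    have := congrFun hWij ⟨q, h⟩
    rw [hWap, hWap] at this
    rw [show (i + 1 + q + p' : ℤ) = 1 + q + ((i + p + 1 : ℕ) : ℤ) by push_cast; omega, ← this]
    congr 1
    ring
  have hrun : ∀ k : ℕ, k + l ≤ q + p' → b + c * T < D ((shift ℝ)^[i + k] ω) := by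
    intro k
    induction k using Nat.strong_induction_on with
    | _ k ih =>
      intro hk
      by_cases hkp : k < p'
      · exact hbig _ (by omega)
      · have h1 := ih (k - p') (by omega) (by omega)
        rw [hD ((shift ℝ)^[i + k] ω) ((shift ℝ)^[i + (k - p')] ω)]
        · exact h1
        · intro x hx
          rw [iterate_shift, iterate_shift]
          have := hqmin (x + (k - p')) (by omega)
          convert this using 2 <;> omega
  obtain ⟨k0, hk0⟩ : ∃ k0, k0 + l = q + p' := ⟨q + p' - l, by omega⟩
  have hend := hrun k0 hk0.le
  have hinS : ∀ t ∈ Finset.Icc 1 T, W (i + k0 + t) ∈ S := by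
    intro t ht
    rw [Finset.mem_Icc] at ht
    refine hS _ (iterate_shift_mem hΩ hω _) ?_
    have := hstep (i + k0) t
    have : c * t ≤ c * T := mul_le_mul_of_nonneg_left (by exact_mod_cast ht.2) hc0
    linarith
  have hkey : ∀ s t : ℕ, 1 ≤ t → t < s → s ≤ T → W (i + k0 + t) ≠ W (i + k0 + s) := by
    intro s t ht hts hs he
    have e1 := congrFun he ⟨l - s, by omega⟩
    have e2 := congrFun he ⟨l - s - p', by omega⟩
    rw [hWap, hWap] at e1 e2
    have e3 := hqmin (q - (s - t)) (by omega)
    simp only at e1 e2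
    refine hqne ?_
    rw [show (i + 1 + q + p' : ℤ) = 1 + ((l - s : ℕ) : ℤ) + ((i + k0 + s : ℕ) : ℤ) by omega, ← e1,
      show (i + 1 + q : ℤ) = 1 + ((l - s - p' : ℕ) : ℤ) + ((i + k0 + s : ℕ) : ℤ) by omega, ← e2]
    convert e3 using 2 <;> omega
  have hcard := Finset.card_le_card_of_injOn (fun t => W (i + k0 + t)) hinS (by
    intro s hs t ht he
    simp only [Finset.coe_Icc, Set.mem_Icc] at hs ht
    rcases lt_trichotomy s t with h | h | h
    · exact absurd he (hkey t s hs.1 h ht.2)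
    · exact h
    · exact absurd he.symm (hkey s t ht.1 h hs.2))
  simp at hcard
  omega

/-- Boshernitzan's condition at length `l` bounds the number of words on which a function is
large by the measure of the set where it is large. -/
theorem card_word_le [IsProbabilityMeasure ν] (h𝒜 : 𝒜.Finite)
    (hval : ∀ ω ∈ Ω, ∀ n : ℤ, ω n ∈ 𝒜) (hΩ : IsSubshift Ω) {C : ℝ} {l : ℕ}
    (hB : ∀ w : List ℝ, IsWordOf Ω w → w.length = l →
      C ≤ (w.length : ℝ) * (ν (Vset Ω w)).toReal) {D : (ℤ → ℝ) → ℝ} {b : ℝ}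
    (hD : ∀ ω ω' : ℤ → ℝ, (∀ i : ℕ, i < l → ω (1 + i) = ω' (1 + i)) → D ω = D ω') :
    ∃ S : Finset (Fin l → ℝ),
      (∀ ω ∈ Ω, b < D ω → (fun i : Fin l => ω (1 + (i : ℕ))) ∈ S) ∧
      C * S.card ≤ l * (ν {ω | b < D ω}).toReal := by
  classical
  have hfin : ((fun ω : ℤ → ℝ => fun i : Fin l => ω (1 + (i : ℕ))) ''
      {ω ∈ Ω | b < D ω}).Finite := by
    refine (Set.Finite.pi' (fun _ : Fin l => h𝒜)).subset ?_
    rintro _ ⟨ω, hω, rfl⟩ i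
    exact hval ω hω.1 _
  refine ⟨hfin.toFinset, fun ω hω hb => by simpa using ⟨ω, ⟨hω, hb⟩, rfl⟩, ?_⟩
  set S := hfin.toFinset with hS
  set V : (Fin l → ℝ) → Set (ℤ → ℝ) :=
    fun w => {ω ∈ Ω | ∀ i : Fin l, ω (1 + (i : ℕ)) = w i} with hV
  have hVm : ∀ w, MeasurableSet (V w) := by
    intro w
    have : V w = Ω ∩ ⋂ i : Fin l, (fun ω : ℤ → ℝ => ω (1 + (i : ℕ))) ⁻¹' {w i} := by
      ext ω; simp [hV]
    rw [this]
    exact hΩ.1.measurableSet.inter (MeasurableSet.iInter fun i =>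
      measurable_pi_apply _ (measurableSet_singleton _))
  have hdisj : (S : Set (Fin l → ℝ)).PairwiseDisjoint V := by
    intro w _ w' _ hne
    refine Set.disjoint_left.2 fun ω h h' => hne ?_
    funext i
    rw [← h.2 i, h'.2 i]
  have hsub : ⋃ w ∈ S, V w ⊆ {ω | b < D ω} := by
    intro ω hω
    simp only [Set.mem_iUnion] at hω
    obtain ⟨w, hw, hωw⟩ := hω
    rw [hS, Set.Finite.mem_toFinset] at hw
    obtain ⟨ρ, hρ, rfl⟩ := hw
    show b < D ω
    rw [hD ω ρ fun i hi => hωw.2 ⟨i, hi⟩]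
    exact hρ.2
  have hlow : ∀ w ∈ S, C ≤ l * (ν (V w)).toReal := by
    intro w hw
    rw [hS, Set.Finite.mem_toFinset] at hw
    obtain ⟨ρ, hρ, rfl⟩ := hw
    have hocc : ∀ ω : ℤ → ℝ, OccursAt ω (List.ofFn fun i : Fin l => ρ (1 + (i : ℕ))) 1 ↔
        ∀ i : Fin l, ω (1 + (i : ℕ)) = ρ (1 + (i : ℕ)) := by
      intro ω
      unfold OccursAt
      constructor
      · intro h i
        simpa using h (i.cast (List.length_ofFn).symm)
      · intro h i
        simpa using h (i.cast List.length_ofFn)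
    have h := hB (List.ofFn fun i : Fin l => ρ (1 + (i : ℕ)))
      ⟨ρ, hρ.1, 1, (hocc ρ).2 fun i => rfl⟩ List.length_ofFn
    rw [List.length_ofFn] at h
    have e : Vset Ω (List.ofFn fun i : Fin l => ρ (1 + (i : ℕ))) =
        V fun i => ρ (1 + (i : ℕ)) := by
      ext ω
      simp only [Vset, hV, Set.mem_ofPred_eq, hocc]
    rwa [e] at h
  have hsum : ∑ w ∈ S, (ν (V w)).toReal ≤ (ν {ω | b < D ω}).toReal := by
    rw [← ENNReal.toReal_sum fun w _ => measure_ne_top ν _,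
      ← measure_biUnion_finset hdisj fun w _ => hVm w]
    exact ENNReal.toReal_mono (measure_ne_top ν _) (measure_mono hsub)
  calc C * S.card = ∑ w ∈ S, C := by rw [Finset.sum_const, nsmul_eq_mul, mul_comm]
    _ ≤ ∑ w ∈ S, l * (ν (V w)).toReal := Finset.sum_le_sum hlow
    _ = l * ∑ w ∈ S, (ν (V w)).toReal := by rw [Finset.mul_sum]
    _ ≤ _ := by gcongr

end

section

variable {α : Type*} [MeasurableSpace α] {μ : Measure α}

theorem integral_norm_le_norm_Lp_two [IsProbabilityMeasure μ] (h : Lp ℝ 2 μ) :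
    ∫ x, ‖h x‖ ∂μ ≤ ‖h‖ := by
  rw [Lp.norm_def, integral_norm_eq_lintegral_enorm (Lp.aestronglyMeasurable h),
    ← eLpNorm_one_eq_lintegral_enorm]
  exact ENNReal.toReal_mono (Lp.eLpNorm_ne_top h)
    (eLpNorm_le_eLpNorm_of_exponent_le (by norm_num) (Lp.aestronglyMeasurable h))

/-- The mean ergodic theorem in `L¹` for square integrable functions. -/
theorem tendsto_integral_abs_average_sub [IsProbabilityMeasure μ] {T : α → α} (hT : Ergodic T μ)
    {f : α → ℝ} (hf : MemLp f 2 μ) :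
    Tendsto (fun n : ℕ => ∫ x, |(n : ℝ)⁻¹ * ∑ j ∈ Finset.range n, f (T^[j] x) - ∫ y, f y ∂μ| ∂μ)
      atTop (𝓝 0) := by
  have hmp : MeasurePreserving T μ μ := hT.toMeasurePreserving
  set U : Lp ℝ 2 μ →L[ℝ] Lp ℝ 2 μ :=
    (Lp.compMeasurePreservingₗᵢ ℝ T hmp).toContinuousLinearMap with hU
  have hU1 : ‖U‖ ≤ 1 := LinearIsometry.norm_toContinuousLinearMap_le _
  have hUit : ∀ j : ℕ, ∀ F : Lp ℝ 2 μ,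
      U^[j] F = Lp.compMeasurePreserving T^[j] (hmp.iterate j) F := by
    intro j F
    rw [← Lp.compMeasurePreserving_iterate hmp j]
    rfl
  have hlim := U.tendsto_birkhoffAverage_orthogonalProjection hU1 (hf.toLp f)
  set P := (U.eqLocus (1 : Lp ℝ 2 μ →L[ℝ] Lp ℝ 2 μ)).orthogonalProjectionOnto (hf.toLp f) with hP
  have hPU : U (P : Lp ℝ 2 μ) = P := P.2
  obtain ⟨c, hc⟩ : ∃ c : ℝ, ((P : Lp ℝ 2 μ) : α → ℝ) =ᵐ[μ] Function.const α c := by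
    refine hT.ae_eq_const_of_ae_eq_comp_ae (Lp.aestronglyMeasurable _) ?_
    have h1 := Lp.coeFn_compMeasurePreserving (P : Lp ℝ 2 μ) hmp
    have h2 : Lp.compMeasurePreserving T hmp (P : Lp ℝ 2 μ) = P := hPU
    rw [h2] at h1
    exact h1.symm
  have hcoe : ∀ n : ℕ, ((birkhoffAverage ℝ U id n (hf.toLp f) : Lp ℝ 2 μ) : α → ℝ) =ᵐ[μ]
      fun x => (n : ℝ)⁻¹ * ∑ j ∈ Finset.range n, f (T^[j] x) := by
    have hsum : ∀ m : ℕ,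
        ((∑ j ∈ Finset.range m, U^[j] (hf.toLp f) : Lp ℝ 2 μ) : α → ℝ) =ᵐ[μ]
          fun x => ∑ j ∈ Finset.range m, f (T^[j] x) := by
      intro m
      induction m with
      | zero =>
        simp only [Finset.range_zero, Finset.sum_empty]
        exact Lp.coeFn_zero _ _ _
      | succ m ih =>
        rw [Finset.sum_range_succ]
        refine (Lp.coeFn_add _ _).trans ?_
        have h3 : (U^[m] (hf.toLp f) : α → ℝ) =ᵐ[μ] f ∘ T^[m] := by
          rw [hUit, Lp.toLp_compMeasurePreserving]
          exact MemLp.coeFn_toLp _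
        filter_upwards [ih, h3] with x hx1 hx2
        simp only [Pi.add_apply, hx1, hx2, Finset.sum_range_succ, Function.comp_apply]
    intro n
    have e : birkhoffAverage ℝ U id n (hf.toLp f) =
        (n : ℝ)⁻¹ • ∑ j ∈ Finset.range n, U^[j] (hf.toLp f) := rfl
    rw [e]
    refine (Lp.coeFn_smul _ _).trans ?_
    filter_upwards [hsum n] with x hx
    rw [Pi.smul_apply, hx, smul_eq_mul]
  have hconv : Tendsto (fun n : ℕ =>
      ∫ x, |(n : ℝ)⁻¹ * ∑ j ∈ Finset.range n, f (T^[j] x) - c| ∂μ) atTop (𝓝 0) := by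
    refine squeeze_zero (fun n => integral_nonneg fun x => abs_nonneg _) (fun n => ?_)
      (tendsto_iff_norm_sub_tendsto_zero.1 hlim)
    refine le_trans (le_of_eq ?_) (integral_norm_le_norm_Lp_two _)
    refine integral_congr_ae ?_
    filter_upwards [hcoe n, hc, Lp.coeFn_sub (birkhoffAverage ℝ U id n (hf.toLp f))
      (P : Lp ℝ 2 μ)] with x h1 h2 h3
    rw [Real.norm_eq_abs, h3, Pi.sub_apply, h1, h2]
    rfl
  have hfi : Integrable f μ := hf.integrable (by norm_num)
  have hji : ∀ j : ℕ, Integrable (fun x => f (T^[j] x)) μ := fun j =>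
    (hmp.iterate j).integrable_comp_of_integrable hfi
  have hji' : ∀ j : ℕ, ∫ x, f (T^[j] x) ∂μ = ∫ x, f x ∂μ := by
    intro j
    rw [← integral_map (hmp.iterate j).aemeasurable (by
      rw [(hmp.iterate j).map_eq]; exact hfi.aestronglyMeasurable), (hmp.iterate j).map_eq]
  have hav : ∀ n : ℕ, Integrable (fun x => (n : ℝ)⁻¹ * ∑ j ∈ Finset.range n, f (T^[j] x)) μ :=
    fun n => (integrable_finsetSum _ fun j _ => hji j).const_mul _
  have hceq : ∫ x, f x ∂μ = c := by
    have h0 : |∫ x, f x ∂μ - c| ≤ 0 := by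
      refine ge_of_tendsto hconv ?_
      filter_upwards [eventually_gt_atTop 0] with n hn
      have e : ∫ x, f x ∂μ - c =
          ∫ x, ((n : ℝ)⁻¹ * ∑ j ∈ Finset.range n, f (T^[j] x) - c) ∂μ := by
        rw [integral_sub (hav n) (integrable_const _), integral_const_mul,
          integral_finsetSum _ fun j _ => hji j]
        simp only [hji', Finset.sum_const, Finset.card_range, nsmul_eq_mul, integral_const,
          probReal_univ, one_smul]
        have : (n : ℝ) ≠ 0 := by positivity
        field_simp
      rw [e]
      exact abs_integral_le_integral_abs
    exact sub_eq_zero.1 (abs_nonpos_iff.1 h0)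
  rw [hceq]
  exact hconv

end

section

variable {ν : Measure (ℤ → ℝ)} {Ω : Set (ℤ → ℝ)} {𝒜 : Set ℝ} {E R : ℝ}

theorem bounded_iterate_shift {ω : ℤ → ℝ} (h : ∀ n, |E - ω n| ≤ R) (k : ℕ) :
    ∀ n, |E - (shift ℝ)^[k] ω n| ≤ R := fun n => by
  rw [iterate_shift]
  exact h _

theorem abs_logNorm_iterate_sub_le {ω : ℤ → ℝ} (h : ∀ n, |E - ω n| ≤ R) (n r : ℕ) :
    |logNorm E n ((shift ℝ)^[r] ω) - logNorm E n ω| ≤ r * (2 * Real.log (2 + R)) := by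
  induction r with
  | zero => simp
  | succ r ih =>
    have h1 := abs_logNorm_shift_sub_le (bounded_iterate_shift h r) n
    rw [← Function.iterate_succ_apply' (shift ℝ)] at h1
    push_cast
    rw [abs_le] at *
    constructor <;> linarith [h1.1, h1.2, ih.1, ih.2]

theorem sum_logNorm_mul_le {ω : ℤ → ℝ} (h : ∀ n, |E - ω n| ≤ R) (n q : ℕ) :
    ∑ r ∈ Finset.range n, logNorm E (q * n) ((shift ℝ)^[r] ω) ≤
      ∑ j ∈ Finset.range (q * n), logNorm E n ((shift ℝ)^[j] ω) + n * Real.log 2 := by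
  induction q with
  | zero =>
    have : ∀ r ∈ Finset.range n, logNorm E (0 * n) ((shift ℝ)^[r] ω) ≤ Real.log 2 := fun r _ => by
      simpa using logNorm_le (bounded_iterate_shift h r) 0
    simpa using Finset.sum_le_sum this
  | succ q ih =>
    rw [Nat.succ_mul, Finset.sum_range_add]
    have : ∀ r ∈ Finset.range n, logNorm E (q * n + n) ((shift ℝ)^[r] ω) ≤
        logNorm E n ((shift ℝ)^[q * n + r] ω) + logNorm E (q * n) ((shift ℝ)^[r] ω) := by
      intro r _
      rw [add_comm (q * n) n, Function.iterate_add_apply]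
      exact logNorm_add_le E n (q * n) _
    have h2 := Finset.sum_le_sum this
    rw [Finset.sum_add_distrib] at h2
    linarith

/-- The logarithmic norm of a long product is dominated by the Birkhoff sums of the logarithmic
norms of blocks of fixed length. -/
theorem exists_mul_logNorm_le (E R : ℝ) (hR : 0 ≤ R) (n : ℕ) : ∃ C : ℝ, ∀ ω : ℤ → ℝ,
    (∀ k, |E - ω k| ≤ R) → ∀ l : ℕ, n * logNorm E l ω ≤
      ∑ j ∈ Finset.range l, logNorm E n ((shift ℝ)^[j] ω) + C := by
  have hM : 0 ≤ Real.log (2 + R) := Real.log_nonneg (by linarith)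
  refine ⟨n * (Real.log 2 + n * Real.log (2 + R)) + n * Real.log 2 +
    n * (n * (2 * Real.log (2 + R))), fun ω h l => ?_⟩
  have hdiv : l / n * n + l % n = l := Nat.div_add_mod' l n
  set q := l / n
  rcases Nat.eq_zero_or_pos n with rfl | hn
  · simp only [Nat.cast_zero, zero_mul, add_zero]
    exact Finset.sum_nonneg fun j _ => logNorm_nonneg _ _ _
  have hr : ((l % n : ℕ) : ℝ) ≤ n := by exact_mod_cast (Nat.mod_lt l hn).le
  have h1 : logNorm E l ω ≤ Real.log 2 + n * Real.log (2 + R) + logNorm E (q * n) ω := by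
    conv_lhs => rw [← hdiv, add_comm]
    refine (logNorm_add_le E _ _ _).trans ?_
    have := logNorm_le (bounded_iterate_shift h (q * n)) (l % n)
    nlinarith
  have h2 : ∀ r ∈ Finset.range n, logNorm E (q * n) ω ≤
      logNorm E (q * n) ((shift ℝ)^[r] ω) + n * (2 * Real.log (2 + R)) := by
    intro r hr
    have h3 := (abs_le.1 (abs_logNorm_iterate_sub_le h (q * n) r)).1
    have h4 : (r : ℝ) ≤ n := by exact_mod_cast (Finset.mem_range.1 hr).le
    nlinarith
  have h5 := Finset.sum_le_sum h2
  rw [Finset.sum_add_distrib, Finset.sum_const, Finset.sum_const, Finset.card_range,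
    nsmul_eq_mul, nsmul_eq_mul] at h5
  have h6 := sum_logNorm_mul_le h n q
  have h7 : ∑ j ∈ Finset.range (q * n), logNorm E n ((shift ℝ)^[j] ω) ≤
      ∑ j ∈ Finset.range l, logNorm E n ((shift ℝ)^[j] ω) :=
    Finset.sum_le_sum_of_subset_of_nonneg (Finset.range_subset_range.2 (by omega))
      fun _ _ _ => logNorm_nonneg _ _ _
  have h8 := mul_le_mul_of_nonneg_left h1 (Nat.cast_nonneg (α := ℝ) n)
  linarith

theorem memLp_logNorm [IsProbabilityMeasure ν]
    (hν : ∀ᵐ ω ∂ν, ∀ n, |E - ω n| ≤ R) (n : ℕ) : MemLp (logNorm E n) 2 ν := by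
  have hc : Continuous (logNorm E n) :=
    (continuous_logNorm n).comp (f := fun ω : ℤ → ℝ => (E, ω)) (by fun_prop)
  refine MemLp.of_bound hc.aestronglyMeasurable (Real.log 2 + n * Real.log (2 + R)) ?_
  filter_upwards [hν] with ω hω
  rw [Real.norm_eq_abs, abs_of_nonneg (logNorm_nonneg _ _ _)]
  exact logNorm_le hω n

theorem integrable_logNorm [IsProbabilityMeasure ν]
    (hν : ∀ᵐ ω ∂ν, ∀ n, |E - ω n| ≤ R) (n : ℕ) : Integrable (logNorm E n) ν :=
  (memLp_logNorm hν n).integrable (by norm_num)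

theorem subadditive_integral_logNorm [IsProbabilityMeasure ν]
    (hT : MeasurePreserving (shift ℝ) ν ν) (hν : ∀ᵐ ω ∂ν, ∀ n, |E - ω n| ≤ R) :
    Subadditive fun n => ∫ ω, logNorm E n ω ∂ν := by
  intro m n
  have hi := integrable_logNorm (E := E) hν
  have h1 : ∫ ω, logNorm E m ((shift ℝ)^[n] ω) ∂ν = ∫ ω, logNorm E m ω ∂ν := by
    rw [← integral_map (hT.iterate n).aemeasurable (by
      rw [(hT.iterate n).map_eq]; exact (hi m).aestronglyMeasurable), (hT.iterate n).map_eq]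
  have h2 : Integrable (fun ω => logNorm E m ((shift ℝ)^[n] ω)) ν :=
    (hT.iterate n).integrable_comp_of_integrable (hi m)
  show ∫ ω, logNorm E (m + n) ω ∂ν ≤ ∫ ω, logNorm E m ω ∂ν + ∫ ω, logNorm E n ω ∂ν
  rw [← h1, ← integral_add h2 (hi n)]
  exact integral_mono (hi _) (h2.add (hi n)) fun ω => logNorm_add_le E m n ω

/-- There is a Lyapunov exponent, and the growth rates converge to it in `L¹`. -/
theorem exists_lyapunov [IsProbabilityMeasure ν] (hT : Ergodic (shift ℝ) ν) (hR : 0 ≤ R)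
    (hν : ∀ᵐ ω ∂ν, ∀ n, |E - ω n| ≤ R) :
    ∃ Λ : ℝ, 0 ≤ Λ ∧
      Tendsto (fun n : ℕ => (n : ℝ)⁻¹ * ∫ ω, logNorm E n ω ∂ν) atTop (𝓝 Λ) ∧
      Tendsto (fun n : ℕ => ∫ ω, |(n : ℝ)⁻¹ * logNorm E n ω - Λ| ∂ν) atTop (𝓝 0) := by
  have hmp := hT.toMeasurePreserving
  have hi := integrable_logNorm (E := E) hν
  have hsub := subadditive_integral_logNorm hmp hν
  have hnn : ∀ n, 0 ≤ ∫ ω, logNorm E n ω ∂ν := fun n =>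
    integral_nonneg fun ω => logNorm_nonneg _ _ _
  have hbdd : BddBelow (range fun n : ℕ => (∫ ω, logNorm E n ω ∂ν) / n) :=
    ⟨0, by rintro _ ⟨n, rfl⟩; exact div_nonneg (hnn n) (Nat.cast_nonneg n)⟩
  have hlim := hsub.tendsto_lim hbdd
  set Λ := hsub.lim with hΛ
  have hle : ∀ n : ℕ, n ≠ 0 → Λ ≤ (∫ ω, logNorm E n ω ∂ν) / n := fun n hn =>
    hsub.lim_le_div hbdd hn
  refine ⟨Λ, ge_of_tendsto' hlim fun n => div_nonneg (hnn n) (Nat.cast_nonneg n),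
    by simpa only [div_eq_inv_mul] using hlim, ?_⟩
  have hg : ∀ l : ℕ, Integrable (fun ω => (l : ℝ)⁻¹ * logNorm E l ω - Λ) ν := fun l =>
    ((hi l).const_mul _).sub (integrable_const _)
  rw [Metric.tendsto_atTop]
  intro ε hε
  obtain ⟨n, hn0, hn⟩ : ∃ n : ℕ, 0 < n ∧ (∫ ω, logNorm E n ω ∂ν) / n < Λ + ε / 8 :=
    ((eventually_gt_atTop 0).and (hlim.eventually_lt_const (by linarith))).exists
  obtain ⟨C, hC⟩ := exists_mul_logNorm_le E R hR n
  set m := ∫ ω, (n : ℝ)⁻¹ * logNorm E n ω ∂ν with hm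
  have hmval : m = (∫ ω, logNorm E n ω ∂ν) / n := by
    rw [hm, integral_const_mul, div_eq_inv_mul]
  have hav := tendsto_integral_abs_average_sub hT ((memLp_logNorm (E := E) hν n).const_mul (n : ℝ)⁻¹)
  rw [← hm] at hav
  have hCl : Tendsto (fun l : ℕ => |C| / n * (l : ℝ)⁻¹) atTop (𝓝 0) := by
    simpa using tendsto_inv_atTop_nhds_zero_nat.const_mul (|C| / n)
  obtain ⟨N, hN⟩ := eventually_atTop.1 (((hav.eventually_lt_const (show 0 < ε / 8 by linarith)).and
    (hCl.eventually_lt_const (show 0 < ε / 8 by linarith))).and (eventually_gt_atTop 0))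
  refine ⟨N, fun l hl => ?_⟩
  obtain ⟨⟨h1, h2⟩, h3⟩ := hN l hl
  rw [Real.dist_eq, sub_zero, abs_of_nonneg (integral_nonneg fun ω => abs_nonneg _)]
  have hn' : (0 : ℝ) < n := by exact_mod_cast hn0
  have hl' : (0 : ℝ) < l := by exact_mod_cast h3
  set A : (ℤ → ℝ) → ℝ := fun ω =>
    |(l : ℝ)⁻¹ * ∑ j ∈ Finset.range l, (n : ℝ)⁻¹ * logNorm E n ((shift ℝ)^[j] ω) - m| with hA
  have hAi : Integrable A ν := by
    refine Integrable.abs (Integrable.sub (Integrable.const_mul ?_ _) (integrable_const _))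
    exact integrable_finsetSum _ fun j _ =>
      ((hmp.iterate j).integrable_comp_of_integrable (hi n)).const_mul _
  have hpt : ∀ᵐ ω ∂ν, |(l : ℝ)⁻¹ * logNorm E l ω - Λ| ≤
      2 * (A ω + ε / 4) - ((l : ℝ)⁻¹ * logNorm E l ω - Λ) := by
    filter_upwards [hν] with ω hω
    have k1 := hC ω hω l
    have k2 := le_abs_self ((l : ℝ)⁻¹ * ∑ j ∈ Finset.range l,
      (n : ℝ)⁻¹ * logNorm E n ((shift ℝ)^[j] ω) - m)
    have k3 : (l : ℝ)⁻¹ * logNorm E l ω ≤ (l : ℝ)⁻¹ * ∑ j ∈ Finset.range l,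
        (n : ℝ)⁻¹ * logNorm E n ((shift ℝ)^[j] ω) + |C| / n * (l : ℝ)⁻¹ := by
      rw [← Finset.mul_sum]
      have : logNorm E l ω ≤ (n : ℝ)⁻¹ * ∑ j ∈ Finset.range l, logNorm E n ((shift ℝ)^[j] ω)
          + |C| / n := by
        rw [inv_mul_eq_div, ← add_div, le_div_iff₀ hn']
        linarith [le_abs_self C]
      calc (l : ℝ)⁻¹ * logNorm E l ω ≤ (l : ℝ)⁻¹ * _ := mul_le_mul_of_nonneg_left this (by positivity)
        _ = _ := by ring
    have k4 : 0 ≤ A ω := abs_nonneg _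
    have k5 : (l : ℝ)⁻¹ * logNorm E l ω - Λ ≤ A ω + ε / 4 := by
      simp only [hA]
      linarith
    rw [abs_le]
    constructor <;> linarith
  have hI1 : Integrable (fun ω => 2 * (A ω + ε / 4)) ν :=
    (hAi.add (integrable_const _)).const_mul _
  calc ∫ ω, |(l : ℝ)⁻¹ * logNorm E l ω - Λ| ∂ν
      ≤ ∫ ω, (2 * (A ω + ε / 4) - ((l : ℝ)⁻¹ * logNorm E l ω - Λ)) ∂ν :=
        integral_mono_ae (hg l).abs (hI1.sub (hg l)) hpt
    _ = 2 * (∫ ω, A ω ∂ν + ε / 4) - ((∫ ω, logNorm E l ω ∂ν) / l - Λ) := by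
        rw [integral_sub hI1 (hg l), integral_const_mul, integral_add hAi (integrable_const _),
          integral_sub ((hi l).const_mul _) (integrable_const _), integral_const_mul]
        simp [div_eq_inv_mul]
    _ < ε := by
        have := hle l (by omega)
        linarith

/-- Boshernitzan's condition upgrades the convergence of growth rates to a uniform one along the
lengths of the condition. -/
theorem eventually_abs_logNorm_sub_le [IsProbabilityMeasure ν] (h𝒜 : 𝒜.Finite)
    (hval : ∀ ω ∈ Ω, ∀ n : ℤ, ω n ∈ 𝒜) (hΩ : IsSubshift Ω) (haper : IsAperiodicSubshift Ω)
    (hR : 0 ≤ R) (hΩR : ∀ ω ∈ Ω, ∀ n, |E - ω n| ≤ R) {C : ℝ} (hC : 0 < C) {l : ℕ → ℕ}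
    (hl : Tendsto l atTop atTop)
    (hB : ∀ n : ℕ, ∀ w : List ℝ, IsWordOf Ω w → w.length = l n →
      C ≤ (w.length : ℝ) * (ν (Vset Ω w)).toReal) {Λ : ℝ}
    (hν : ∀ᵐ ω ∂ν, ∀ n, |E - ω n| ≤ R)
    (hΛ : Tendsto (fun n : ℕ => ∫ ω, |(n : ℝ)⁻¹ * logNorm E n ω - Λ| ∂ν) atTop (𝓝 0))
    {ε : ℝ} (hε : 0 < ε) :
    ∀ᶠ k in atTop, ∀ ω ∈ Ω, |logNorm E (l k) ω - Λ * l k| ≤ ε * l k := by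
  set M := Real.log (2 + R) with hM
  have hM0 : 0 ≤ M := Real.log_nonneg (by linarith)
  obtain ⟨δ, hδ0, hδ1, hδ2⟩ : ∃ δ : ℝ, 0 < δ ∧ δ ≤ 1 / 2 ∧ 4 * M * δ ≤ ε / 2 := by
    refine ⟨min (1 / 2) (ε / (8 * (M + 1))), by positivity, min_le_left _ _, ?_⟩
    calc 4 * M * min (1 / 2) (ε / (8 * (M + 1))) ≤ 4 * M * (ε / (8 * (M + 1))) :=
          mul_le_mul_of_nonneg_left (min_le_right _ _) (by positivity)
      _ = ε / 2 * (M / (M + 1)) := by field_simp; ring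
      _ ≤ ε / 2 * 1 := by
          refine mul_le_mul_of_nonneg_left ?_ (by positivity)
          rw [div_le_one (by positivity)]
          linarith
      _ = ε / 2 := mul_one _
  have hsmall := (hΛ.comp hl).eventually_lt_const (show 0 < C * δ / 2 * (ε / 2) by positivity)
  have hlarge := (tendsto_natCast_atTop_atTop (R := ℝ)).comp hl |>.eventually_gt_atTop (2 / δ)
  filter_upwards [hsmall, hlarge] with k hk1 hk2 ω hω
  simp only [Function.comp_apply] at hk1 hk2
  set L := l k
  have hL0 : (0 : ℝ) < L := lt_trans (by positivity) hk2
  have hδL : 2 < δ * L := by rwa [div_lt_iff₀ hδ0, mul_comm] at hk2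
  set D : (ℤ → ℝ) → ℝ := fun ω => |logNorm E L ω - Λ * L| with hD
  have hDc : ∀ ω ω' : ℤ → ℝ, (∀ i : ℕ, i < L → ω (1 + i) = ω' (1 + i)) → D ω = D ω' := by
    intro ω ω' h
    simp only [hD, logNorm, cocycle_congr E h]
  obtain ⟨S, hS, hcard⟩ := card_word_le (ν := ν) (b := ε / 2 * L) h𝒜 hval hΩ (hB k) hDc
  have hmarkov : (ν {ω | ε / 2 * L < D ω}).toReal * (ε / 2) ≤
      ∫ ω, |(L : ℝ)⁻¹ * logNorm E L ω - Λ| ∂ν := by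
    have hfint : Integrable (fun ω => |(L : ℝ)⁻¹ * logNorm E L ω - Λ|) ν :=
      (((integrable_logNorm hν L).const_mul _).sub (integrable_const _)).abs
    have := mul_meas_ge_le_integral_of_nonneg (Eventually.of_forall fun ω => abs_nonneg _) hfint
      (ε / 2)
    rw [mul_comm]
    refine le_trans (mul_le_mul_of_nonneg_left ?_ (by positivity)) this
    refine measureReal_mono ?_
    intro ω hω
    show ε / 2 ≤ |(L : ℝ)⁻¹ * logNorm E L ω - Λ|
    have e : (L : ℝ)⁻¹ * logNorm E L ω - Λ = (L : ℝ)⁻¹ * (logNorm E L ω - Λ * L) := by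
      field_simp
    rw [e, abs_mul, abs_of_pos (inv_pos.2 hL0), inv_mul_eq_div, le_div_iff₀ hL0]
    exact (show ε / 2 * L < |logNorm E L ω - Λ * L| from hω).le
  have hbad : (ν {ω | ε / 2 * L < D ω}).toReal < C * δ / 2 :=
    lt_of_mul_lt_mul_right (hmarkov.trans_lt hk1) (by positivity)
  have hScard : (S.card : ℝ) < δ * L / 2 := by
    have : C * S.card < C * (δ * L / 2) := by
      refine hcard.trans_lt ?_
      have := mul_lt_mul_of_pos_left hbad hL0
      linarith
    exact lt_of_mul_lt_mul_left this hC.le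
  have hfl := Nat.lt_floor_add_one (δ * L)
  have hfl2 := Nat.floor_le (show 0 ≤ δ * L by positivity)
  have hfin := le_of_ncard_word_le h𝒜 hval hΩ haper (l := L) (T := ⌊δ * L⌋₊) (c := 2 * M)
    (by positivity) hDc (fun ρ hρ => ?_) hS ?_ ?_ hω
  · have : 2 * (2 * M) * (⌊δ * L⌋₊ : ℝ) ≤ ε / 2 * L := by
      calc 2 * (2 * M) * (⌊δ * L⌋₊ : ℝ) ≤ 2 * (2 * M) * (δ * L) :=
            mul_le_mul_of_nonneg_left hfl2 (by positivity)
        _ = 4 * M * δ * L := by ring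
        _ ≤ ε / 2 * L := mul_le_mul_of_nonneg_right hδ2 hL0.le
    show D ω ≤ _
    linarith
  · refine (abs_abs_sub_abs_le_abs_sub _ _).trans ?_
    rw [sub_sub_sub_cancel_right]
    exact abs_logNorm_shift_sub_le (hΩR ρ hρ) L
  · have : (S.card : ℝ) < (⌊δ * L⌋₊ : ℝ) := by linarith
    exact_mod_cast this
  · have : (2 : ℝ) * (⌊δ * L⌋₊ : ℝ) ≤ L := by nlinarith
    exact_mod_cast this

end

section

variable {ν : Measure (ℤ → ℝ)} {Ω : Set (ℤ → ℝ)} {E R : ℝ}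

/-- If some vector stays bounded under `B` and then `B'`, without becoming small in between, then
the norm of `B' * B` is much smaller than the product of the norms. -/
theorem matNorm_mul_le_of_bounded {B B' : Matrix (Fin 2) (Fin 2) ℝ} (hB : B.det = 1) {K : ℝ}
    {x y z : Fin 2 → ℝ} (hy : B.mulVec x = y) (hz : B'.mulVec y = z) (hx : ∀ i, |x i| ≤ K)
    (hyK : ∀ i, |y i| ≤ K) (hzK : ∀ i, |z i| ≤ K) (hs : 1 ≤ y 0 ^ 2 + y 1 ^ 2) :
    matNorm (B' * B) ≤ 4 * K ^ 2 * (matNorm B + matNorm B') := by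
  have hK : 0 ≤ K := (abs_nonneg _).trans (hx 0)
  set b := matNorm B
  set b' := matNorm B'
  have hb : 0 ≤ b := matNorm_nonneg _
  have hb' : 0 ≤ b' := matNorm_nonneg _
  have hdet : B 0 0 * B 1 1 - B 0 1 * B 1 0 = 1 := by rw [← Matrix.det_fin_two, hB]
  have y0 : B 0 0 * x 0 + B 0 1 * x 1 = y 0 := by
    rw [← hy]; simp [Matrix.mulVec, dotProduct, Fin.sum_univ_two]
  have y1 : B 1 0 * x 0 + B 1 1 * x 1 = y 1 := by
    rw [← hy]; simp [Matrix.mulVec, dotProduct, Fin.sum_univ_two]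
  have hzi : ∀ i, B' i 0 * y 0 + B' i 1 * y 1 = z i := by
    intro i
    rw [← hz]; simp [Matrix.mulVec, dotProduct, Fin.sum_univ_two]
  have hmul : ∀ p q P Q : ℝ, |p| ≤ P → |q| ≤ Q → |p * q| ≤ P * Q := fun p q P Q hp hq => by
    rw [abs_mul]
    exact mul_le_mul hp hq (abs_nonneg _) ((abs_nonneg _).trans hp)
  have hcol : ∀ j, |y 0 * B 0 j + y 1 * B 1 j| ≤ 2 * (K * b) := fun j =>
    (abs_add_le _ _).trans (by
      linarith [hmul _ _ _ _ (hyK 0) (abs_le_matNorm B 0 j),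
        hmul _ _ _ _ (hyK 1) (abs_le_matNorm B 1 j)])
  have hrow : ∀ i, |B' i 1 * y 0 - B' i 0 * y 1| ≤ 2 * (b' * K) := fun i =>
    (abs_sub _ _).trans (by
      linarith [hmul _ _ _ _ (abs_le_matNorm B' i 1) (hyK 0),
        hmul _ _ _ _ (abs_le_matNorm B' i 0) (hyK 1)])
  have key : ∀ i j, |(B' * B) i j| ≤ 2 * K ^ 2 * (b + b') := by
    intro i j
    obtain ⟨w, hw, e⟩ : ∃ w, |w| ≤ K ∧ y 0 * B 1 j - y 1 * B 0 j = w := by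
      fin_cases j
      · refine ⟨-x 1, by rw [abs_neg]; exact hx 1, ?_⟩
        show y 0 * B 1 0 - y 1 * B 0 0 = -x 1
        rw [← y0, ← y1]
        linear_combination (-x 1) * hdet
      · refine ⟨x 0, hx 0, ?_⟩
        show y 0 * B 1 1 - y 1 * B 0 1 = x 0
        rw [← y0, ← y1]
        linear_combination (x 0) * hdet
    have hid : (y 0 ^ 2 + y 1 ^ 2) * (B' * B) i j =
        z i * (y 0 * B 0 j + y 1 * B 1 j) + (B' i 1 * y 0 - B' i 0 * y 1) * w := by
      rw [← e, ← hzi i, Matrix.mul_apply, Fin.sum_univ_two]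
      ring
    have h1 := hmul _ _ _ _ (hzK i) (hcol j)
    have h2 := hmul _ _ _ _ (hrow i) hw
    calc |(B' * B) i j| ≤ (y 0 ^ 2 + y 1 ^ 2) * |(B' * B) i j| :=
          le_mul_of_one_le_left (abs_nonneg _) hs
      _ = |(y 0 ^ 2 + y 1 ^ 2) * (B' * B) i j| := by
          rw [abs_mul, abs_of_nonneg (show 0 ≤ y 0 ^ 2 + y 1 ^ 2 by positivity)]
      _ ≤ _ := by
          rw [hid]
          refine (abs_add_le _ _).trans ?_
          nlinarith
  refine le_of_sq_le_sq ?_ (by positivity)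
  rw [matNorm_sq]
  have hq : ∀ i j, (B' * B) i j ^ 2 ≤ (2 * K ^ 2 * (b + b')) ^ 2 := fun i j => by
    rw [← sq_abs]
    exact pow_le_pow_left₀ (abs_nonneg _) (key i j) 2
  nlinarith [hq 0 0, hq 0 1, hq 1 0, hq 1 1]

/-- Transfer matrices propagate solutions of the difference equation. -/
theorem cocycle_mulVec {ω v : ℤ → ℝ} {N : ℕ}
    (h : ∀ j : ℤ, 1 ≤ j → j ≤ N → v (j + 1) + v (j - 1) + ω j * v j = E * v j) :
    (cocycle (transferMat E) N ω).mulVec ![v 1, v 0] = ![v (N + 1), v N] := by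
  induction N with
  | zero => simp [cocycle]
  | succ N ih =>
    rw [cocycle, ← Matrix.mulVec_mulVec, ih fun j h1 h2 => h j h1 (by push_cast; omega)]
    have := h (N + 1) (by omega) (by push_cast; omega)
    have e : (shift ℝ)^[N] ω 1 = ω (N + 1) := by rw [iterate_shift, add_comm]
    funext i
    fin_cases i
    · simp [transferMat, e, Matrix.mulVec, dotProduct, Fin.sum_univ_two]
      rw [show (N : ℤ) + 1 - 1 = N by ring] at this
      linarith
    · simp [transferMat, Matrix.mulVec, dotProduct, Fin.sum_univ_two]

/-- If the equation at energy `E` has solutions which are polynomially bounded on long intervals,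
then the Lyapunov exponent vanishes. -/
theorem lyapunov_eq_zero (hΩ : IsSubshift Ω) (hR : 0 ≤ R) (hΩR : ∀ ω ∈ Ω, ∀ n, |E - ω n| ≤ R)
    {l : ℕ → ℕ} (hl : Tendsto l atTop atTop) {Λ : ℝ} (hΛ : 0 ≤ Λ)
    (hu : ∀ ε : ℝ, 0 < ε → ∀ᶠ k in atTop, ∀ ω ∈ Ω, |logNorm E (l k) ω - Λ * l k| ≤ ε * l k)
    (hsol : ∀ L : ℕ, ∃ ω ∈ Ω, ∃ v : ℤ → ℝ, v L = 1 ∧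
      (∀ j : ℤ, 0 ≤ j → j ≤ 2 * L + 1 → v j ^ 2 ≤ 8 * (L + 2)) ∧
      ∀ j : ℤ, 1 ≤ j → j ≤ 2 * L → v (j + 1) + v (j - 1) + ω j * v j = E * v j) :
    Λ = 0 := by
  by_contra hne
  have hΛ0 : 0 < Λ := lt_of_le_of_ne hΛ (Ne.symm hne)
  set M := Real.log (2 + R) with hM
  have hM0 : 0 ≤ M := Real.log_nonneg (by linarith)
  have hlog2 : 0 ≤ Real.log 2 := Real.log_nonneg (by norm_num)
  have hu' := hu (Λ / 10) (by positivity)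
  obtain ⟨k0, hk0, hk0'⟩ := (hu'.and (hl.eventually_gt_atTop 0)).exists
  set n0 := l k0
  have hup : ∀ ω ∈ Ω, ∀ L : ℕ, logNorm E L ω ≤ 11 / 10 * Λ * L + (2 * Real.log 2 + n0 * M) := by
    have hq : ∀ q : ℕ, ∀ ω ∈ Ω, logNorm E (q * n0) ω ≤ 11 / 10 * Λ * (q * n0) + Real.log 2 := by
      intro q
      induction q with
      | zero =>
        intro ω hω
        simpa using logNorm_le (hΩR ω hω) 0
      | succ q ih =>
        intro ω hω
        rw [Nat.succ_mul, add_comm]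
        have h1 := logNorm_add_le E n0 (q * n0) ω
        have h2 := (abs_le.1 (hk0 _ (iterate_shift_mem hΩ hω (q * n0)))).2
        have h3 := ih ω hω
        push_cast
        linarith
    intro ω hω L
    have h1 := logNorm_add_le E (L % n0) (L / n0 * n0) ω
    have hdiv : L % n0 + L / n0 * n0 = L := Nat.mod_add_div' L n0
    have h2 := hq (L / n0) ω hω
    have h3 := logNorm_le (hΩR _ (iterate_shift_mem hΩ hω (L / n0 * n0))) (L % n0)
    rw [hdiv] at h1
    have h4 : ((L % n0 : ℕ) : ℝ) * M ≤ n0 * M :=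
      mul_le_mul_of_nonneg_right (by exact_mod_cast (Nat.mod_lt L hk0').le) hM0
    have h5 : ((L / n0 : ℕ) : ℝ) * n0 ≤ L := by exact_mod_cast Nat.div_mul_le_self L n0
    have h6 := mul_le_mul_of_nonneg_left h5 (show 0 ≤ 11 / 10 * Λ by positivity)
    linarith
  set C0 := 2 * Real.log 2 + n0 * M with hC0
  have hlogsmall := Real.isLittleO_log_id_atTop.bound (show 0 < Λ / 640 by positivity)
  have hto : Tendsto (fun k => 64 * ((l k : ℝ) + 2)) atTop atTop :=
    (tendsto_atTop_add_const_right _ _ (tendsto_natCast_atTop_atTop.comp hl)).const_mul_atTop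
      (by norm_num)
  have hlarge := (tendsto_natCast_atTop_atTop (R := ℝ)).comp hl |>.eventually_gt_atTop
    ((M + C0 + Λ) * 10 / Λ)
  obtain ⟨k, ⟨h1, h2⟩, h3⟩ := ((hu'.and (hto.eventually hlogsmall)).and hlarge).exists
  simp only [Function.comp_apply, id_eq, Real.norm_eq_abs] at h2 h3
  obtain ⟨L, hL1, hL2⟩ : ∃ L, 2 * L ≤ l k ∧ l k ≤ 2 * L + 1 := ⟨l k / 2, by omega, by omega⟩
  obtain ⟨ω, hω, v, hv1, hvb, hv⟩ := hsol L
  have hlow := (abs_le.1 (h1 ω hω)).1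
  have hstep : logNorm E (l k) ω ≤ M + logNorm E (2 * L) ω := by
    rcases (by omega : l k = 2 * L ∨ l k = 2 * L + 1) with h | h
    · rw [h]; linarith
    · rw [h, add_comm]
      refine (logNorm_add_le E 1 _ ω).trans ?_
      have := logNorm_one_le (hΩR _ (iterate_shift_mem hΩ hω (2 * L)) 1)
      linarith
  have e1 := cocycle_mulVec (N := L) (fun j h1 h2 => hv j h1 (by omega))
  have e2 : (cocycle (transferMat E) L ((shift ℝ)^[L] ω)).mulVec ![v (L + 1), v L] =
      ![v (2 * L + 1), v (2 * L)] := by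
    have := cocycle_mulVec (E := E) (N := L) (ω := (shift ℝ)^[L] ω) (v := fun j => v (j + L))
      (fun j h1 h2 => by
        have := hv (j + L) (by omega) (by omega)
        rw [iterate_shift]
        rw [show j + 1 + (L : ℤ) = j + L + 1 by ring, show j - 1 + (L : ℤ) = j + L - 1 by ring]
        exact this)
    simp only [zero_add] at this
    rw [show (1 + L : ℤ) = L + 1 by ring, show (L + 1 + L : ℤ) = 2 * L + 1 by ring,
      show (L + L : ℤ) = 2 * L by ring] at this
    exact this
  set K := Real.sqrt (8 * ((L : ℝ) + 2)) with hK
  have hKsq : K ^ 2 = 8 * ((L : ℝ) + 2) := Real.sq_sqrt (by positivity)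
  have hvK : ∀ j : ℤ, 0 ≤ j → j ≤ 2 * L + 1 → |v j| ≤ K := fun j h1 h2 =>
    Real.abs_le_sqrt (hvb j h1 h2)
  have hmat := matNorm_mul_le_of_bounded (det_cocycle E L ω) e1 e2 (K := K)
    (fun i => by fin_cases i <;> [exact hvK 1 (by omega) (by omega); exact hvK 0 (by omega) (by omega)])
    (fun i => by fin_cases i <;> [exact hvK _ (by omega) (by omega); exact hvK _ (by omega) (by omega)])
    (fun i => by fin_cases i <;> [exact hvK _ (by omega) (by omega); exact hvK _ (by omega) (by omega)])
    (by simp [hv1]; positivity)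
  rw [← cocycle_add] at hmat
  have hexp : ∀ ρ ∈ Ω, matNorm (cocycle (transferMat E) L ρ) ≤
      Real.exp (11 / 10 * Λ * L + C0) := fun ρ hρ =>
    (Real.log_le_iff_le_exp (matNorm_cocycle_pos _ _ _)).1 (hup ρ hρ L)
  have hmat2 : matNorm (cocycle (transferMat E) (L + L) ω) ≤
      64 * ((L : ℝ) + 2) * Real.exp (11 / 10 * Λ * L + C0) := by
    refine hmat.trans ?_
    rw [hKsq]
    have a1 := hexp ω hω
    have a2 := hexp _ (iterate_shift_mem hΩ hω L)
    have : 0 ≤ (L : ℝ) + 2 := by positivity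
    nlinarith
  have hF : logNorm E (2 * L) ω ≤ Real.log (64 * ((L : ℝ) + 2)) + (11 / 10 * Λ * L + C0) := by
    rw [two_mul]
    unfold logNorm
    refine (Real.log_le_log (matNorm_cocycle_pos _ _ _) hmat2).trans ?_
    rw [Real.log_mul (by positivity) (Real.exp_pos _).ne', Real.log_exp]
  have hLl : 2 * (L : ℝ) ≤ l k := by exact_mod_cast hL1
  have hL0 : (0 : ℝ) ≤ L := Nat.cast_nonneg L
  have hlogle : Real.log (64 * ((L : ℝ) + 2)) ≤ Λ / 640 * (64 * ((l k : ℝ) + 2)) := by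
    refine (Real.log_le_log (by positivity) (show 64 * ((L : ℝ) + 2) ≤ 64 * ((l k : ℝ) + 2) by
      linarith)).trans ((le_abs_self _).trans (h2.trans_eq ?_))
    rw [abs_of_nonneg (by positivity)]
  rw [div_lt_iff₀ hΛ0] at h3
  nlinarith

end

section

variable {F : Type*} [NormedAddCommGroup F] [InnerProductSpace ℝ F]

theorem sub_algebraMap_apply (T : F →L[ℝ] F) (t : ℝ) (x : F) :
    (T - algebraMap ℝ (F →L[ℝ] F) t) x = T x - t • x := by
  simp [Algebra.algebraMap_eq_smul_one]

theorem norm_sq_le_of_nonneg {S : F →L[ℝ] F} (hS : ∀ x y, inner ℝ (S x) y = inner ℝ x (S y))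
    (hpos : ∀ x, 0 ≤ inner ℝ (S x) x) (x : F) :
    ‖S x‖ ^ 2 ≤ (‖S‖ + 1) * inner ℝ (S x) x := by
  set K := ‖S‖ + 1
  have hK : 0 < K := by positivity
  have h := hpos (x - K⁻¹ • S x)
  have e1 : inner ℝ (S (S x)) x = ‖S x‖ ^ 2 := by rw [hS, real_inner_self_eq_norm_sq]
  have e2 : inner ℝ (S (S x)) (S x) ≤ K * ‖S x‖ ^ 2 := by
    calc inner ℝ (S (S x)) (S x) ≤ ‖S (S x)‖ * ‖S x‖ := real_inner_le_norm _ _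
      _ ≤ (‖S‖ * ‖S x‖) * ‖S x‖ := by gcongr; exact S.le_opNorm _
      _ ≤ _ := by
        have : 0 ≤ ‖S x‖ ^ 2 := by positivity
        have : K = ‖S‖ + 1 := rfl
        nlinarith
  have e3 : inner ℝ (S (x - K⁻¹ • S x)) (x - K⁻¹ • S x)
      = inner ℝ (S x) x - 2 * K⁻¹ * ‖S x‖ ^ 2 + K⁻¹ ^ 2 * inner ℝ (S (S x)) (S x) := by
    rw [map_sub, map_smul, inner_sub_left, inner_sub_right, inner_sub_right, inner_smul_left,
      inner_smul_left, inner_smul_right, inner_smul_right, e1, real_inner_self_eq_norm_sq]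
    simp
    ring
  rw [e3] at h
  have e4 : K⁻¹ ^ 2 * inner ℝ (S (S x)) (S x) ≤ K⁻¹ ^ 2 * (K * ‖S x‖ ^ 2) := by gcongr
  have e5 : K⁻¹ ^ 2 * (K * ‖S x‖ ^ 2) = K⁻¹ * ‖S x‖ ^ 2 := by field_simp
  have e6 : K⁻¹ * ‖S x‖ ^ 2 ≤ inner ℝ (S x) x := by linarith
  rwa [inv_mul_le_iff₀ hK] at e6

variable [CompleteSpace F]

/-- A symmetric operator is invertible if and only if it is bounded below. -/
theorem isUnit_iff_bounded_below {A : F →L[ℝ] F} (hA : ∀ x y, inner ℝ (A x) y = inner ℝ x (A y)) :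
    IsUnit A ↔ ∃ c > 0, ∀ x, c * ‖x‖ ≤ ‖A x‖ := by
  constructor
  · rintro ⟨u, rfl⟩
    refine ⟨(‖(↑u⁻¹ : F →L[ℝ] F)‖ + 1)⁻¹, by positivity, fun x => ?_⟩
    rw [inv_mul_le_iff₀ (by positivity)]
    have h1 : (↑u⁻¹ : F →L[ℝ] F) ((u : F →L[ℝ] F) x) = x := by
      rw [← mul_apply_eq_comp, Units.inv_mul]; rfl
    calc ‖x‖ = ‖(↑u⁻¹ : F →L[ℝ] F) ((u : F →L[ℝ] F) x)‖ := by rw [h1]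
      _ ≤ ‖(↑u⁻¹ : F →L[ℝ] F)‖ * ‖(u : F →L[ℝ] F) x‖ := ContinuousLinearMap.le_opNorm _ _
      _ ≤ _ := by gcongr; linarith
  · rintro ⟨c, hc, h⟩
    have h2 : IsUnit (A ^ 2) := by
      refine ContinuousLinearMap.isUnit_of_forall_le_norm_inner_map _
        (c := Real.toNNReal (c ^ 2)) (Real.toNNReal_pos.2 (by positivity)) fun x => ?_
      rw [Real.coe_toNNReal _ (sq_nonneg c), pow_two A, mul_apply_eq_comp, hA, real_inner_self_eq_norm_sq,
        Real.norm_of_nonneg (by positivity)]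
      have := h x
      have h3 : (c * ‖x‖) ^ 2 ≤ ‖A x‖ ^ 2 := by gcongr
      nlinarith
    exact (isUnit_pow_iff two_ne_zero).1 h2

/-- If the spectrum of a symmetric operator does not meet `(-r, r)`, the operator is bounded below
by `r`. -/
theorem le_norm_of_isUnit {T : F →L[ℝ] F} (hT : ∀ x y, inner ℝ (T x) y = inner ℝ x (T y))
    {r : ℝ} (hr : 0 ≤ r) (h : ∀ t : ℝ, |t| < r → IsUnit (T - algebraMap ℝ (F →L[ℝ] F) t)) (x : F) :
    r * ‖x‖ ≤ ‖T x‖ := by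
  set P : Set ℝ := Icc 0 r ∩ {m | ∀ x, m * ‖x‖ ≤ ‖T x‖} with hP
  have hPc : IsCompact P := by
    refine isCompact_Icc.inter_right ?_
    have : {m : ℝ | ∀ x, m * ‖x‖ ≤ ‖T x‖} = ⋂ x, {m | m * ‖x‖ ≤ ‖T x‖} := by ext; simp
    rw [this]
    exact isClosed_iInter fun x => isClosed_le (by fun_prop) (by fun_prop)
  obtain ⟨m, ⟨⟨hm0, hmr⟩, hm⟩, hmax⟩ := hPc.exists_isGreatest ⟨0, ⟨le_refl 0, hr⟩, by simp⟩
  rcases hmr.eq_or_lt with rfl | hlt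
  · exact hm x
  exfalso
  have hm' : ∀ x, m * ‖x‖ ≤ ‖T x‖ := hm
  set S : F →L[ℝ] F := (T - algebraMap ℝ (F →L[ℝ] F) m) * (T - algebraMap ℝ (F →L[ℝ] F) (-m))
  have hSx : ∀ x, S x = T (T x) - m ^ 2 • x := by
    intro x
    rw [mul_apply_eq_comp, sub_algebraMap_apply, sub_algebraMap_apply, map_sub, map_smul]
    module
  have hS : IsUnit S := (h m (by rwa [abs_of_nonneg hm0])).mul
    (h (-m) (by rwa [abs_neg, abs_of_nonneg hm0]))
  have hSs : ∀ x y, inner ℝ (S x) y = inner ℝ x (S y) := by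
    intro x y
    rw [hSx, hSx, inner_sub_left, inner_sub_right, hT, hT, inner_smul_left, inner_smul_right]
    simp
  have hSi : ∀ x, inner ℝ (S x) x = ‖T x‖ ^ 2 - m ^ 2 * ‖x‖ ^ 2 := by
    intro x
    rw [hSx, inner_sub_left, hT, inner_smul_left, real_inner_self_eq_norm_sq,
      real_inner_self_eq_norm_sq]
    simp
  have hpos : ∀ x, 0 ≤ inner ℝ (S x) x := by
    intro x
    rw [hSi]
    have : (m * ‖x‖) ^ 2 ≤ ‖T x‖ ^ 2 := by gcongr; exact hm' x
    nlinarith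
  obtain ⟨c, hc, hcS⟩ := (isUnit_iff_bounded_below hSs).1 hS
  set K := ‖S‖ + 1
  have hK : 0 < K := by positivity
  set m' := min r (√(m ^ 2 + c ^ 2 / K))
  have hmm' : m < m' := by
    refine lt_min hlt (Real.lt_sqrt_of_sq_lt ?_)
    have : 0 < c ^ 2 / K := by positivity
    linarith
  have : m' ∈ P := by
    refine ⟨⟨hm0.trans hmm'.le, min_le_left _ _⟩, fun x => ?_⟩
    have h1 : (c * ‖x‖) ^ 2 ≤ ‖S x‖ ^ 2 := by gcongr; exact hcS x
    have h2 := norm_sq_le_of_nonneg hSs hpos x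
    rw [hSi] at h2
    have h3 : c ^ 2 / K * ‖x‖ ^ 2 ≤ ‖T x‖ ^ 2 - m ^ 2 * ‖x‖ ^ 2 := by
      rw [div_mul_eq_mul_div, div_le_iff₀ hK]
      calc c ^ 2 * ‖x‖ ^ 2 = (c * ‖x‖) ^ 2 := by ring
        _ ≤ _ := h1.trans h2
        _ = _ := by ring
    refine le_of_sq_le_sq ?_ (norm_nonneg _)
    calc (m' * ‖x‖) ^ 2 = m' ^ 2 * ‖x‖ ^ 2 := by ring
      _ ≤ (√(m ^ 2 + c ^ 2 / K)) ^ 2 * ‖x‖ ^ 2 := by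
        gcongr
        exact min_le_right _ _
      _ = (m ^ 2 + c ^ 2 / K) * ‖x‖ ^ 2 := by rw [Real.sq_sqrt (by positivity)]
      _ ≤ _ := by nlinarith
  exact absurd (hmax this) (not_le.2 hmm')

/-- If zero is isolated in the spectrum of a symmetric operator, then the operator is bounded below
on the orthogonal complement of its kernel. -/
theorem le_norm_of_mem_orthogonal_ker {A : F →L[ℝ] F}
    (hA : ∀ x y, inner ℝ (A x) y = inner ℝ x (A y)) {r : ℝ} (hr : 0 < r)
    (h : ∀ t : ℝ, t ≠ 0 → |t| < r → IsUnit (A - algebraMap ℝ (F →L[ℝ] F) t)) {y : F}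
    (hy : y ∈ A.kerᗮ) : r * ‖y‖ ≤ ‖A y‖ := by
  set T : F →L[ℝ] F := A * A - algebraMap ℝ (F →L[ℝ] F) (r ^ 2 / 2) with hTdef
  have hTx : ∀ x, T x = A (A x) - (r ^ 2 / 2) • x := by
    intro x
    simp [T, Algebra.algebraMap_eq_smul_one]
  have hT : ∀ x y, inner ℝ (T x) y = inner ℝ x (T y) := by
    intro x y
    rw [hTx, hTx, inner_sub_left, inner_sub_right, hA, hA, inner_smul_left, inner_smul_right]
    simp
  have hT' : ∀ x, r ^ 2 / 2 * ‖x‖ ≤ ‖T x‖ := by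
    refine fun x => le_norm_of_isUnit hT (by positivity) (fun t ht => ?_) x
    rw [abs_lt] at ht
    set s := √(r ^ 2 / 2 + t)
    have hs0 : 0 < s := Real.sqrt_pos.2 (by linarith)
    have hs2 : s ^ 2 = r ^ 2 / 2 + t := Real.sq_sqrt (by linarith)
    have hsr : s < r := by
      refine lt_of_pow_lt_pow_left₀ 2 hr.le ?_
      rw [hs2]; linarith
    have e : T - algebraMap ℝ (F →L[ℝ] F) t
        = (A - algebraMap ℝ (F →L[ℝ] F) s) * (A - algebraMap ℝ (F →L[ℝ] F) (-s)) := by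
      have : t = s ^ 2 - r ^ 2 / 2 := by linarith
      ext x
      rw [mul_apply_eq_comp, sub_algebraMap_apply T, hTx, sub_algebraMap_apply A,
        sub_algebraMap_apply A, map_sub, map_smul, this]
      module
    rw [e]
    exact (h s hs0.ne' (by rwa [abs_of_pos hs0])).mul
      (h (-s) (by simpa using hs0.ne') (by rwa [abs_neg, abs_of_pos hs0]))
  have hrange : ∀ x, r * ‖A x‖ ≤ ‖A (A x)‖ := by
    intro x
    have h1 : (r ^ 2 / 2 * ‖x‖) ^ 2 ≤ ‖T x‖ ^ 2 := by gcongr; exact hT' x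
    have h2 : ‖T x‖ ^ 2 = ‖A (A x)‖ ^ 2 - r ^ 2 * ‖A x‖ ^ 2 + (r ^ 2 / 2) ^ 2 * ‖x‖ ^ 2 := by
      rw [hTx, norm_sub_sq_real, inner_smul_right, hA, real_inner_self_eq_norm_sq, norm_smul,
        Real.norm_of_nonneg (by positivity)]
      ring
    refine le_of_sq_le_sq ?_ (norm_nonneg _)
    nlinarith
  have hsym : (A : F →ₗ[ℝ] F).IsSymmetric := fun x y => hA x y
  have hker : A.kerᗮ = (A.range).topologicalClosure := by
    rw [← Submodule.orthogonal_orthogonal_eq_closure]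
    congr 1
    exact hsym.orthogonal_range.symm
  rw [hker] at hy
  have hclosed : IsClosed {y : F | r * ‖y‖ ≤ ‖A y‖} := isClosed_le (by fun_prop) (by fun_prop)
  refine closure_minimal (s := (A.range : Set F)) ?_ hclosed hy
  rintro _ ⟨x, rfl⟩
  exact hrange x

/-- An isolated point of the spectrum with one-dimensional eigenspace does not have two orthogonal
approximate eigenvectors. -/
theorem false_of_orthogonal_approx {A : F →L[ℝ] F}
    (hA : ∀ x y, inner ℝ (A x) y = inner ℝ x (A y)) {r : ℝ} (hr : 0 < r)
    (h : ∀ t : ℝ, t ≠ 0 → |t| < r → IsUnit (A - algebraMap ℝ (F →L[ℝ] F) t))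
    (hker : ∀ p q : F, A p = 0 → A q = 0 → p ≠ 0 → ∃ c : ℝ, q = c • p) {x x' : F} {s : ℝ}
    (hs : 0 < s) (hx : ‖x‖ = s) (hx' : ‖x'‖ = s) (horth : inner ℝ x x' = 0)
    (hAx : ‖A x‖ ≤ r / 8 * s) (hAx' : ‖A x'‖ ≤ r / 8 * s) : False := by
  have key : ∀ x : F, ‖A x‖ ≤ r / 8 * s → ∃ p, A p = 0 ∧ ‖x - p‖ ≤ s / 8 := by
    intro x hx
    have : CompleteSpace A.ker := (ContinuousLinearMap.isClosed_ker A).completeSpace_coe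
    obtain ⟨p, hp, z, hz, rfl⟩ := A.ker.exists_add_mem_mem_orthogonal x
    have hp0 : A p = 0 := hp
    refine ⟨p, hp0, ?_⟩
    have := le_norm_of_mem_orthogonal_ker hA hr h hz
    rw [map_add, hp0, zero_add] at hx
    rw [add_sub_cancel_left]
    have h2 : r * ‖z‖ ≤ r * (s / 8) := by linarith
    exact le_of_mul_le_mul_left h2 hr
  obtain ⟨p, hp, hxp⟩ := key x hAx
  obtain ⟨q, hq, hxq⟩ := key x' hAx'
  have np : s - s / 8 ≤ ‖p‖ := by
    have := norm_sub_norm_le x p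
    linarith
  have nq : s - s / 8 ≤ ‖q‖ := by
    have := norm_sub_norm_le x' q
    linarith
  have nq' : ‖q‖ ≤ s + s / 8 := by
    have := norm_sub_norm_le q x'
    rw [norm_sub_rev] at this
    linarith
  obtain ⟨c, rfl⟩ := hker p q hp hq (by
    rintro rfl
    rw [norm_zero] at np
    linarith)
  have e1 : |inner ℝ p (c • p)| = ‖p‖ * ‖c • p‖ := by
    rw [inner_smul_right, real_inner_self_eq_norm_sq, norm_smul, abs_mul, Real.norm_eq_abs,
      abs_of_nonneg (sq_nonneg ‖p‖)]
    ring
  have e2 : inner ℝ p (c • p) = -inner ℝ (x - p) (c • p) - inner ℝ x (x' - c • p) := by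
    rw [inner_sub_left, inner_sub_right, horth]; ring
  have e3 : |inner ℝ (x - p) (c • p)| ≤ s / 8 * (s + s / 8) :=
    (abs_real_inner_le_norm _ _).trans (by gcongr)
  have e4 : |inner ℝ x (x' - c • p)| ≤ s * (s / 8) :=
    (abs_real_inner_le_norm _ _).trans (by rw [hx]; gcongr)
  have e5 : |inner ℝ p (c • p)| ≤ s / 8 * (s + s / 8) + s * (s / 8) := by
    rw [e2]
    rw [abs_le] at *
    constructor <;> linarith [e3.1, e3.2, e4.1, e4.2]
  have e6 : (s - s / 8) * (s - s / 8) ≤ ‖p‖ * ‖c • p‖ := by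
    apply mul_le_mul np nq (by linarith) (norm_nonneg _)
  nlinarith [mul_pos hs hs]

end

section

variable {V : ℤ → ℝ} {E δ : ℝ} {H : lp (fun _ : ℤ => ℝ) 2 →L[ℝ] lp (fun _ : ℤ => ℝ) 2}

theorem inner_schrodinger (hH : IsSchrodingerOp V H) (f g : lp (fun _ : ℤ => ℝ) 2) :
    inner ℝ (H f) g = inner ℝ f (H g) := by
  have s1 := lp.summable_inner (𝕜 := ℝ) (H f) g
  have s2 := lp.summable_inner (𝕜 := ℝ) f (H g)
  rw [lp.inner_eq_tsum, lp.inner_eq_tsum, ← sub_eq_zero, ← s1.tsum_sub s2]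
  have hs : ∀ a b : lp (fun _ : ℤ => ℝ) 2, Summable fun n : ℤ => a (n + 1) * b n := by
    intro a b
    have ha := (lp.summable_inner (𝕜 := ℝ) a a).comp_injective (add_left_injective (1 : ℤ))
    have hb := lp.summable_inner (𝕜 := ℝ) b b
    refine Summable.of_norm_bounded (ha.add hb) fun n => ?_
    simp only [Function.comp, Real.inner_apply, Real.norm_eq_abs, abs_mul]
    have h1 := sq_abs (a (n + 1))
    have h2 := sq_abs (b n)
    nlinarith [sq_nonneg (|a (n + 1)| - |b n|), sq_nonneg (a (n + 1)), sq_nonneg (b n)]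
  have ht : ∀ a b : lp (fun _ : ℤ => ℝ) 2,
      HasSum (fun n : ℤ => a n * b (n - 1)) (∑' n : ℤ, a (n + 1) * b n) := by
    intro a b
    have := (Equiv.addRight (-1 : ℤ)).hasSum_iff.2 (hs a b).hasSum
    refine this.congr_fun fun n => ?_
    simp [Function.comp, sub_eq_add_neg]
  have e : (fun n : ℤ => inner ℝ (H f n) (g n) - inner ℝ (f n) (H g n))
      = fun n : ℤ => (f (n + 1) * g n - f n * g (n - 1)) - (g (n + 1) * f n - g n * f (n - 1)) := by
    funext n
    rw [hH f n, hH g n]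
    simp only [Real.inner_apply]
    ring
  rw [e]
  have h1 := ((hs f g).hasSum.sub (ht f g)).sub ((hs g f).hasSum.sub (ht g f))
  simpa using h1.tsum_eq

theorem norm_sq_eq_sum_translate (f : lp (fun _ : ℤ => ℝ) 2) (c : ℤ) (s : Finset ℤ)
    (h : ∀ n : ℤ, n - c ∉ s → f n = 0) : ‖f‖ ^ 2 = ∑ j ∈ s, f (c + j) ^ 2 := by
  rw [← real_inner_self_eq_norm_sq, lp.inner_eq_tsum, ← (Equiv.addLeft c).tsum_eq, tsum_eq_sum]
  · refine Finset.sum_congr rfl fun j _ => ?_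
    simp [pow_two]
  · intro j hj
    have := h (c + j) (by simpa using hj)
    simp [this]

/-- `u`, supported in `[-N, N]`, is an approximate eigenfunction with potential `V`. -/
def IsApproxEigen (V : ℤ → ℝ) (E δ : ℝ) (N : ℕ) (u : ℤ → ℝ) : Prop :=
  (∀ n ∉ Finset.Icc (-N : ℤ) N, u n = 0) ∧ (∃ n, u n ≠ 0) ∧
    ∑ n ∈ Finset.Icc (-(N + 1) : ℤ) (N + 1), (u (n + 1) + u (n - 1) + V n * u n - E * u n) ^ 2
      ≤ δ * ∑ n ∈ Finset.Icc (-N : ℤ) N, u n ^ 2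

theorem IsApproxEigen.exists_lp {c : ℤ} {N : ℕ} {u : ℤ → ℝ}
    (h : IsApproxEigen (translate c V) E δ N u) (hH : IsSchrodingerOp V H) :
    ∃ f : lp (fun _ : ℤ => ℝ) 2, (∀ n, f n = u (n - c)) ∧
      ‖f‖ ^ 2 = ∑ n ∈ Finset.Icc (-N : ℤ) N, u n ^ 2 ∧ 0 < ‖f‖ ∧
      ‖H f - E • f‖ ^ 2 ≤ δ * ‖f‖ ^ 2 := by
  obtain ⟨h0, ⟨m, hm⟩, h1⟩ := h
  have hmem : Memℓp (fun n : ℤ => u (n - c)) 2 := by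
    refine memℓp_gen (summable_of_hasFiniteSupport ?_)
    refine ((Finset.Icc (-N + c : ℤ) (N + c)).finite_toSet).subset fun n hn => ?_
    by_contra hn'
    apply hn
    have : u (n - c) = 0 := h0 _ (by
      simp only [Finset.coe_Icc, Set.mem_Icc, Finset.mem_Icc] at hn' ⊢
      omega)
    simp [this]
  set f : lp (fun _ : ℤ => ℝ) 2 := ⟨_, hmem⟩
  have hf : ∀ n, f n = u (n - c) := fun n => rfl
  have hn : ‖f‖ ^ 2 = ∑ n ∈ Finset.Icc (-N : ℤ) N, u n ^ 2 := by
    rw [norm_sq_eq_sum_translate f c (Finset.Icc (-N : ℤ) N) fun n hn => by rw [hf, h0 _ hn]]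
    refine Finset.sum_congr rfl fun j _ => ?_
    rw [hf, add_sub_cancel_left]
  refine ⟨f, hf, hn, ?_, ?_⟩
  · refine norm_pos_iff.2 fun hz => hm ?_
    have := hf (m + c)
    rw [hz] at this
    simpa using this.symm
  · have hval : ∀ n, (H f - E • f) n = u (n - c + 1) + u (n - c - 1) + V n * u (n - c)
        - E * u (n - c) := by
      intro n
      rw [lp.coeFn_sub, lp.coeFn_smul, Pi.sub_apply, Pi.smul_apply, hH f n, hf, hf, hf, smul_eq_mul,
        show n + 1 - c = n - c + 1 by ring, show n - 1 - c = n - c - 1 by ring]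
    rw [hn, norm_sq_eq_sum_translate _ c (Finset.Icc (-(N + 1) : ℤ) (N + 1))]
    · refine le_of_eq_of_le (Finset.sum_congr rfl fun j _ => ?_) h1
      rw [hval, add_sub_cancel_left]
      simp only [translate, add_comm c j]
    · intro n hn
      rw [Finset.mem_Icc] at hn
      rw [hval, h0 (n - c + 1) (by rw [Finset.mem_Icc]; omega),
        h0 (n - c - 1) (by rw [Finset.mem_Icc]; omega), h0 (n - c) (by rw [Finset.mem_Icc]; omega)]
      ring

theorem inner_schrodinger_sub (hH : IsSchrodingerOp V H) (E : ℝ)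
    (f g : lp (fun _ : ℤ => ℝ) 2) :
    inner ℝ ((H - algebraMap ℝ _ E) f) g = inner ℝ f ((H - algebraMap ℝ _ E) g) := by
  rw [sub_algebraMap_apply, sub_algebraMap_apply, inner_sub_left, inner_sub_right, inner_schrodinger hH,
    inner_smul_left, inner_smul_right]
  simp

theorem mem_spectrum_iff_not_isUnit : E ∈ spectrum ℝ H ↔ ¬ IsUnit (H - algebraMap ℝ _ E) := by
  rw [spectrum.mem_iff, ← IsUnit.neg_iff, neg_sub]

theorem exists_isApproxEigen (hH : IsSchrodingerOp V H) (hE : E ∈ spectrum ℝ H) (hδ : 0 < δ) :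
    ∃ N u, IsApproxEigen V E δ N u := by
  rw [mem_spectrum_iff_not_isUnit, isUnit_iff_bounded_below (inner_schrodinger_sub hH E)] at hE
  push Not at hE
  obtain ⟨x, hx⟩ := hE (√δ) (Real.sqrt_pos.2 hδ)
  set A := H - algebraMap ℝ _ E with hA
  have hopen : IsOpen {x | ‖A x‖ < √δ * ‖x‖} := isOpen_lt (by fun_prop) (by fun_prop)
  obtain ⟨s, hs⟩ := ((lp.hasSum_single (by simp) x).eventually (hopen.mem_nhds hx)).exists
  set y := ∑ i ∈ s, lp.single 2 i (x i : ℝ) with hy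
  have hy0 : ∀ n ∉ s, y n = 0 := by
    intro n hn
    rw [hy, lp.coeFn_sum, Finset.sum_apply]
    refine Finset.sum_eq_zero fun i hi => ?_
    rw [lp.single_apply_ne]
    rintro rfl
    exact hn hi
  set N := s.sup Int.natAbs
  have hsN : ∀ n ∉ Finset.Icc (-N : ℤ) N, y n = 0 := by
    intro n hn
    refine hy0 n fun hns => hn ?_
    have : n.natAbs ≤ N := Finset.le_sup (f := Int.natAbs) hns
    rw [Finset.mem_Icc]
    omega
  have hlt : ‖A y‖ < √δ * ‖y‖ := hs
  refine ⟨N, y, hsN, ?_, ?_⟩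
  · by_contra! hc
    have : y = 0 := by ext n; simpa using hc n
    rw [this] at hlt
    simp at hlt
  · have h1 : ‖A y‖ ^ 2 ≤ (√δ * ‖y‖) ^ 2 := by gcongr
    rw [mul_pow, Real.sq_sqrt hδ.le] at h1
    have hval : ∀ n, A y n = y (n + 1) + y (n - 1) + V n * y n - E * y n := by
      intro n
      rw [hA, sub_algebraMap_apply, lp.coeFn_sub, lp.coeFn_smul, Pi.sub_apply, Pi.smul_apply,
        hH y n, smul_eq_mul]
    rw [norm_sq_eq_sum_translate y 0 (Finset.Icc (-N : ℤ) N) (by simpa using hsN),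
      norm_sq_eq_sum_translate (A y) 0 (Finset.Icc (-(N + 1) : ℤ) (N + 1))] at h1
    · simpa [hval] using h1
    · intro n hn
      rw [Finset.mem_Icc] at hn
      rw [hval, hsN (n + 1) (by rw [Finset.mem_Icc]; omega),
        hsN (n - 1) (by rw [Finset.mem_Icc]; omega), hsN n (by rw [Finset.mem_Icc]; omega)]
      ring

theorem mem_spectrum_of_isApproxEigen (hH : IsSchrodingerOp V H)
    (h : ∀ δ > 0, ∃ c N u, IsApproxEigen (translate c V) E δ N u) : E ∈ spectrum ℝ H := by
  rw [mem_spectrum_iff_not_isUnit, isUnit_iff_bounded_below (inner_schrodinger_sub hH E)]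
  rintro ⟨c, hc, hb⟩
  obtain ⟨k, N, u, hu⟩ := h (c ^ 2 / 2) (by positivity)
  obtain ⟨f, -, -, hf0, hf⟩ := hu.exists_lp hH
  have h1 := hb f
  rw [sub_algebraMap_apply] at h1
  have h2 : (c * ‖f‖) ^ 2 ≤ ‖H f - E • f‖ ^ 2 := by gcongr
  nlinarith [mul_pos (pow_pos hc 2) (pow_pos hf0 2)]

/-- An approximate eigenfunction for `V` is one for every potential close to `V`. -/
theorem IsApproxEigen.of_close {N : ℕ} {u : ℤ → ℝ} (h : IsApproxEigen V E δ N u) {V' : ℤ → ℝ}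
    {ε : ℝ} (hV : ∀ n ∈ Finset.Icc (-N : ℤ) N, (V' n - V n) ^ 2 ≤ ε) :
    IsApproxEigen V' E (2 * δ + 2 * ε) N u := by
  obtain ⟨h0, h1, h2⟩ := h
  refine ⟨h0, h1, ?_⟩
  have h3 : ∑ n ∈ Finset.Icc (-N : ℤ) N, u n ^ 2
      = ∑ n ∈ Finset.Icc (-(N + 1) : ℤ) (N + 1), u n ^ 2 := by
    refine Finset.sum_subset (Finset.Icc_subset_Icc (by omega) (by omega)) fun n _ hn => ?_
    rw [h0 n hn]; ring
  have h4 : ∀ n, (u (n + 1) + u (n - 1) + V' n * u n - E * u n) ^ 2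
      ≤ 2 * (u (n + 1) + u (n - 1) + V n * u n - E * u n) ^ 2 + 2 * ε * u n ^ 2 := by
    intro n
    by_cases hn : n ∈ Finset.Icc (-N : ℤ) N
    · have := mul_le_mul_of_nonneg_right (hV n hn) (sq_nonneg (u n))
      set r := u (n + 1) + u (n - 1) + V n * u n - E * u n
      have e : u (n + 1) + u (n - 1) + V' n * u n - E * u n = r + (V' n - V n) * u n := by
        simp only [r]; ring
      rw [e]
      nlinarith [sq_nonneg (r - (V' n - V n) * u n)]
    · rw [h0 n hn]
      nlinarith [sq_nonneg (u (n + 1) + u (n - 1))]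
  calc _ ≤ ∑ n ∈ Finset.Icc (-(N + 1) : ℤ) (N + 1),
        (2 * (u (n + 1) + u (n - 1) + V n * u n - E * u n) ^ 2 + 2 * ε * u n ^ 2) :=
        Finset.sum_le_sum fun n _ => h4 n
    _ = 2 * ∑ n ∈ Finset.Icc (-(N + 1) : ℤ) (N + 1),
        (u (n + 1) + u (n - 1) + V n * u n - E * u n) ^ 2
        + 2 * ε * ∑ n ∈ Finset.Icc (-N : ℤ) N, u n ^ 2 := by
        rw [h3, Finset.sum_add_distrib, Finset.mul_sum, Finset.mul_sum]
    _ ≤ _ := by linarith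

end

section

variable {𝒜 : Set ℝ} {Ω : Set (ℤ → ℝ)} {V : ℤ → ℝ} {E δ : ℝ}
  {H : lp (fun _ : ℤ => ℝ) 2 →L[ℝ] lp (fun _ : ℤ => ℝ) 2}

/-- In a minimal subshift every forward orbit is dense. -/
theorem exists_gt_translate_mem (h𝒜 : 𝒜.Finite) (hval : ∀ ω ∈ Ω, ∀ n : ℤ, ω n ∈ 𝒜)
    (hmin : IsMinimalSubshift Ω) {U : Set (ℤ → ℝ)} (hU : IsOpen U) (hne : (U ∩ Ω).Nonempty)
    {ω : ℤ → ℝ} (hω : ω ∈ Ω) (m : ℤ) : ∃ k > m, translate k ω ∈ U := by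
  obtain ⟨τ, hτ, φ, hφ, hlim⟩ := (isCompact_subshift h𝒜 hval hmin.1).tendsto_subseq
    (x := fun n : ℕ => translate n ω) fun n => translate_mem hmin.1 n hω
  obtain ⟨k, hk⟩ := exists_translate_mem hmin hU hne hτ
  have hev : ∀ᶠ i in atTop, translate k (translate (φ i : ℤ) ω) ∈ U :=
    hlim.eventually (((hU.preimage (continuous_translate k)).mem_nhds hk))
  obtain ⟨i, hi, hi'⟩ := (hev.and (eventually_gt_atTop (m - k).toNat)).exists
  have := hφ.le_apply (x := i)
  refine ⟨k + φ i, by omega, ?_⟩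
  convert hi using 1
  funext n
  simp only [translate]
  congr 1
  ring

/-- Approximate eigenfunctions of one element of a minimal subshift recur arbitrarily far to the
right in every other element. -/
theorem IsApproxEigen.exists_gt (h𝒜 : 𝒜.Finite) (hval : ∀ ω ∈ Ω, ∀ n : ℤ, ω n ∈ 𝒜)
    (hmin : IsMinimalSubshift Ω) {N : ℕ} {u : ℤ → ℝ} (hu : IsApproxEigen V E δ N u) (hδ : 0 < δ)
    (hV : V ∈ Ω) {ω : ℤ → ℝ} (hω : ω ∈ Ω) (m : ℤ) :
    ∃ k > m, IsApproxEigen (translate k ω) E (4 * δ) N u := by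
  set U : Set (ℤ → ℝ) := ⋂ n ∈ Finset.Icc (-N : ℤ) N, {V' | (V' n - V n) ^ 2 < δ}
  have hU : IsOpen U := isOpen_biInter_finset fun n _ => isOpen_lt (by fun_prop) (by fun_prop)
  have hVU : V ∈ U := by
    simp only [U, Set.mem_iInter]
    intro n _
    simpa using hδ
  obtain ⟨k, hk, hkU⟩ := exists_gt_translate_mem h𝒜 hval hmin hU ⟨V, hVU, hV⟩ hω m
  refine ⟨k, hk, ?_⟩
  simp only [U, Set.mem_iInter] at hkU
  have := hu.of_close (ε := δ) (V' := translate k ω) fun n hn => (hkU n hn).le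
  convert this using 1
  ring

theorem spectrum_subset_spectrum (h𝒜 : 𝒜.Finite) (hval : ∀ ω ∈ Ω, ∀ n : ℤ, ω n ∈ 𝒜)
    (hmin : IsMinimalSubshift Ω) (hV : V ∈ Ω) (hH : IsSchrodingerOp V H) {ω : ℤ → ℝ} (hω : ω ∈ Ω)
    {H' : lp (fun _ : ℤ => ℝ) 2 →L[ℝ] lp (fun _ : ℤ => ℝ) 2} (hH' : IsSchrodingerOp ω H') :
    spectrum ℝ H ⊆ spectrum ℝ H' := by
  intro E hE
  refine mem_spectrum_of_isApproxEigen hH' fun δ hδ => ?_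
  obtain ⟨N, u, hu⟩ := exists_isApproxEigen hH hE (δ := δ / 4) (by positivity)
  obtain ⟨k, -, hk⟩ := hu.exists_gt h𝒜 hval hmin (by positivity) hV hω 0
  refine ⟨k, N, u, ?_⟩
  convert hk using 1
  ring

theorem tendsto_atTop_zero_of_lp (f : lp (fun _ : ℤ => ℝ) 2) :
    Tendsto (fun n : ℤ => f n) atTop (𝓝 0) := by
  have h := (lp.summable_inner (𝕜 := ℝ) f f).tendsto_cofinite_zero
  rw [Int.cofinite_eq] at h
  have h1 := h.mono_left (le_sup_right : (atTop : Filter ℤ) ≤ atBot ⊔ atTop)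
  have h2 : Tendsto (fun n : ℤ => |f n|) atTop (𝓝 0) := by
    have := (Real.continuous_sqrt.tendsto 0).comp h1
    rw [Real.sqrt_zero] at this
    refine this.congr fun n => ?_
    simp only [Function.comp, Real.inner_apply, Real.sqrt_mul_self_eq_abs]
  exact (tendsto_zero_iff_abs_tendsto_zero _).2 h2

/-- Eigenspaces of Schrödinger operators on the line are at most one-dimensional. -/
theorem eigenvector_unique (hH : IsSchrodingerOp V H) {p q : lp (fun _ : ℤ => ℝ) 2}
    (hp : H p = E • p) (hq : H q = E • q) (hp0 : p ≠ 0) : ∃ c : ℝ, q = c • p := by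
  have eqn : ∀ f : lp (fun _ : ℤ => ℝ) 2, H f = E • f →
      ∀ n : ℤ, f (n + 1) + f (n - 1) + V n * f n = E * f n := by
    intro f hf n
    rw [← hH f n, hf, lp.coeFn_smul, Pi.smul_apply, smul_eq_mul]
  have ep := eqn p hp
  have eq := eqn q hq
  set W : ℤ → ℝ := fun n => p (n + 1) * q n - p n * q (n + 1) with hW
  have hstep : ∀ n, W (n + 1) = W n := by
    intro n
    have h1 := ep (n + 1)
    have h2 := eq (n + 1)
    rw [add_sub_cancel_right] at h1 h2
    simp only [hW]
    have h1' : p (n + 1 + 1) = E * p (n + 1) - V (n + 1) * p (n + 1) - p n := by linarith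
    have h2' : q (n + 1 + 1) = E * q (n + 1) - V (n + 1) * q (n + 1) - q n := by linarith
    rw [h1', h2']
    ring
  have hconst : ∀ n, W n = W 0 := by
    intro n
    induction n using Int.induction_on with
    | zero => rfl
    | succ i ih => rw [hstep, ih]
    | pred i ih => rw [← hstep, sub_add_cancel, ih]
  have hlim : Tendsto W atTop (𝓝 0) := by
    have hp1 := tendsto_atTop_zero_of_lp p
    have hq1 := tendsto_atTop_zero_of_lp q
    have hadd : Tendsto (fun n : ℤ => n + 1) atTop atTop :=
      tendsto_atTop_add_const_right _ _ tendsto_id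
    have := ((hp1.comp hadd).mul hq1).sub (hp1.mul (hq1.comp hadd))
    simpa using this
  have hW0 : ∀ n, W n = 0 := by
    intro n
    rw [hconst n]
    refine tendsto_nhds_unique ?_ hlim
    exact tendsto_const_nhds.congr fun n => (hconst n).symm
  obtain ⟨m, hm⟩ : ∃ m, p m ≠ 0 := by
    by_contra! hc
    apply hp0
    ext n
    simpa using hc n
  refine ⟨q m / p m, ?_⟩
  set c := q m / p m
  have hcm : c * p m = q m := div_mul_cancel₀ _ hm
  have hd1 : q (m + 1) = c * p (m + 1) := by
    have := hW0 m
    simp only [hW] at this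
    rw [← hcm] at this
    have h2 : p m * (q (m + 1) - c * p (m + 1)) = 0 := by linarith
    rcases mul_eq_zero.1 h2 with h | h
    · exact absurd h hm
    · linarith
  have hall : ∀ n : ℤ, q (m + n) = c * p (m + n) ∧ q (m + n + 1) = c * p (m + n + 1) := by
    intro n
    induction n using Int.induction_on with
    | zero => simpa using ⟨hcm.symm, hd1⟩
    | succ i ih =>
      rw [← add_assoc]
      refine ⟨ih.2, ?_⟩
      have h1 := ep (m + i + 1)
      have h2 := eq (m + i + 1)
      rw [add_sub_cancel_right] at h1 h2
      rw [ih.1, ih.2] at h2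
      linear_combination h2 - c * h1
    | pred i ih =>
      rw [show m + (-(i : ℤ) - 1) = m + -(i : ℤ) - 1 by ring, sub_add_cancel]
      refine ⟨?_, ih.1⟩
      have h1 := ep (m + -(i : ℤ))
      have h2 := eq (m + -(i : ℤ))
      rw [ih.1, ih.2] at h2
      linear_combination h2 - c * h1
  ext n
  have := (hall (n - m)).1
  rw [add_sub_cancel] at this
  rw [this, lp.coeFn_smul, Pi.smul_apply, smul_eq_mul]

theorem accPt_spectrum (h𝒜 : 𝒜.Finite) (hval : ∀ ω ∈ Ω, ∀ n : ℤ, ω n ∈ 𝒜)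
    (hmin : IsMinimalSubshift Ω) (hV : V ∈ Ω) (hH : IsSchrodingerOp V H) (hE : E ∈ spectrum ℝ H) :
    AccPt E (𝓟 (spectrum ℝ H)) := by
  rw [accPt_iff_nhds]
  by_contra! hcon
  obtain ⟨U, hU, hUE⟩ := hcon
  obtain ⟨r, hr, hball⟩ := Metric.mem_nhds_iff.1 hU
  set A := H - algebraMap ℝ _ E with hA
  have hAs : ∀ f g, inner ℝ (A f) g = inner ℝ f (A g) := inner_schrodinger_sub hH E
  have hunit : ∀ t : ℝ, t ≠ 0 → |t| < r → IsUnit (A - algebraMap ℝ _ t) := by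
    intro t ht htr
    by_contra hn
    have hmem : E + t ∈ spectrum ℝ H := by
      rw [mem_spectrum_iff_not_isUnit, map_add, ← sub_sub]
      exact hn
    have := hUE (E + t) ⟨hball (by simpa [Real.dist_eq] using htr), hmem⟩
    apply ht
    linarith
  have hAx : ∀ f, A f = H f - E • f := sub_algebraMap_apply H E
  have hker : ∀ p q, A p = 0 → A q = 0 → p ≠ 0 → ∃ c : ℝ, q = c • p := by
    intro p q hp hq
    rw [hAx, sub_eq_zero] at hp hq
    exact eigenvector_unique hH hp hq
  have hδ : 0 < (r / 8) ^ 2 / 4 := by positivity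
  obtain ⟨N, u, hu⟩ := exists_isApproxEigen hH hE hδ
  obtain ⟨k, -, hk⟩ := hu.exists_gt h𝒜 hval hmin hδ hV hV 0
  obtain ⟨k', hkk', hk'⟩ := hu.exists_gt h𝒜 hval hmin hδ hV hV (k + 2 * N)
  rw [mul_div_cancel₀ _ (four_ne_zero)] at hk hk'
  obtain ⟨f, hf, hfn, hf0, hfA⟩ := hk.exists_lp hH
  obtain ⟨g, hg, hgn, hg0, hgA⟩ := hk'.exists_lp hH
  have hfg : ‖g‖ = ‖f‖ := by
    rw [← hfn] at hgn
    exact (pow_left_inj₀ (norm_nonneg _) (norm_nonneg _) two_ne_zero).1 hgn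
  have horth : inner ℝ f g = 0 := by
    rw [lp.inner_eq_tsum]
    refine (tsum_congr fun n => ?_).trans tsum_zero
    rw [Real.inner_apply, hf, hg]
    by_cases h : n - k ∈ Finset.Icc (-N : ℤ) N
    · rw [hu.1 (n - k') (by rw [Finset.mem_Icc] at h ⊢; omega), mul_zero]
    · rw [hu.1 _ h, zero_mul]
  refine false_of_orthogonal_approx hAs hr hunit hker hf0 rfl hfg horth ?_ ?_
  · refine le_of_sq_le_sq ?_ (by positivity)
    rw [hAx, mul_pow]
    exact hfA
  · refine le_of_sq_le_sq ?_ (by positivity)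
    rw [hAx, mul_pow, ← hfg]
    exact hgA

end

section

variable {𝒜 : Set ℝ} {Ω : Set (ℤ → ℝ)} {V : ℤ → ℝ} {E δ : ℝ}
  {H : lp (fun _ : ℤ => ℝ) 2 →L[ℝ] lp (fun _ : ℤ => ℝ) 2}

theorem sum_translate_le {g : ℤ → ℝ} (hg : ∀ n, 0 ≤ g n) {M : Finset ℤ} (hM : ∀ n ∉ M, g n = 0)
    (s : Finset ℤ) (j : ℤ) : ∑ n ∈ s, g (n + j) ≤ ∑ n ∈ M, g n := by
  calc ∑ n ∈ s, g (n + j) = ∑ n ∈ s.map (addRightEmbedding j), g n := by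
        rw [Finset.sum_map]; rfl
    _ ≤ ∑ n ∈ s.map (addRightEmbedding j) ∪ M, g n :=
        Finset.sum_le_sum_of_subset_of_nonneg Finset.subset_union_left fun n _ _ => hg n
    _ = ∑ n ∈ M, g n :=
        (Finset.sum_subset Finset.subset_union_right fun n _ hn => hM n hn).symm

/-- An approximate eigenfunction looks like a generalized eigenfunction around some point. -/
theorem IsApproxEigen.exists_point {N : ℕ} {u : ℤ → ℝ} (h : IsApproxEigen V E δ N u) (hδ : 0 < δ)
    (L : ℕ) : ∃ n, u n ≠ 0 ∧ ∀ j : ℤ, |j| ≤ L + 1 → u (n + j) ^ 2 ≤ 8 * (L + 2) * u n ^ 2 ∧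
      (u (n + j + 1) + u (n + j - 1) + V (n + j) * u (n + j) - E * u (n + j)) ^ 2
        ≤ 8 * (L + 2) * δ * u n ^ 2 := by
  obtain ⟨h0, ⟨m, hm⟩, h1⟩ := h
  set r : ℤ → ℝ := fun n => u (n + 1) + u (n - 1) + V n * u n - E * u n with hr
  set g : ℤ → ℝ := fun n => u n ^ 2 + δ⁻¹ * r n ^ 2 with hg
  have hg0 : ∀ n, 0 ≤ g n := fun n => by positivity
  set S := ∑ n ∈ Finset.Icc (-N : ℤ) N, u n ^ 2
  have hsupp : ∀ n ∉ Finset.Icc (-(N + 1) : ℤ) (N + 1), g n = 0 := by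
    intro n hn
    rw [Finset.mem_Icc] at hn
    simp only [hg, hr]
    rw [h0 (n + 1) (by rw [Finset.mem_Icc]; omega), h0 (n - 1) (by rw [Finset.mem_Icc]; omega),
      h0 n (by rw [Finset.mem_Icc]; omega)]
    ring
  have hS : ∑ n ∈ Finset.Icc (-(N + 1) : ℤ) (N + 1), u n ^ 2 = S := by
    refine (Finset.sum_subset (Finset.Icc_subset_Icc (by omega) (by omega)) fun n _ hn => ?_).symm
    rw [h0 n hn]; ring
  have hG : ∑ n ∈ Finset.Icc (-(N + 1) : ℤ) (N + 1), g n ≤ 2 * S := by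
    simp only [hg]
    rw [Finset.sum_add_distrib, hS, ← Finset.mul_sum]
    have : δ⁻¹ * ∑ n ∈ Finset.Icc (-(N + 1) : ℤ) (N + 1), r n ^ 2 ≤ δ⁻¹ * (δ * S) := by
      gcongr
    rw [inv_mul_cancel_left₀ hδ.ne'] at this
    linarith
  obtain ⟨n, hn, hle⟩ : ∃ n, u n ≠ 0 ∧
      ∑ j ∈ Finset.Icc (-(L + 1) : ℤ) (L + 1), g (n + j) ≤ 8 * (L + 2) * u n ^ 2 := by
    by_contra! hcon
    have hlt : ∑ n ∈ Finset.Icc (-N : ℤ) N, 8 * (L + 2) * u n ^ 2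
        < ∑ n ∈ Finset.Icc (-N : ℤ) N, ∑ j ∈ Finset.Icc (-(L + 1) : ℤ) (L + 1), g (n + j) := by
      refine Finset.sum_lt_sum (fun n _ => ?_) ⟨m, ?_, hcon m hm⟩
      · by_cases hn : u n = 0
        · rw [hn]
          simpa using Finset.sum_nonneg fun j _ => hg0 (n + j)
        · exact (hcon n hn).le
      · by_contra hc
        exact hm (h0 m hc)
    rw [Finset.sum_comm, ← Finset.mul_sum] at hlt
    have hle : ∑ j ∈ Finset.Icc (-(L + 1) : ℤ) (L + 1), ∑ n ∈ Finset.Icc (-N : ℤ) N, g (n + j)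
        ≤ ∑ j ∈ Finset.Icc (-(L + 1) : ℤ) (L + 1), 2 * S :=
      Finset.sum_le_sum fun j _ => (sum_translate_le hg0 hsupp _ j).trans hG
    rw [Finset.sum_const, Int.card_Icc, nsmul_eq_mul,
      show ((L : ℤ) + 1 + 1 - -((L : ℤ) + 1)).toNat = 2 * L + 3 by omega] at hle
    push_cast at hle
    have hS0 : 0 ≤ S := Finset.sum_nonneg fun n _ => sq_nonneg _
    have hL : (0 : ℝ) ≤ L := Nat.cast_nonneg L
    nlinarith [mul_nonneg hL hS0]
  refine ⟨n, hn, fun j hj => ?_⟩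
  have hjm : j ∈ Finset.Icc (-(L + 1) : ℤ) (L + 1) := by
    rw [Finset.mem_Icc]; rwa [abs_le] at hj
  have hgj : g (n + j) ≤ 8 * (L + 2) * u n ^ 2 :=
    (Finset.single_le_sum (f := fun j => g (n + j)) (fun j _ => hg0 (n + j)) hjm).trans hle
  have hr0 : 0 ≤ δ⁻¹ * r (n + j) ^ 2 := by positivity
  have hu0 := sq_nonneg (u (n + j))
  have hgj' : u (n + j) ^ 2 + δ⁻¹ * r (n + j) ^ 2 ≤ 8 * (L + 2) * u n ^ 2 := hgj
  refine ⟨by linarith, ?_⟩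
  have : δ⁻¹ * r (n + j) ^ 2 ≤ 8 * (L + 2) * u n ^ 2 := by linarith
  rw [inv_mul_le_iff₀ hδ] at this
  calc _ ≤ _ := this
    _ = _ := by ring

theorem exists_solution_of_mem_spectrum (h𝒜 : 𝒜.Finite) (hval : ∀ ω ∈ Ω, ∀ n : ℤ, ω n ∈ 𝒜)
    (hΩ : IsSubshift Ω) (hV : V ∈ Ω) (hH : IsSchrodingerOp V H) (hE : E ∈ spectrum ℝ H) (L : ℕ) :
    ∃ ω ∈ Ω, ∃ v : ℤ → ℝ, v L = 1 ∧ (∀ j : ℤ, 0 ≤ j → j ≤ 2 * L + 1 → v j ^ 2 ≤ 8 * (L + 2)) ∧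
      ∀ j : ℤ, 1 ≤ j → j ≤ 2 * L → v (j + 1) + v (j - 1) + ω j * v j = E * v j := by
  set K : ℝ := 8 * (L + 2) with hK
  have hK0 : 0 < K := by positivity
  have happrox : ∀ i : ℕ, ∃ p : (ℤ → ℝ) × (ℤ → ℝ), (p.1 ∈ Ω ∧ p.2 ∈ boundedSeq (√K)) ∧
      p.2 L = 1 ∧ ∀ j : ℤ, 1 ≤ j → j ≤ 2 * L →
        (p.2 (j + 1) + p.2 (j - 1) + p.1 j * p.2 j - E * p.2 j) ^ 2 ≤ K * (1 / ((i : ℝ) + 1)) := by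
    intro i
    have hδ : (0 : ℝ) < 1 / ((i : ℝ) + 1) := by positivity
    obtain ⟨N, u, hu⟩ := exists_isApproxEigen hH hE hδ
    obtain ⟨n, hn, hnj⟩ := hu.exists_point hδ L
    set v : ℤ → ℝ := fun j => if 0 ≤ j ∧ j ≤ 2 * L + 1 then u (n + (j - L)) / u n else 0 with hv
    have hv1 : ∀ j : ℤ, 0 ≤ j → j ≤ 2 * L + 1 → v j = u (n + (j - L)) / u n := fun j h1 h2 =>
      if_pos ⟨h1, h2⟩
    have hn2 : 0 < u n ^ 2 := by positivity
    refine ⟨(translate (n - L) V, v), ⟨translate_mem hΩ _ hV, fun j => ?_⟩, ?_, fun j h1 h2 => ?_⟩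
    · refine Real.abs_le_sqrt ?_
      change v j ^ 2 ≤ K
      by_cases h : 0 ≤ j ∧ j ≤ 2 * L + 1
      · rw [hv1 j h.1 h.2, div_pow, div_le_iff₀ hn2]
        exact (hnj (j - L) (by rw [abs_le]; omega)).1
      · have : v j = 0 := if_neg h
        rw [this]
        simpa using hK0.le
    · change v L = 1
      rw [hv1 L (by omega) (by omega), sub_self, add_zero, div_self hn]
    · change (v (j + 1) + v (j - 1) + V (j + (n - L)) * v j - E * v j) ^ 2 ≤ _
      have := (hnj (j - L) (by rw [abs_le]; omega)).2
      rw [hv1 _ (by omega) (by omega), hv1 _ (by omega) (by omega), hv1 _ (by omega) (by omega)]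
      rw [show n + (j + 1 - (L : ℤ)) = n + (j - L) + 1 by ring,
        show n + (j - 1 - (L : ℤ)) = n + (j - L) - 1 by ring,
        show j + (n - (L : ℤ)) = n + (j - L) by ring]
      have e : ∀ a b c d : ℝ, a / u n + b / u n + c * (d / u n) - E * (d / u n)
          = (a + b + c * d - E * d) / u n := fun a b c d => by ring
      rw [e, div_pow, div_le_iff₀ hn2]
      exact this
  choose p hp hpL hpj using happrox
  have hcpt : IsCompact (Ω ×ˢ boundedSeq (√K)) :=
    (isCompact_subshift h𝒜 hval hΩ).prod (isCompact_boundedSeq _)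
  obtain ⟨⟨ω, v⟩, ⟨hω, hv⟩, φ, hφ, hlim⟩ := hcpt.tendsto_subseq (x := p) fun i => hp i
  refine ⟨ω, hω, v, ?_, fun j _ _ => ?_, fun j h1 h2 => ?_⟩
  · have hc : Continuous fun q : (ℤ → ℝ) × (ℤ → ℝ) => q.2 (L : ℤ) := by fun_prop
    refine tendsto_nhds_unique ((hc.tendsto _).comp hlim) ?_
    exact tendsto_const_nhds.congr fun i => (hpL (φ i)).symm
  · have := hv j
    calc v j ^ 2 = |v j| ^ 2 := (sq_abs _).symm
      _ ≤ √K ^ 2 := by gcongr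
      _ = K := Real.sq_sqrt hK0.le
  · have hc : Continuous fun q : (ℤ → ℝ) × (ℤ → ℝ) =>
        (q.2 (j + 1) + q.2 (j - 1) + q.1 j * q.2 j - E * q.2 j) ^ 2 := by fun_prop
    have hz : Tendsto (fun i => K * (1 / ((φ i : ℝ) + 1))) atTop (𝓝 0) := by
      have := (tendsto_one_div_add_atTop_nhds_zero_nat (𝕜 := ℝ)).comp hφ.tendsto_atTop
      simpa using this.const_mul K
    have hle := le_of_tendsto_of_tendsto' ((hc.tendsto _).comp hlim) hz fun i => hpj (φ i) j h1 h2
    have h0 := pow_eq_zero_iff (two_ne_zero) |>.1 (le_antisymm hle (sq_nonneg _))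
    linarith

theorem volume_spectrum_eq_zero {ν : Measure (ℤ → ℝ)} [IsProbabilityMeasure ν] (h𝒜 : 𝒜.Finite)
    (hval : ∀ ω ∈ Ω, ∀ n : ℤ, ω n ∈ 𝒜) (hmin : IsMinimalSubshift Ω)
    (haper : IsAperiodicSubshift Ω) (hT : Ergodic (shift ℝ) ν) (hν : ν Ωᶜ = 0) {C : ℝ} (hC : 0 < C)
    {l : ℕ → ℕ} (hl : Tendsto l atTop atTop)
    (hB : ∀ n : ℕ, ∀ w : List ℝ, IsWordOf Ω w → w.length = l n →
      C ≤ (w.length : ℝ) * (ν (Vset Ω w)).toReal)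
    (hV : V ∈ Ω) (hH : IsSchrodingerOp V H) : volume (spectrum ℝ H) = 0 := by
  refine volume_eq_zero_of_lyapunov h𝒜 hval hmin ⟨V, hV⟩ haper hT.toMeasurePreserving hν
    (spectrum.isCompact H) fun E hE => ?_
  obtain ⟨R₀, hR₀, hΩR₀⟩ := exists_subset_boundedSeq h𝒜 hval
  have hR : 0 ≤ |E| + R₀ := by positivity
  have hΩR : ∀ ω ∈ Ω, ∀ n, |E - ω n| ≤ |E| + R₀ := fun ω hω n =>
    (abs_sub _ _).trans (by have := hΩR₀ hω n; gcongr)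
  have hmem : ∀ᵐ ω ∂ν, ω ∈ Ω := mem_ae_iff.2 hν
  have hνR : ∀ᵐ ω ∂ν, ∀ n, |E - ω n| ≤ |E| + R₀ := by
    filter_upwards [hmem] with ω hω using hΩR ω hω
  obtain ⟨Λ, hΛ0, hΛ, hΛ'⟩ := exists_lyapunov hT hR hνR
  have := lyapunov_eq_zero hmin.1 hR hΩR hl hΛ0
    (fun ε hε => eventually_abs_logNorm_sub_le h𝒜 hval hmin.1 haper hR hΩR hC hl hB hνR hΛ' hε)
    (exists_solution_of_mem_spectrum h𝒜 hval hmin.1 hV hH hE)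
  rwa [this] at hΛ

end

end ZeroMeasure

/-- zero-measure Cantor spectrum for minimal aperiodic subshifts
satisfying (B). -/
theorem stmt1 (Ω : Set (ℤ → ℝ)) (𝒜 : Set ℝ) (h𝒜 : 𝒜.Finite)
    (hval : ∀ ω ∈ Ω, ∀ n : ℤ, ω n ∈ 𝒜)
    (hmin : IsMinimalSubshift Ω) (haper : IsAperiodicSubshift Ω) (hB : CondB Ω) :
    ∃ Sigma₀ : Set ℝ, IsCantorSet Sigma₀ ∧ MeasureTheory.volume Sigma₀ = 0 ∧
      ∀ ω ∈ Ω, ∀ H : lp (fun _ : ℤ => ℝ) 2 →L[ℝ] lp (fun _ : ℤ => ℝ) 2,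
        IsSchrodingerOp ω H → spectrum ℝ H = Sigma₀ := by
  obtain ⟨ν, hprob, hν, hT, C, hC, l, hl, hword⟩ := hB
  by_cases hex : ∃ ω₀ ∈ Ω, ∃ H₀, IsSchrodingerOp ω₀ H₀
  · obtain ⟨ω₀, hω₀, H₀, hH₀⟩ := hex
    have hvol : volume (spectrum ℝ H₀) = 0 :=
      ZeroMeasure.volume_spectrum_eq_zero h𝒜 hval hmin haper hT hν hC hl hword hω₀ hH₀
    refine ⟨spectrum ℝ H₀, ⟨spectrum.isCompact H₀, Measure.interior_eq_empty_of_null hvol,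
      fun E hE => ZeroMeasure.accPt_spectrum h𝒜 hval hmin hω₀ hH₀ hE⟩, hvol, fun ω hω H hH => ?_⟩
    exact (ZeroMeasure.spectrum_subset_spectrum h𝒜 hval hmin hω hH hω₀ hH₀).antisymm
      (ZeroMeasure.spectrum_subset_spectrum h𝒜 hval hmin hω₀ hH₀ hω hH)
  · refine ⟨∅, ⟨isCompact_empty, interior_empty, fun x hx => hx.elim⟩, measure_empty,
      fun ω hω H hH => ?_⟩
    exact absurd ⟨ω, hω, H, hH⟩ hex
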